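/- Let c_4 denote the limit inferior, as n tends to infinity, of k_4(n) / C(n,4), where k_4(n) is the minimum over all simple graphs G on n vertices of the number of 4-cliques in G plus the number of 4-cliques in the complement of G. Then c_4 ≥ 204603019/7112448000. -/

import Mathlib

open scoped Classical

/-- `k4 n` is the minimum, over all simple graphs `G` on `n` vertices, of the number of
4-cliques of `G` plus the number of 4-cliques of the complement of `G`. -/
noncomputable def k4 (n : ℕ) : ℕ :=
  sInf { m | ∃ G : SimpleGraph (Fin n),
    m = (G.cliqueFinset 4).card + (Gᶜ.cliqueFinset 4).card }

/-- `c4` is the limit inferior of `k4 n / (n choose 4)` as `n → ∞`. -/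
noncomputable def c4 : ℝ :=
  Filter.liminf (fun n : ℕ => (k4 n : ℝ) / (n.choose 4 : ℝ)) Filter.atTop


inductive Lf where
  | mk (row sh : Nat) (vec : List Nat) : Lf

inductive Tr where
  | leaf (l : Lf) : Tr
  | node (f t : Tr) : Tr

def Lf.row (l : Lf) : Nat := Lf.casesOn l fun r _ _ => r
def Lf.sh (l : Lf) : Nat := Lf.casesOn l fun _ s _ => s
def Lf.vec (l : Lf) : List Nat := Lf.casesOn l fun _ _ v => v

def Tr.get (t : Tr) (b : Bool) : Tr :=
  Tr.casesOn t (fun _ => t) (fun f t => Bool.casesOn b f t)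

def Tr.lf (t : Tr) : Lf := Tr.casesOn t (fun l => l) (fun _ _ => Lf.mk 0 0 [])

def Tr.path (t : Tr) (x0 x1 x2 y0 y1 y2 z : Bool) : Lf :=
  (((((((t.get x0).get x1).get x2).get y0).get y1).get y2).get z).lf

def entry (l m : Lf) : Nat := Nat.mod (Nat.shiftRight l.row m.sh) 1073741824

def lfA0 : Lf := .mk 49563743931335149617751960078501142968148653977020627518551820852420810032527778276662653796412851992204715020824928483934572841079599261221886155223745871819827759882239272613028878899178155591571189234024784042440976871876394744865342856512735674328604566504366570216354115137224756650100933023276682472375479745279484297744425552588464381707802193399556458687676314253513723184042059230239925227732164918955226276681668063189896420695896873608039800582784880487982116858154492214717497581902403466581719569078380325864093907021051770029986521036958321364505917220871443346501219968818357049531924240274335458070437364479589089327740275899172094861 0 [158580679, 155644725, 153341192, 133891936, 133831267, 133742652, 134623151, 135236249, 133193801, 132406428, 136151722, 135412962, 136305736, 137162020, 135065315, 135367398, 134056799, 137163807, 134641259, 133568523, 134449678, 134970285, 134385850, 134617496, 134722333, 133957498, 134685578, 133652149, 133750506, 133379950, 133488801, 133441883, 134436189, 133888823, 134146302, 134328253,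 134161817, 134215642, 134366806, 134176892, 134194442, 134495024, 134267152, 134267905, 134157984, 134184298, 134210268, 134251121, 134236268, 134170955, 134189656, 134348633, 134096011, 134291950, 134258906, 134304411, 134248639, 134259362, 134282006, 134198618, 134268402, 134194819, 134224561, 134314419, 134217728]
def lfA1 : Lf := .mk 37244950252074708429062375600506328648608209122383009855189705183589566393022648663160007133752765565665709034409492721534859666964594697956173416352631608422773714749936416388559435892301564774272883155458520379511815835009603616296774986909488004158728168222522485708721893869962716568139909649739223472954097737422889400408150834551660326364938003831914818547426590166264775719946055848988078256837158298857112465690397049220398158779092484299905194781789014572473822034017792037820052528427608545577229729532544539467661147276687718520324138804503267736420387140124792763366723238529648400519697050645203987419873855010758665474973179711202463223 30 [117145610, 137684095, 137311439, 145536719, 133331899, 147747505, 141422150, 114932682, 145750638, 135560065, 130995266, 122640630, 121789643, 119726521, 118954034, 134147242, 134461174, 134430897, 134420842, 135811864, 135095798, 133126762, 132891476, 134613542, 134034999, 134077416, 134174453, 134563257, 132984063, 133860647, 135907610, 133830998, 134120879, 134429788, 133902202, 134728462, 135080363, 133383261, 134934122, 137147046, 134217728, 134217728, 134217728, 134217728,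 134217728, 134217728, 134217728, 134217728, 134217728, 134217728, 134217728, 134217728, 134217728, 134217728, 134217728, 134217728, 134217728, 134217728, 134217728, 134217728, 134217728, 134217728, 134217728, 134217728, 134217728]
def lfA2 : Lf := .mk 29523965720152396267770678589426076979649985851126806049482647084294780429989851105462905650731086077098198898916515437861119776632757125271538528287791519670100343005337994662260057311080699856679447878822143496997138173817214010607151673958514361781242814936079469642408640513461132488801512337437369503390296224348124030272995171790587491204127952173401465569997053874470032241245915783868139538951001592874043366874003447353132914397049907465266129534683274370402869595094709059901090765223261963366603673450138037586106194602402186298844667166495820448124608166977019059815767009150501020494223201748219115598049573935121476333824723694741413276 60 [88966172, 119251797, 120860726, 121723987, 207023650, 134217728, 134217728, 134217728, 134217728, 134217728, 134217728, 134217728, 134217728, 134217728, 134217728, 134217728, 134217728, 134217728, 134217728, 134217728, 134217728, 134217728, 134217728, 134217728, 134217728, 134217728, 134217728, 134217728, 134217728, 134217728, 134217728, 134217728, 134217728, 134217728, 134217728, 134217728, 134217728, 134217728, 134217728, 134217728, 134217728, 134217728, 134217728, 134217728, 134217728, 134217728, 134217728, 134217728, 134217728, 134217728, 134217728, 134217728,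 134217728, 134217728, 134217728, 134217728, 134217728, 134217728, 134217728, 134217728, 134217728, 134217728, 134217728, 134217728, 134217728]
def lfA3 : Lf := .mk 37244950251239457770212456531990359593276390798577373020122176370359752980603106336496580910106549596843890337247719506894683416341238505111112345603872967772594418712797710621669648911288803749016374091260451126949429858956184668105013167775547592606739323988974526591494277906000971193728866430018996058767050055517456196289108179214320751905580730399793486330011446596125488041971010052836845745459533286447963152617204960779887549197783336190941374902261305563966493370882657824185526617329467911026418623255802508398729344578553091421861715773131428981559887632943991509756778996762339193394288024807238901565772452572287517405515024086360591863 90 [135475419, 135323856, 116604135, 131430267, 145223831, 147747505, 141422150, 142842845, 145946093, 152532430, 120923933, 133631090, 129767265, 118215534, 140904680, 143488020, 134861698, 123217850, 133855628, 134298337, 131922878, 133297313, 134491610, 134219195, 134024198, 134274012, 134611866, 134481587, 134556044, 133767066, 133889239, 135274010, 134228485, 133667459, 133983748, 134265957, 134280277, 137385152, 134217728, 134217728, 134217728, 134217728, 134217728, 134217728, 134217728, 134217728, 134217728, 134217728, 134217728, 134217728, 134217728, 134217728, 134217728, 134217728, 134217728, 134217728, 134217728, 134217728, 134217728, 134217728,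 134217728, 134217728, 134217728, 134217728, 134217728]
def lfA4 : Lf := .mk 36589867309658505823938876331776252206102440841629838782625411235466595264854729307461585058768636840826138703993561649214318881331316918554451257851378151495932929824121893229631814012908827956006280233049265695570158287906679754472076577962740999869038671160133679985750710314433750913774263034900131533475571750729255588606717867747562404324844749250820167636871434269882279932392506849671020127846768026274090870391595878117029318443292169352627864774179980383004489670256944147267901285059861011621591627913716512810297499921465329616958329558531436494141551801999639035594469848622424374202989899070104787252748248374723855394429345769087980078 120 [120617706, 142783877, 121202805, 142840075, 144445732, 152110686, 143158320, 133834227, 188980112, 134217728, 134217728, 134217728, 134217728, 134217728, 134217728, 134217728, 134217728, 134217728, 134217728, 134217728, 134217728, 134217728, 134217728, 134217728, 134217728, 134217728, 134217728, 134217728, 134217728, 134217728, 134217728, 134217728, 134217728, 134217728, 134217728, 134217728, 134217728, 134217728, 134217728, 134217728, 134217728, 134217728, 134217728, 134217728, 134217728, 134217728, 134217728, 134217728, 134217728, 134217728, 134217728, 134217728, 134217728, 134217728, 134217728, 134217728, 134217728, 134217728, 134217728, 134217728, 134217728, 134217728, 134217728, 134217728, 134217728]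
def lfA5 : Lf := .mk 29523965721203167807125793826746869879721589591646456251920337532112395026641822798842249129889934479879015648399976366662135306763402656004478501937110550822389509950403235175296493281652540155907146445469021424723896119422584055221744076741634168208095909641352154023800996184005763099042814476300320510979062189653962579076780190513429546792722945288674210213635894946620411179440769697229945612325656502578154661405892063163944645996469968110877268063922199544055916099183520029781400554940649622824900322105221072772080320151544041302379178693040177723790389403019040677896149381425710062676143033405379877633292612145938196602576355445759073692 150 [113595239, 116080433, 93037109, 208087857, 134217728, 134217728, 134217728, 134217728, 134217728, 134217728, 134217728, 134217728, 134217728, 134217728, 134217728, 134217728, 134217728, 134217728, 134217728, 134217728, 134217728, 134217728, 134217728, 134217728, 134217728, 134217728, 134217728, 134217728, 134217728, 134217728, 134217728, 134217728, 134217728, 134217728, 134217728, 134217728, 134217728, 134217728, 134217728, 134217728, 134217728, 134217728, 134217728, 134217728, 134217728, 134217728, 134217728, 134217728, 134217728, 134217728, 134217728, 134217728, 134217728, 134217728, 134217728, 134217728, 134217728, 134217728, 134217728, 134217728, 134217728, 134217728, 134217728, 134217728, 134217728]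
def lfA6 : Lf := .mk 31429810184371052367899289692699931911712935470786592019035819252245479055915054723905168874763012420190933047655580832602842935212347567160803398207144567509992893130300327247176209374955561586020200355768622687936143072616161057596798558815819981126251467991268380097934619822099651835069104586165446789156734412422548193186336470841804090721493423181746844495644867586315510598729625602683891851236088809017233684278557072878369547886630076876527329823805495745662985471553344457963030367480282739558670486246830576911486807034432419870147615657586194273301699308913817415646894192471917790366719425694291684336184404275632700164741683569589042740 180 [103123761, 126258249, 107601024, 141782455, 143191161, 152926620, 149148349, 131236844, 146912035, 138892682, 132680084, 131015662, 133654329, 124836086, 128846765, 145817068, 132915882, 132283378, 133894912, 135829795, 132975940, 130875519, 134153534, 135132059, 134096905, 135089503, 134721493, 135918878, 134116144, 132575860, 135299186, 134987520, 134506223, 134159675, 135198690, 134376239, 134175152, 135502460, 134223624, 136027717, 135433681, 134135345, 133708125, 133769099, 134289096, 133960459, 134142624, 133405868, 134085974, 133983584, 133671656, 134239030, 134582893, 134618394, 133692627, 134070573, 134299942, 134184352, 134272464, 134367630, 134217728, 134217728, 134217728, 134217728, 134217728]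
def lfA7 : Lf := .mk 35114840667932978192507788732533317183393429776954049558319282959125535359510165657359088996280631269705873422872397095723792367262009742616923210561042512419790443317805680438901325492483480643576981876244573583965145591620027082043980976324413375955398536891912029375687440074961553329483806057180412497791420826771572771899665258729042487920197230830867251395905291143066346878350233910970984090322699570357140926423292581914099228548076846968147579346316787050819484253185644305359864640238977000948238395035541427268399580857902062245678651593735118814820206887218571253010555086300098828708607837458837686619998780807946713017029974494547713059 210 [101411682, 145847633, 108375068, 129545951, 177195331, 129639619, 139340181, 155829978, 164041970, 135742761, 125784969, 166103496, 142566271, 138973020, 144147709, 147561532, 122935998, 127588400, 128422327, 135973082, 132544594, 135027186, 143792465, 134217728, 134217728, 134217728, 134217728, 134217728, 134217728, 134217728, 134217728, 134217728, 134217728, 134217728, 134217728, 134217728, 134217728, 134217728, 134217728, 134217728, 134217728, 134217728, 134217728, 134217728, 134217728, 134217728, 134217728, 134217728, 134217728, 134217728, 134217728, 134217728, 134217728, 134217728, 134217728, 134217728, 134217728, 134217728, 134217728, 134217728, 134217728, 134217728, 134217728, 134217728, 134217728]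
def lfA8 : Lf := .mk 35114840671073099084524023493359837566801159477910871895812291567745833712590731821807297158331194457543183696178983376290631135306949558743425688451382225075924611816432681547830090411008105292002754697697608889532903430665717647948558070916579098328746484111180546573963405278582442378911215427685751528849305851994057475540413914201137764422309996351724281100769622417039970008191479744412765119898856380131334947876430546191850689705238550664836638612710991243285862756864325387300523802627496446173019759967347250664900014850286633039003024170940588305807982253937596962291091753121698157433398060053782676119984589560049023812713330914876890147 240 [105868164, 145273794, 103340550, 177366319, 136882107, 129639619, 139340181, 117619141, 163774379, 119491295, 150439332, 110459251, 133279146, 156541886, 117849144, 137317316, 135928474, 138438980, 139157232, 130784988, 137615439, 131994037, 128447315, 133069165, 135950322, 135597073, 135410414, 137367353, 135870010, 135477142, 134204721, 134975196, 131979158, 134240925, 137980439, 134217728, 134217728, 134217728, 134217728, 134217728, 134217728, 134217728, 134217728, 134217728, 134217728, 134217728, 134217728, 134217728, 134217728, 134217728, 134217728, 134217728, 134217728, 134217728, 134217728, 134217728, 134217728, 134217728, 134217728, 134217728, 134217728, 134217728, 134217728, 134217728, 134217728]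
def lfA9 : Lf := .mk 56185015446600753188283206034001269020721140984677445277549405380039475711934497950650763165551922979094916353828393984363867007064212423440813339370703310274937032513840331001368143193147299840698419017809616817550590337102206276081844477740898230576607708430540956835488300878894642035820820394588629147955505007660294918024645651805061933777388138380160018516454461319124662042674347761094809588695191265169153592984790934072823254047799525686455138549977852202917572744905305250582662611406055409682547944602156190698264694883326287821670283177614979248121741503021449765616236766711463703418656987031807199636542372392353784171091505148906595486 270 [148935609, 248517980, 134217728, 134217728, 134217728, 134217728, 134217728, 134217728, 134217728, 134217728, 134217728, 134217728, 134217728, 134217728, 134217728, 134217728, 134217728, 134217728, 134217728, 134217728, 134217728, 134217728, 134217728, 134217728, 134217728, 134217728, 134217728, 134217728, 134217728, 134217728, 134217728, 134217728, 134217728, 134217728, 134217728, 134217728, 134217728, 134217728, 134217728, 134217728, 134217728, 134217728, 134217728, 134217728, 134217728, 134217728, 134217728, 134217728, 134217728, 134217728, 134217728, 134217728, 134217728, 134217728, 134217728, 134217728, 134217728, 134217728, 134217728, 134217728, 134217728, 134217728, 134217728, 134217728, 134217728]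
def lfA10 : Lf := .mk 37244950251239457769434568735067755423021646036475101570108621352778729167124553227085690300230640233729883282997822386376689410269451839596493462278251471831874798818832235961025989190387589680494129521388773812813400818631849339117858807852442312176165747061756066297450553374376462020605412356057520965578542452672129782665455718608572024392454857656826211936911753370880530150226142336160055957819999190237067331370993777330381216601258319835421980566284071584855902518607538074081285360855379301728812950669591461263754831990343390577300629172087910824454285290373878426952087900673110823744447991826617525765031645600735794440901165607259409911 300 [135475419, 116842713, 137311439, 145536718, 147644545, 136104559, 114650789, 129684935, 128164908, 144932061, 122043255, 127116789, 120378344, 122154568, 139820635, 120858030, 133858844, 134391230, 133749139, 133969207, 135071298, 132814115, 134082122, 133123294, 134193590, 132959234, 133832527, 132790821, 134286872, 136077555, 133948725, 133996320, 133630083, 134494756, 133138980, 133967440, 134465154, 133274483, 134729043, 132796062, 132796510, 133111723, 134796977, 134786491, 134166733, 134441830, 134283021, 135582098, 134217728, 134217728, 134217728, 134217728, 134217728, 134217728, 134217728, 134217728, 134217728, 134217728, 134217728, 134217728, 134217728, 134217728, 134217728, 134217728, 134217728]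
def lfA11 : Lf := .mk 36589867309658505824169093199976411530860293733703947595951495762563997637750038563819849250442910001441628788454146397623595063199035819765644051128013957554795368016005937632159096432016677356954770006499104154342161486351004878439270852880467827541446253532197553571167632493186095514250809431827688058780145258114460495200997259609299745148387130819572479767393886508218052127478091352170136833391710370354106528073775279638732946187286961106104222701985852077690969788858690448149519360190491698884293773481929437431325729248147265906596395971996941493978987317816012195322183441284394307154340656976851544375984733508128605405098470541220008494 330 [120617706, 122256630, 144202680, 147973357, 145326620, 147873864, 128503322, 112616762, 111519193, 102716921, 119846065, 123677821, 119104971, 113411643, 136583530, 137303621, 132686056, 141141660, 133731225, 135602249, 134002200, 133182164, 132338646, 132708871, 133117927, 132824418, 133011851, 132183660, 132137333, 134867633, 134891383, 133940466, 134305527, 132395608, 133760635, 134308428, 134608940, 134618399, 134447939, 134684023, 133806332, 133628817, 134364387, 134362788, 134229386, 134281614, 134268920, 134498094, 134224083, 134246318, 134200804, 134163401, 134264167, 134180425, 134191086, 134161115, 134211662, 134215369, 134200771, 134217474, 134213627, 134200792, 134207613, 134217914, 134199606]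
def lfA12 : Lf := .mk 36589867309905699304447858290772284412119178453599515498387054822963487945314326178829403287823290398524935791889916378316738109091084872149710377557010203308803280625865395671800374153699328704902018979445981517958781132572506677510252878726832338521114647000440542293835522657987496223883253410352391630619930365846627115677649780616117381181044658439331487279319633670167783174778396239579067224896263222475939421434788518295205513696129764189619136788913124451627780480694367174812405577853465050026916709888951090279289785035896329762958349231459977117350901359324646320302771148948914144515308942731223031451247198575726847068427605257538130478 360 [140976865, 119635082, 121202805, 142840075, 149654048, 147873864, 128503323, 148198640, 111768373, 182662605, 134217728, 134217728, 134217728, 134217728, 134217728, 134217728, 134217728, 134217728, 134217728, 134217728, 134217728, 134217728, 134217728, 134217728, 134217728, 134217728, 134217728, 134217728, 134217728, 134217728, 134217728, 134217728, 134217728, 134217728, 134217728, 134217728, 134217728, 134217728, 134217728, 134217728, 134217728, 134217728, 134217728, 134217728, 134217728, 134217728, 134217728, 134217728, 134217728, 134217728, 134217728, 134217728, 134217728, 134217728, 134217728, 134217728, 134217728, 134217728, 134217728, 134217728, 134217728, 134217728, 134217728, 134217728, 134217728]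
def lfA13 : Lf := .mk 39097690754435838917527782301022468459296697787724028251535909086839329399168152974828465916695928500898942445742099785627576158735017217562978664397038989534883677279970088479953797281400476110504604122779746196141449724623235585526638361849514796035657033219916421104286254746924255660688492805547278017440754622230852414226781004427931279444785821417646737954972649245087060571429879863767566845845032482391147250115423863738134471113684307016347541567414799028603005837998658015178743664044518501693601916015437013767596234498408147533542990009750690130435049217905124287817006373097490867958985948521773554536382108800008694523244101735893353192 390 [148233747, 103737499, 150098674, 144967394, 146969202, 156122423, 132117827, 134602966, 127500662, 134246070, 137906820, 134496237, 139075485, 131888515, 138942995, 134474861, 136638160, 145165034, 133747856, 134854542, 135035132, 134456209, 133175774, 131408824, 134153306, 135126946, 133597832, 130590612, 134189655, 132364315, 133236424, 133441197, 134744911, 134166620, 134617491, 134602940, 133980678, 133967150, 134134283, 133883553, 134304309, 135072059, 134089765, 134054538, 134175118, 134245346, 134340597, 133805513, 134224915, 134467288, 134532901, 134269541, 133955430, 133843739, 134704890, 134237833, 134069177, 134437436, 134217728, 134217728, 134217728, 134217728, 134217728, 134217728, 134217728]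
def lfA14 : Lf := .mk 29523965721203167808104401085542608529029494805006273110287362436645948350692157472487003756385797897254097685909062513076892358338741037847923565024357286115494656142155896894577699575898962282498278397112928166834127951759551254067719876511574794995294623852764933504522238528685962799421061363635724932825009617710196024563343985212410508833841626082409361689053763820485094169953460149117111558228598073852729720734819493173436696822605317216555876098481654787580093877000008184994231782745284871093669413043995525639878286118472842998317148536112061671730925144578369242999659217564926818758242908930244489071941002253761767469754648451767655836 420 [113595239, 91248025, 120860726, 121723987, 119397398, 205499283, 134217728, 134217728, 134217728, 134217728, 134217728, 134217728, 134217728, 134217728, 134217728, 134217728, 134217728, 134217728, 134217728, 134217728, 134217728, 134217728, 134217728, 134217728, 134217728, 134217728, 134217728, 134217728, 134217728, 134217728, 134217728, 134217728, 134217728, 134217728, 134217728, 134217728, 134217728, 134217728, 134217728, 134217728, 134217728, 134217728, 134217728, 134217728, 134217728, 134217728, 134217728, 134217728, 134217728, 134217728, 134217728, 134217728, 134217728, 134217728, 134217728, 134217728, 134217728, 134217728, 134217728, 134217728, 134217728, 134217728, 134217728, 134217728, 134217728]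
def lfA15 : Lf := .mk 31429810184371052367147058026974128983627850187516774835820432983091791106640088968087841766343610572882706623718939172488129270056544251019189274658258553690474106258465366902866322014188773100004180802421981344684375713620764408485149980154957148101370429870315438520430870526558595376206068349881243324167711094271252490205309204455358968121858530279651300647970829760936879487552466750101293521519677879172548467881224573005123923921910117142661802293063302768656342620807446399126342009025632836848727045834641431801822979551711634609475662144783654098492325170948132315294963875815874933746881275196177260264157166509249837482785875275102633524 450 [103123761, 106870862, 129323736, 149191277, 144462540, 146811651, 125470550, 120280217, 132160904, 132426070, 133887140, 126467007, 123036548, 129635204, 127594510, 125280508, 134306227, 142650917, 134755769, 135895480, 136715532, 130352741, 133715192, 133600507, 133730064, 134249337, 133750323, 133994002, 133828253, 135445271, 135222473, 133275766, 133632465, 135137917, 133942338, 134002570, 134493055, 131624860, 133991464, 134805817, 133601924, 133680641, 134546525, 134223318, 134418740, 134730654, 134158551, 134456683, 134110590, 133746727, 133826386, 134016636, 133973963, 133657363, 134591246, 134034642, 134109839, 134251615, 134337370, 134169049, 134220663, 134236051, 134317371, 134217728, 134217728]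
def lfA16 : Lf := .mk 35114840667932978192797099092919812443354023055111953472564864365175745841230194197909070912071993333935706528038587002827553315820597686877783346641218384768872989870330859121559974734189556451298090199129232054485510315876106239279337054870846987626493603942018765003757520833810995642221974194798611961440301373121003866136649465876701824394807945932263190234919284536784520404355312961211738569766901271780889141928929967336934130582538540832057232137060944711662812235001189474686875372743319985234425206037256772432379087792271413903037700879136787237467854624722588486879861953146688900022237193863782333813821846968967901755701977178066033699 480 [101411682, 109858379, 148699438, 121967729, 175894882, 135894404, 102310990, 149639708, 109618659, 107941630, 120782375, 125587744, 134349741, 130409084, 138788864, 125900739, 137055152, 144636160, 133531044, 127892678, 132601213, 131027268, 130797724, 130341747, 130807786, 132422666, 132871658, 132711221, 132164133, 135482104, 134982357, 135303005, 133331073, 134963509, 134213608, 132837862, 135050830, 133352073, 133351220, 133735417, 135091138, 134053105, 133637047, 133347796, 135333715, 135145430, 133651743, 133927261, 134111859, 134069851, 133440042, 134208341, 134177622, 134365896, 134396509, 133972052, 134194637, 134248775, 134394793, 134217728, 134217728, 134217728, 134217728, 134217728, 134217728]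
def lfA17 : Lf := .mk 39097690754435838915539822937780267093929950714614790734628237705978273413782598899730202289150249387992576165449884279896625821524362383165581568213089508275658098711573758139237001777100569896380955768315158254409649785676922378702501909253270330965922615986463991174138718757950544878287821305193653206270874118911592644818034961006414098860445164524485860882783336687566336518983392576124769636397697946616111467715559520665302101128278079044527004130108628278597372933131915799345752206579148167230055116129541309126854249903781989687178840084565969996126329094006668803953458959920712482287368247544693203635943981891850948890068233166915027688 510 [148233747, 146544692, 102135104, 150978443, 148000718, 151161126, 135836603, 137871175, 137075161, 138178361, 139323110, 135865589, 132577982, 140294831, 139670754, 141220952, 131421114, 140557359, 132125840, 133003228, 132788456, 134514275, 133301837, 135321850, 135686527, 133031503, 132005475, 134943401, 135323205, 132925916, 133126821, 131795720, 135118550, 131788520, 134403979, 134475280, 133995234, 133743114, 134242591, 133751199, 134739728, 134740797, 133980669, 134325960, 134296958, 134120458, 134211882, 133950283, 134186240, 134514388, 134452848, 134310721, 134304532, 134823364, 133973817, 134202334, 134499899, 134217728, 134217728, 134217728, 134217728, 134217728, 134217728, 134217728, 134217728]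
def lfA18 : Lf := .mk 37023455895768323060897108047552906819171496106869138937450670910573564426286364543428559486704935416291947407586182914227528885512808208038181684805288892301939778991670112701503032951285451922076437792322039577414586249150590162256772400654074746366591967808565231473788105430783719240969902241829996228075187246496274457425048581072413065110825340663068521187229998047998742871860252931997498651487168877124536440454572417729025690689725625236950529223232819056780712994119150518397907440845707557868607700418975923397114214795737381169808424982293125971045684781371932335203105820619813982268992618244549370069009694103216709758122719180015543304 540 [131176835, 113913449, 116096284, 127127240, 145146698, 127899248, 112257930, 161383228, 133856593, 140798535, 117752743, 146580768, 130355617, 120555438, 135485798, 134921470, 128044222, 128471045, 127605909, 130679693, 132028749, 134159153, 136976735, 129513935, 132553650, 133522333, 130890137, 133413605, 133857423, 134393812, 134225332, 134898685, 135480568, 135069862, 133182010, 133186100, 137469526, 134217728, 134217728, 134217728, 134217728, 134217728, 134217728, 134217728, 134217728, 134217728, 134217728, 134217728, 134217728, 134217728, 134217728, 134217728, 134217728, 134217728, 134217728, 134217728, 134217728, 134217728, 134217728, 134217728, 134217728, 134217728, 134217728, 134217728, 134217728]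
def lfA19 : Lf := .mk 35114840671073099087737799335209618711614962979231704108499067978996308309953800070294319123713300476841821361043292603786556267466256843235902355617750587508102145258116194821732347476090678244183575366940608875984387004069473248006099066201778626271534551558497487502622225917974733466256414052142688344685395362415904883053506089054950900493098568177664613292188624198307317752030107409435833125584357663983268440481997309924741213008964013271270262177003657669161160784294467569194469402549895613675199996513367464372527817180237046827683285105574948014071689051386216854025650328293678050295300100090974841488195392641094481804512284215088946211 570 [105868164, 104791264, 148699438, 121967728, 127375522, 175363574, 162673434, 102607388, 123456670, 107892693, 137074794, 141374679, 136970935, 125691840, 122934453, 134297329, 131934676, 144113699, 140330836, 145159122, 134217728, 134217728, 134217728, 134217728, 134217728, 134217728, 134217728, 134217728, 134217728, 134217728, 134217728, 134217728, 134217728, 134217728, 134217728, 134217728, 134217728, 134217728, 134217728, 134217728, 134217728, 134217728, 134217728, 134217728, 134217728, 134217728, 134217728, 134217728, 134217728, 134217728, 134217728, 134217728, 134217728, 134217728, 134217728, 134217728, 134217728, 134217728, 134217728, 134217728, 134217728, 134217728, 134217728, 134217728, 134217728]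
def lfA20 : Lf := .mk 56185015446600753191628332540519765720476344555539181085776500672175522444264315461149792169293729713290359338261137102004227529570706064427924066489682240925916541948093981806330552213271157667209173697066709820480124558086705412465464591602745478391152218904151424997253849951201751714332163296957569006310756284939037117673607307790793746348250875383632242991954974435964111194603273767523147166584291368440788764020248159765275161503358258045415627116888659771026829656351590561464753595671616570713270873208243108350614391142386621415405383652673368447130964893538065412430338704323882343255739022431508420411903170134665091745215076943297143966 600 [148935609, 147161972, 247782661, 134217728, 134217728, 134217728, 134217728, 134217728, 134217728, 134217728, 134217728, 134217728, 134217728, 134217728, 134217728, 134217728, 134217728, 134217728, 134217728, 134217728, 134217728, 134217728, 134217728, 134217728, 134217728, 134217728, 134217728, 134217728, 134217728, 134217728, 134217728, 134217728, 134217728, 134217728, 134217728, 134217728, 134217728, 134217728, 134217728, 134217728, 134217728, 134217728, 134217728, 134217728, 134217728, 134217728, 134217728, 134217728, 134217728, 134217728, 134217728, 134217728, 134217728, 134217728, 134217728, 134217728, 134217728, 134217728, 134217728, 134217728, 134217728, 134217728, 134217728, 134217728, 134217728]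
def lfA21 : Lf := .mk 31429810183563349769064181875218439591806980356270355982416263765542651407554655860634481656605680739063346166537550926177609894733644395935925333392343863650960505619042060521611317246802449941131296887102477004963466796307143951615447937054694512573345800822190575441951886552257391550496192001881969435027262744471630940128920670730641261595266858231760879021009477895603991823989340670965680318163684295825310431150034595929634118902244044031761931960938462863107791407139897116355369971469751027233192516927697890954369843138615237638339520733599158477828905346108400023951124979955130683761033444171766765476797738294752665429224289135869115956 630 [122352394, 104394886, 107601024, 141782455, 150708278, 146811652, 125470550, 143768396, 132325391, 146681555, 122760159, 135720763, 131877507, 128599416, 147680822, 133747850, 134987777, 132479688, 132162630, 134101329, 132562111, 130707703, 134970637, 133708994, 134438414, 134044694, 133823026, 133778780, 135580352, 135314000, 132614672, 135035127, 133744804, 134041323, 134047633, 133838680, 134014873, 135388785, 133373869, 131937513, 133686245, 133732165, 134141328, 134518296, 134072999, 133880165, 134236569, 134559810, 134121241, 135274499, 134217728, 134217728, 134217728, 134217728, 134217728, 134217728, 134217728, 134217728, 134217728, 134217728, 134217728, 134217728, 134217728, 134217728, 134217728]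
def lfA22 : Lf := .mk 39097690752301283806148897007884681181372446081222050861522200208850207360273133266045703593825836610388863440115882537224169989579135929299980012387421620556073112502430814115644576832148938143195750049258274808053602057400478155989359722433121431881121737198843867894747853685549017662178348077515583990458172179843838235281513846569743500701651346034835475887251244773744874012352572300982573992168742094631137281682754872100984042795334790309175973392999607984620436711822374901062517606411831275668234577995924966439303376951756831561062360417900171683596967478412051114179080659424169518881923612978044837185874266131598500284130456937574089448 660 [105777083, 152011627, 150098674, 144967395, 153068114, 151161126, 135836603, 132064279, 137034496, 128351845, 130428479, 133870914, 136900642, 138938482, 132593530, 138475630, 130897149, 144644791, 136945226, 134766663, 135924622, 134006600, 134767778, 134276509, 131129161, 133782647, 134439415, 134370198, 130789331, 133316543, 132686028, 133686247, 134472372, 134366237, 134508368, 133821567, 133638783, 133884238, 134154777, 133641359, 134720599, 134836084, 134383301, 134007534, 134100352, 134143381, 134185393, 133940979, 134204663, 133483422, 134204845, 134209155, 134253910, 134054519, 134004324, 134241665, 134131905, 134069781, 134271434, 134199727, 134350386, 134217728, 134217728, 134217728, 134217728]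
def lfA23 : Lf := .mk 35114840671383743719838670464088296868449002771942323594472385333753731499569940123645922803190841305117561541636143213375782441790985768101800819613209665222562058619443637056936304744713645180288084994714797806079664732896704925860359932519778045280909465099697699297954387965828158686994267208242936594264291754225483220816552633301490026179651877280378350329886261345675141247974516847962424613349780389791544818892131806591386959358379251040991177014344352367246164711734058681652524341566684255329422129031156738817186386970815775926983221885625574324716997215455179774721337332747848626774945873104769031736211084646342379720309710573438409763 690 [141562719, 104688328, 103340550, 177366319, 129193113, 135894404, 102310990, 122574717, 109429123, 156814952, 149655936, 145769356, 135131884, 146753075, 143816567, 122816997, 135290965, 138462740, 134005966, 137649328, 137671065, 134736039, 137424655, 136685988, 134605228, 129040745, 132358487, 135199149, 136703025, 133757522, 135016739, 134394970, 136259262, 134536218, 132702609, 133774357, 132784479, 134111313, 132447866, 134148506, 134395308, 133021693, 133607683, 134045855, 133433813, 133148876, 134053719, 134112538, 134159485, 134709426, 134224279, 133874965, 134599455, 133866629, 133916240, 134375355, 134215961, 134197079, 134152006, 134274052, 134236563, 134225579, 134224630, 134236436, 134289399]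
def lfA24 : Lf := .mk 37023455897821907585292245660286275323475724981102115061990572991000281735078823677638417710169740399282242746881726466000052089039415634008813782163761420004111250148104587269568558111351796282860473243097799858749318860749744416767926014009450862156024755793447674274376507525561182336610688403705575396317775643580006902588297048204834834816703381727770491378958858904518657282573910616634792783107297563326807108176804675847415912745007880175686021406528162495312679009957858298913646240833424295814441276219497221854973210587234365200700419278209225924769551720612295921967049662182705448103044127534315442069068326392292726132753495388339315720 720 [113691357, 116164968, 135849742, 146188473, 129077818, 127899248, 112257930, 102283536, 133442718, 135808304, 140843701, 116409645, 127226647, 138708476, 130596697, 130167158, 137637614, 129902425, 138635669, 135461795, 138435089, 134290268, 131360518, 132471467, 132570556, 130873922, 134211145, 136354582, 136309558, 134586113, 134749437, 134210948, 134002106, 136239473, 135466261, 133602425, 132411496, 134742092, 133050917, 134927589, 133245204, 134194130, 135116885, 134951042, 134032289, 134424496, 134888443, 134318808, 134092803, 133963359, 135222428, 134217728, 134217728, 134217728, 134217728, 134217728, 134217728, 134217728, 134217728, 134217728, 134217728, 134217728, 134217728, 134217728, 134217728]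
def lfA25 : Lf := .mk 35114840671383743722763135945551582753302212995105251892913580338953995615212979831582962849281735263954353877072424006291282667322457151106725144555011010963972165401183549188466771180435759236097266003152355301447188697697796729546773239746463109274628235328670584804098347935272545859659358323247481027105766516195445055158658224761322865292605714123778622137868754959661850452301666277095213086009791985777696733602768462217869739551052087313963055761804310463448159195434583385695992606119829513179488685925662138675923191767109713561986981705368165084604992902097747861037105146632859921493444059703823652356819748901149932198790588901751430179 750 [141562719, 100195052, 108375067, 129545951, 120986978, 175363574, 162673434, 167115958, 123908423, 157790478, 141519554, 128722127, 144641389, 136788128, 142842890, 144591327, 140489192, 129043042, 127829783, 130873721, 130113789, 133276414, 130701055, 135602013, 133779012, 141956514, 134217728, 134217728, 134217728, 134217728, 134217728, 134217728, 134217728, 134217728, 134217728, 134217728, 134217728, 134217728, 134217728, 134217728, 134217728, 134217728, 134217728, 134217728, 134217728, 134217728, 134217728, 134217728, 134217728, 134217728, 134217728, 134217728, 134217728, 134217728, 134217728, 134217728, 134217728, 134217728, 134217728, 134217728, 134217728, 134217728, 134217728, 134217728, 134217728]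
def lfA26 : Lf := .mk 37023455897821907587204795291745239800023180741976636449684700642254412904117644026311900789024422127053113335380062230005245044667972051445840886515793114308358911260281689429986154054871726191731226420197378255643829510934979586802257396815871891079438952975769401854388309111353676682698223826315889872022466701046825750552189661426512142984610357518853202787094218283205087313272484875940256561548273455574813048541447544307452291731396751062822637465678302734048148725746990182025195901581002820453009368644126558201994899833606559848732177662994669439090329258725349793260811459252573020707709630583498644592729316202446857367246746672220087304 780 [113691357, 133794809, 116096284, 127127240, 125806846, 143631688, 175580067, 131844579, 142644778, 139010672, 130941031, 131016311, 131080862, 123809585, 132494285, 131768500, 136469901, 129067545, 134192735, 139301142, 131614604, 134768532, 131472818, 136113291, 131836769, 138765704, 131485210, 135183920, 134609879, 133798167, 133917687, 134440771, 132304130, 134005220, 133449745, 133909435, 133624993, 134643476, 137284468, 134217728, 134217728, 134217728, 134217728, 134217728, 134217728, 134217728, 134217728, 134217728, 134217728, 134217728, 134217728, 134217728, 134217728, 134217728, 134217728, 134217728, 134217728, 134217728, 134217728, 134217728, 134217728, 134217728, 134217728, 134217728, 134217728]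
def lfA27 : Lf := .mk 56185015450192555422658927998029318018483052078826553859261096335939231045378486579250466598097776408004330470318410343853388865252797156573797199407159218386243444736999263151334653160925617026824338043737297025115878351392283147782030331418932720851633501981194333216796950878401258986153561303558249422617000011564465757229069756443645124602727499548279801351971098954723252819093457021164676823929074340343936155931241567678425337454677003529590015108684539988414392501358331751406608812265211387348493450621647192077153261727170915601240440125966405138515622042937275857382137151763370748079435003638344189612356663051538374045371532907907015838 810 [249461659, 134217728, 134217728, 134217728, 134217728, 134217728, 134217728, 134217728, 134217728, 134217728, 134217728, 134217728, 134217728, 134217728, 134217728, 134217728, 134217728, 134217728, 134217728, 134217728, 134217728, 134217728, 134217728, 134217728, 134217728, 134217728, 134217728, 134217728, 134217728, 134217728, 134217728, 134217728, 134217728, 134217728, 134217728, 134217728, 134217728, 134217728, 134217728, 134217728, 134217728, 134217728, 134217728, 134217728, 134217728, 134217728, 134217728, 134217728, 134217728, 134217728, 134217728, 134217728, 134217728, 134217728, 134217728, 134217728, 134217728, 134217728, 134217728, 134217728, 134217728, 134217728, 134217728, 134217728, 134217728]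
def lfA28 : Lf := .mk 25973575913753690831678139312363095884834280994258303875429550620555521871284470482030094440270235453433096020889851251722357175237251230009547653258799570269066009624004682435732493511191903603310238377869011151357500615882914624807789748663528340655700010239671728563927882936294968148193418520334796553868968799882310677681669459339233696376835740520219764937850552655337869055790604189922504133715691847410761674958276718728518040690198745597306341822130552636732921959173744594014360542952007280921774123916006439075206897882971085873228403169068707912503071193033514928637697788612758278400984050971476833203917049057088200291084702675056657167 840 [96553319, 101092217, 104653413, 148864776, 151592355, 155576317, 132827599, 130210396, 138923919, 142486174, 126928275, 129094148, 126498556, 123488804, 134679522, 134918107, 134010459, 135599401, 133308709, 135812157, 134021903, 128874735, 134150153, 134010669, 133947057, 134391064, 133968615, 134563435, 134506766, 134688456, 134622993, 134659009, 134082771, 134418883, 134278876, 134156572, 134242601, 134204087, 134100500, 134229749, 134236857, 134042587, 134177650, 134178194, 134237946, 134234290, 134207791, 134171575, 134080082, 134243673, 134213650, 134152003, 134285702, 134183895, 134201773, 134212016, 134203657, 134201793, 134206513, 134220992, 134185162, 134210527, 134214826, 134217189, 134224903]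
def lfA29 : Lf := .mk 38818979579488612879683495975093518063116955807649386087737248150408952378482820570665730865970059338632810896365483294951887797360051550708327071149014029497445334236548689588279140562275902064319908388749671314872455210133259382994040608296117476528088407498814282623258610181906898525991045340398866054386544911170433361892134998601588493185690773014959263989174932761575271109589754519826733952572857723922676375027649275585133469504905224977542927050260667358773153964181519631826003357226885692626899032028614117669905248629910727816647976528618797971655685893232567384303155469562594415257995060528555707851091990196332718568185134491625146380 870 [121311310, 128771749, 129357225, 129057573, 163414404, 134036102, 125685143, 148614925, 136855913, 116580122, 133611230, 142255298, 140006696, 138168384, 165863775, 134217728, 134217728, 134217728, 134217728, 134217728, 134217728, 134217728, 134217728, 134217728, 134217728, 134217728, 134217728, 134217728, 134217728, 134217728, 134217728, 134217728, 134217728, 134217728, 134217728, 134217728, 134217728, 134217728, 134217728, 134217728, 134217728, 134217728, 134217728, 134217728, 134217728, 134217728, 134217728, 134217728, 134217728, 134217728, 134217728, 134217728, 134217728, 134217728, 134217728, 134217728, 134217728, 134217728, 134217728, 134217728, 134217728, 134217728, 134217728, 134217728, 134217728]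
def lfA30 : Lf := .mk 38818979580888004241689544061537374393515483440064319234667987797740159614553545052728470982420634732543971314632534531031506037928713123062836769224265646465119851656613945427998333034089534106180507583293127609475173238673455020834122041253160949973927529956993273378610931110492398789964281426343429352791237485924868112887967419229193058056854879046276625394620978270511028879731067480213494957939102141518330570393829376644116900153787056241256202621099210856900471941822144774505008034935360448433713058788238909963714209802431823625263950994621307394638752288033672064483713231257119663810556398291875082966754506945895627025544346586817841164 900 [127168056, 128017605, 122740821, 163866527, 134069981, 134036103, 125685144, 128870044, 136717639, 137206565, 148612888, 133953128, 142812416, 152174784, 119314636, 113471156, 132569350, 152609351, 134217728, 134217728, 134217728, 134217728, 134217728, 134217728, 134217728, 134217728, 134217728, 134217728, 134217728, 134217728, 134217728, 134217728, 134217728, 134217728, 134217728, 134217728, 134217728, 134217728, 134217728, 134217728, 134217728, 134217728, 134217728, 134217728, 134217728, 134217728, 134217728, 134217728, 134217728, 134217728, 134217728, 134217728, 134217728, 134217728, 134217728, 134217728, 134217728, 134217728, 134217728, 134217728, 134217728, 134217728, 134217728, 134217728, 134217728]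
def lfA31 : Lf := .mk 49399915998610170787952002763797618000450707169891449113530373890408993753588792137331237740631336536751139192274600978431204418887337525949520258640667027676155947185884122918929476280343916592892599829459162192283832844803232973079501951700050661732622286921418855380290424967111749477201708760134169001592340244024638041454575463892961549867742067074885106498761867146002985714400541671569512316266043003409760566320593923163550000797348259599878116630870945528105147529371646831770511811796324419423058943100101438122750253592261684852594835922753670704094356190106093240318714488661866220804304233177271976403434036522813570733982406738386287777 930 [154826125, 153898182, 150216788, 126535956, 125105454, 123364876, 119029094, 133708721, 139174509, 136434066, 128161558, 133045712, 126316163, 134582802, 140350729, 116626462, 136014160, 132400986, 133602427, 133823151, 134748986, 135529998, 133706331, 131598868, 133862531, 133784766, 133883433, 133110913, 135252105, 134697041, 134653817, 134837445, 134202266, 135829498, 133389836, 133973009, 135081294, 134850394, 134684920, 134825196, 132479320, 134428340, 134255557, 134136445, 133911651, 134535998, 135849794, 134217728, 134217728, 134217728, 134217728, 134217728, 134217728, 134217728, 134217728, 134217728, 134217728, 134217728, 134217728, 134217728, 134217728, 134217728, 134217728, 134217728, 134217728]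
def lfA32 : Lf := .mk 38818979580888004242992828832365349048540916939263137307127131950285081689746481118102741242087839088265787473197971283414079637194124970395675341785885125656813545283192200311770579067948794096609070028252575267384730730034579909243487904576773257411216990695055732428667329573008280106451013774352809538475785823224719734343235110444736638181657743949161931009276864106446850867316431168364237335661482352911388374156537587964221873128441126116617301048531798767479977369645113267444106394396851344305950440570585794985103789105480768945911960148767834871937252633323416449707474426246002922849125053581221444775080550128537835125610677642054158348 960 [127168056, 122112505, 129357225, 129057573, 128096647, 162766131, 154681159, 134760876, 118762237, 130606251, 139165291, 138285901, 140121033, 140497665, 122939516, 162505831, 134217728, 134217728, 134217728, 134217728, 134217728, 134217728, 134217728, 134217728, 134217728, 134217728, 134217728, 134217728, 134217728, 134217728, 134217728, 134217728, 134217728, 134217728, 134217728, 134217728, 134217728, 134217728, 134217728, 134217728, 134217728, 134217728, 134217728, 134217728, 134217728, 134217728, 134217728, 134217728, 134217728, 134217728, 134217728, 134217728, 134217728, 134217728, 134217728, 134217728, 134217728, 134217728, 134217728, 134217728, 134217728, 134217728, 134217728, 134217728, 134217728]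
def lfA33 : Lf := .mk 49399915998610170789532467085177823608148393025272438499910230287290941759698165595314741773420665514360730355654114875168671062441441582226652567009312081419145136557211147780263357515346639507526105647695309959881084143786064738818703581316536264146792308224808610929408803918142859494133491928556554980965346621529667153493047955613879273834189504516652424703657843666293237097287383898731394573100465011258348921118692382428425376821669948848314974096162902526448623527949220424083060432376489080938778999286716020403431983675030423217641821404822279320914262273698978864866193909066651519689139318709442656134972521221698818414200346703802596513 990 [154826125, 152342629, 151959717, 126872578, 125163219, 123087041, 140815390, 139569658, 134561701, 135174901, 123026221, 134883436, 135858402, 122712777, 142412359, 145487419, 134384712, 120602722, 133786109, 133507315, 131941970, 135623913, 133798133, 134597249, 134558898, 134090355, 132386130, 135362525, 135493869, 134415961, 134516966, 134386911, 134091786, 133740972, 133143290, 134060496, 135283500, 134967312, 135814693, 134707798, 133999721, 133763967, 134053676, 136312714, 134217728, 134217728, 134217728, 134217728, 134217728, 134217728, 134217728, 134217728, 134217728, 134217728, 134217728, 134217728, 134217728, 134217728, 134217728, 134217728, 134217728, 134217728, 134217728, 134217728, 134217728]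
def lfA34 : Lf := .mk 49399916000307181428633471569601609150587236876136322221002861812563777531509644688659961280829753355111256109297795928952269920236390613856433128934673986662386879805387709252209536272117300310248943701798840102533523481285683528199026301647926937591999128384846234748002389524046182852987288284689958512243780145941522247016356167337421916365168584352267967253203683709718840564578181007534483857435878886229033987581569202728509714972043093384812219421056505867357571424532177716494125125027375453666146020283937730302988161209109214561221401392447446334236089752280745184568612497797103795619835699238844471172622152505785269987818109747841399969 1020 [156368941, 152143968, 150216788, 126535956, 125446996, 123087041, 140815390, 123846865, 134451595, 140901426, 140640350, 128085967, 128725347, 128970929, 114847177, 133466372, 133126309, 132143168, 134949689, 135311050, 135237274, 135739114, 133553878, 134623346, 131989157, 133890198, 134610094, 135462761, 133210661, 134532825, 134676807, 134756897, 133389021, 135569102, 133485797, 134300033, 134079972, 134887342, 135567321, 134872585, 133854256, 133933728, 136484871, 134217728, 134217728, 134217728, 134217728, 134217728, 134217728, 134217728, 134217728, 134217728, 134217728, 134217728, 134217728, 134217728, 134217728, 134217728, 134217728, 134217728, 134217728, 134217728, 134217728, 134217728, 134217728]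
def lfA35 : Lf := .mk 57917119582821169302126883649062605407749168524502530568148701819030297014193632418814137330129914222452800066529059680722756638573507438876136771098699102023586057389520390980169000060235675732079903215541014107060479784359604718042963429452433592784911695166069206428000783365603526195350147060172252211450369277762953105867729837888355780019501553795387351921361052523800428848956549443348134519437492144119196461623438246152960926719654113496314633826538661989301297219991062457135159108552164240060103524453745877606151531892012115449431945322527923792164823833732397045883053519968941569145640467489412719639611014365230729210523743274115986384 1050 [189090833, 182478134, 177289845, 134213791, 134213058, 134211987, 134110740, 133512260, 135241447, 136026151, 132730408, 133134219, 132608663, 132115907, 135081257, 135369878, 134285420, 137501420, 135457203, 132179687, 134508021, 137339790, 134774172, 135284110, 135449345, 133541206, 135681707, 133553325, 133857900, 133193534, 133421077, 133472197, 134745354, 134266794, 133079575, 135401818, 134423385, 134586675, 135484917, 134353213, 133751495, 135054137, 135182056, 135179437, 134198730, 134420436, 135106701, 133811269, 134442160, 134392252, 133663564, 133992147, 134541299, 134193429, 134303148, 134771541, 134217728, 134217728, 134217728, 134217728, 134217728, 134217728, 134217728, 134217728, 134217728]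
def lfA36 : Lf := .mk 64261366297302283789960485623723080192651445048695934824959057530846706505448481204756180369151754603842669415366591704079554589382835676134616872685702157890795275870845703697789206362046098573020730088124474755218007843926962406619899537203229998938878374691697091980576019902209954841260882146564771258596137988747460466722475058939295906091910352041134796015194072996590581025307862250534193070283317085084849212948716532151732771779011808945067082826637253757134871084264137151124409369126424636803043804271928136555196235215906185811547376425200880338563773508119775600797586748741093161762260364706274349555108366869243940613271024936638124850 1080 [180301374, 174747883, 170390643, 107015119, 101949438, 94550394, 136427094, 140733705, 126384157, 120468831, 145969947, 142658413, 146616605, 151410928, 132455963, 131688734, 134799428, 128553071, 135556210, 131757117, 134347903, 143997938, 134217728, 134217728, 134217728, 134217728, 134217728, 134217728, 134217728, 134217728, 134217728, 134217728, 134217728, 134217728, 134217728, 134217728, 134217728, 134217728, 134217728, 134217728, 134217728, 134217728, 134217728, 134217728, 134217728, 134217728, 134217728, 134217728, 134217728, 134217728, 134217728, 134217728, 134217728, 134217728, 134217728, 134217728, 134217728, 134217728, 134217728, 134217728, 134217728, 134217728, 134217728, 134217728, 134217728]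
def lfA37 : Lf := .mk 47071362690946573149829948471290210077257991854259916068201098597250892715132121344302882882819792004929651645116456452512995801119181744903650245080714434829257164031572744793203146481654329847512943316191446734891500332734911608113486036795207171995825566010116324416926398300089089375226476877316509317293949641573252020615271630015085899018681582247279547602277530616092165150052418085483500598403948407854032325562302474466816248213832702139539002386822897672705140455799976457361344644522933084011307495491642002943382612100009142320766894018870829096570262809911733977754157850571609182804950336844836118724228202847992633610634376603923510294 1110 [160664512, 135300378, 135183987, 147768117, 83627343, 140116839, 142027276, 120138680, 134695805, 138501456, 126914857, 130164933, 134625300, 138721839, 105292311, 135061843, 136187753, 136619927, 132306157, 132829219, 133022033, 136902439, 134746912, 134215369, 135447497, 134180672, 133094611, 134517730, 134406901, 133801512, 134177397, 133975308, 133820519, 134540036, 135356803, 134241649, 133940424, 132985173, 134552109, 135343889, 135261619, 135190556, 133364693, 133968284, 133989010, 135904266, 134217728, 134217728, 134217728, 134217728, 134217728, 134217728, 134217728, 134217728, 134217728, 134217728, 134217728, 134217728, 134217728, 134217728, 134217728, 134217728, 134217728, 134217728, 134217728]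
def lfA38 : Lf := .mk 49709633476674556688926402173683443781086937010551344971651036078402718632122872192914620034631603110836246035004595762859171108599263103572997695980653529404345072355507279962726228772022022709883221742276440495706844277835517626176762026696809123553482048857927875736747396555992352755796289038897660228688565854430353618322105178366262602694786842634496968928024531390631230017102678352540782065155674989239985992273763965243374871706648664050534879870827638198874575028076547438325030664346505521715510640726452272622170509350747608535576806574316390325064632772828047914062463897304112703647216856015759209095785670074177144512418290361821417728 1140 [157691576, 127282618, 128028185, 113445576, 107480262, 103491385, 130588168, 149059798, 117906637, 146444917, 149195071, 140452340, 140328710, 140868097, 147363000, 128430719, 138018842, 120946413, 132714056, 133611439, 133274097, 135415173, 134659212, 136203776, 134551425, 135182835, 135397030, 133718162, 140631547, 134217728, 134217728, 134217728, 134217728, 134217728, 134217728, 134217728, 134217728, 134217728, 134217728, 134217728, 134217728, 134217728, 134217728, 134217728, 134217728, 134217728, 134217728, 134217728, 134217728, 134217728, 134217728, 134217728, 134217728, 134217728, 134217728, 134217728, 134217728, 134217728, 134217728, 134217728, 134217728, 134217728, 134217728, 134217728, 134217728]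
def lfA39 : Lf := .mk 47071362690443663054060831099172366525378201179275439885546248412475747995051835810495737705342887771667025118604690532274228013608602469996066798464192332558358837968910353891118547548045066882371011793248658376288491782579307051281372153956696208140519115244999227266474755367635251905108095489378250654050868104335397262733636580615562534252776227029236566788737036034254694133638252070898842749915757476288415587930461312509303304882136472025568712944611377307887896649170892100685151405283661155891273110467782684221355526020996500785442092831764484233476259339114818430119448966472591410599200557721371039271408078264513013054777601904029856790 1170 [138669050, 138132626, 160032404, 82064378, 139016494, 140116840, 142027277, 144266526, 134864772, 134631873, 132037743, 138968664, 122119941, 128681250, 148040579, 153916832, 137510901, 118269033, 136469946, 133596749, 136334378, 136721642, 135089582, 133764690, 133128735, 135162399, 135030140, 135163508, 135133888, 133794683, 133910289, 134728917, 134506466, 134215176, 135317277, 133530310, 133708862, 135817710, 134062267, 133642629, 135071640, 134634400, 134000444, 133342733, 134434560, 132985384, 134821444, 134713997, 134080904, 134462682, 134374032, 133658281, 134154018, 133930570, 134168518, 134627479, 134161977, 134179006, 134100296, 134246250, 134205604, 134250685, 134156355, 134223952, 134212282]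
def lfA40 : Lf := .mk 50200769244639948170681815285042408683572384394861634779358165542026186403948242989172204080611782810665837169132543647527103488086958183633577027128540878327776200283417592563238454955533637357543042233548090487335697262562528926579072551239185757871164892302355478768892855692779052714904147028311338941727399177118442860018799828770849617260405351461868199955398334596328055182443862936226256906172678025478446295714016280647566152581531127758006169843326612011673695953752444874500309882276049669161447640039026081321632378211272035581936755982116014887600819814728623336035010432975728020370049534484789289331202428216990485655702578839405728928 1200 [151544097, 188853928, 143327293, 118227855, 115250215, 148997606, 157699739, 127868781, 127585588, 146261302, 130384681, 124330313, 132864208, 106737841, 127756423, 145087060, 131120397, 129272118, 135559112, 137708622, 129745893, 135177902, 131647755, 138197078, 134318095, 137092581, 136346820, 136426796, 132161470, 131377581, 134266134, 132937618, 138699294, 134217728, 134217728, 134217728, 134217728, 134217728, 134217728, 134217728, 134217728, 134217728, 134217728, 134217728, 134217728, 134217728, 134217728, 134217728, 134217728, 134217728, 134217728, 134217728, 134217728, 134217728, 134217728, 134217728, 134217728, 134217728, 134217728, 134217728, 134217728, 134217728, 134217728, 134217728, 134217728]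
def lfA41 : Lf := .mk 49709633475008338697489384190289303145550505927277368513242362296800500000173670997514900110376645658271494638170310990810594959383446487589829200924414889601364519741347047006469086083566372541474187745814721839714623762381587281669037366719771716597450357718141806902630317612001317361526200163524736114634127126368003607848777417007789053342914325855811792982063757868549621970123752258230936872031301368696457969673820485587210545521565440164215975520354166392041560401093800458623836147878528027611462950906718161937980650189433624815003547327203566446485384123827972307744833043977189170243045311195656687738781961598763535909871343421416132864 1230 [130337268, 130804898, 158930525, 111378672, 109222690, 103491385, 130588168, 125965205, 117744906, 109312230, 132516785, 134309252, 142983388, 133923872, 123086767, 119154513, 135102969, 135450135, 136100897, 134860145, 135251620, 134283169, 134472706, 134210727, 134387543, 135642045, 133020511, 132716913, 132299588, 134787301, 134594152, 136229405, 133273387, 138435493, 134217728, 134217728, 134217728, 134217728, 134217728, 134217728, 134217728, 134217728, 134217728, 134217728, 134217728, 134217728, 134217728, 134217728, 134217728, 134217728, 134217728, 134217728, 134217728, 134217728, 134217728, 134217728, 134217728, 134217728, 134217728, 134217728, 134217728, 134217728, 134217728, 134217728, 134217728]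
def lfA42 : Lf := .mk 32830219361126287442816948232172564980560044732218744599092007476386924660007761885573549295733193188072004463949637045077974568474047394871239940423154920636022654580783919563268648870097519965093364716666226536281714934997227511179512780831008296378793050934210541081764620478144101240266681446390455548334889938953753639661717971167991589537496846979852022611941372407589324803657431991338770550733800821200479920635053156071910864858304204837833842728305051390700022440787901307344961203580470765508431548600305720117005091899311996749860826030416880329220221852066950380831625452754226222694714526147162606545057248171119942749792794812844239219 1260 [121978358, 84495457, 129051007, 143487833, 145214116, 137521784, 140477546, 133184193, 131435159, 136526141, 138049200, 129666858, 140593967, 122511637, 135333700, 133888780, 128844379, 135232824, 134656664, 134659453, 133034699, 134780492, 134343456, 135940577, 135372764, 135198386, 136074279, 136324501, 133416060, 132445526, 135439942, 135077263, 134211025, 133166903, 133995526, 133176570, 133888596, 134501971, 133338589, 134858773, 136839835, 134217728, 134217728, 134217728, 134217728, 134217728, 134217728, 134217728, 134217728, 134217728, 134217728, 134217728, 134217728, 134217728, 134217728, 134217728, 134217728, 134217728, 134217728, 134217728, 134217728, 134217728, 134217728, 134217728, 134217728]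
def lfA43 : Lf := .mk 49215032918612132191452044354029382618776675348982803904340905400609330980833929759809494847772544372394951765763113403088710093706493816156257434974053637062809872162109324074315040487171893694803555456250553377826534144177633557577747420961637196329100667158032003330913545057548960754886837912834526466141629664009392762147987769283432879729267340607608042772180999947289418851562433068295318594959014598127235262880488609736004698961384332831372197175510296042974624238821249267188995969303053400589942134557828247112798400466036557589931188223168002495016586164501101026532268041984214448550552522921817680524123469858042500622700736396882036951 1290 [137790568, 164257235, 139806854, 100216434, 138395931, 126036537, 139837317, 191589632, 134217728, 134217728, 134217728, 134217728, 134217728, 134217728, 134217728, 134217728, 134217728, 134217728, 134217728, 134217728, 134217728, 134217728, 134217728, 134217728, 134217728, 134217728, 134217728, 134217728, 134217728, 134217728, 134217728, 134217728, 134217728, 134217728, 134217728, 134217728, 134217728, 134217728, 134217728, 134217728, 134217728, 134217728, 134217728, 134217728, 134217728, 134217728, 134217728, 134217728, 134217728, 134217728, 134217728, 134217728, 134217728, 134217728, 134217728, 134217728, 134217728, 134217728, 134217728, 134217728, 134217728, 134217728, 134217728, 134217728, 134217728]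
def lfA44 : Lf := .mk 49215032920652649004945599557162911364271142807655946787064289277207036719005449109340425290549564464631581395990316131337606406567329837779428850442680380219499083592668750865806991761216437072639616722551610881383779844956932993718016125815002763695784986080754144993511406241779196217913298444097600844620225543771268520851405811377203819800748970692782326262518472980415885083836271197380371899471567381781954519917143756329462237697631924745165843956497490571509724664392531950349383016421747879658054440089824608614123698888530161644793475234259964783542437294853028240665172624271931548496195257780680467676982727986745591757475739421794846935 1320 [143555765, 163514879, 133293873, 144086416, 101412936, 126036537, 139837318, 83334457, 133459617, 122969621, 143309769, 140752022, 143296083, 148964917, 136478962, 127649319, 135044267, 135098384, 136807195, 134775898, 132088477, 134907573, 134200790, 143616265, 134217728, 134217728, 134217728, 134217728, 134217728, 134217728, 134217728, 134217728, 134217728, 134217728, 134217728, 134217728, 134217728, 134217728, 134217728, 134217728, 134217728, 134217728, 134217728, 134217728, 134217728, 134217728, 134217728, 134217728, 134217728, 134217728, 134217728, 134217728, 134217728, 134217728, 134217728, 134217728, 134217728, 134217728, 134217728, 134217728, 134217728, 134217728, 134217728, 134217728, 134217728]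
def lfA45 : Lf := .mk 46057307065223759199347825059727724012156067919507605285425906188698420403207979077983747144700937574337494320536648291604811843609915956592524238902331157665604877260052029779906619191823133412930064177796012350748539565817480779416504871674751352560842035120082162333688188195482175701921418424649357214686145431414429052272046402971592033395428476114063897610489486254189149790392469789026472974110503423325373512236385505927646195948867483148871512252951568289214912217131186400842631352587287580140600913499938868151499504531538910175415110665472189599688732656115536564782113302405757776206667723240940218604298283205626993162840639561209578222 1350 [110681291, 175973508, 108624247, 112731216, 108729989, 123553699, 143643141, 137906755, 125685228, 125944225, 134804254, 142448411, 132369616, 155088043, 126018494, 146161361, 137025079, 127990069, 135022095, 134424216, 133628216, 132568325, 134688227, 139277967, 133126003, 132725910, 132689503, 135390683, 134407124, 139746532, 134217728, 134217728, 134217728, 134217728, 134217728, 134217728, 134217728, 134217728, 134217728, 134217728, 134217728, 134217728, 134217728, 134217728, 134217728, 134217728, 134217728, 134217728, 134217728, 134217728, 134217728, 134217728, 134217728, 134217728, 134217728, 134217728, 134217728, 134217728, 134217728, 134217728, 134217728, 134217728, 134217728, 134217728, 134217728]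
def lfA46 : Lf := .mk 47071362690443663053592459570289571049145890588426781403292290058984847650631061780515394353464271974154715346496644725611204749128853064217809492509438322836406847419119985120830349045450170366275324073874816237018617819830664221925335596726968204545836160462916085411626316858506270353618041698094144428355349441642520721396739558111307623994517811942390239302721435754694827210176744558178769820499813122896683881829765349110158079979466283105013979180896710238418244984296332490253278792281718181068428037466855587063902598085350163149086892243941145306929783467983123794029397058333028694396623558113711605848284859261863346222729776098499228694 1380 [138669050, 160309686, 135183987, 147768117, 150291476, 85887394, 117410315, 135106716, 136152203, 134968198, 136967355, 129825103, 138424436, 124836534, 145564741, 108602300, 130743462, 136134474, 134804776, 133852070, 133877029, 136857113, 134257019, 135645178, 134623332, 135031081, 134660820, 134786179, 134729232, 134304504, 133767273, 134052139, 134790766, 134868474, 133888492, 133009221, 133982037, 132968391, 133361072, 132693964, 133594616, 134736147, 134545515, 134599596, 134610335, 134085858, 132973827, 134614339, 134231248, 134070389, 134558567, 134063246, 135086664, 134217728, 134217728, 134217728, 134217728, 134217728, 134217728, 134217728, 134217728, 134217728, 134217728, 134217728, 134217728]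
def lfA47 : Lf := .mk 50200769244639948168798393016010902677165143438791646714031114450751949391429849485250294583654396150089419344159845611327727165397411460766430880179314701998680572848022573330612341167801114182351390817750490410888091704770421454084742789443810101062867431618958371190280796288348282241231751343412218773151694131030502982265094371933595538850579154299029544454226295464477238230538876233819403869346069190364600422233640019206674227690946317558681295428223430874238657569317978030749804571516772950155064939501575272703082608624884947939450980117531427297024553191843659091461884548698845433798829017114863509522858548230701428446996636946274981024 1410 [151544097, 149456115, 187470804, 154989464, 121558630, 118655928, 120078053, 118368054, 145716966, 152967502, 141497797, 123302440, 112907244, 134628381, 124803985, 121814276, 137172566, 137579428, 137486717, 133830599, 145101787, 134217728, 134217728, 134217728, 134217728, 134217728, 134217728, 134217728, 134217728, 134217728, 134217728, 134217728, 134217728, 134217728, 134217728, 134217728, 134217728, 134217728, 134217728, 134217728, 134217728, 134217728, 134217728, 134217728, 134217728, 134217728, 134217728, 134217728, 134217728, 134217728, 134217728, 134217728, 134217728, 134217728, 134217728, 134217728, 134217728, 134217728, 134217728, 134217728, 134217728, 134217728, 134217728, 134217728, 134217728]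
def lfA48 : Lf := .mk 50200769242617638912178948041903609131666888785454453475846427114978817013744667077680635174665973394835662240031489533191204839865505808929868474319431151229466498678060755153874090141183474546727438979934083078409215247752577302680611358321980719496831693039034602312087198660536668179807456764892921476160903216166349812796168431684521363109341549615886276439842430611208645059115085407786188900300551647791328217460431601672460196813804898301270125058120375331641702191291746793174194334317285423472757027985615244868003675006765392774396359186587727175075486398075692346265605339933769731144684263654291056213525695757257393163866038021880550560 1440 [190619300, 144424593, 143327293, 118227855, 152549170, 118655928, 120078053, 141973892, 145882277, 132603721, 103216763, 136558931, 127321663, 120451689, 148178635, 133098829, 135232172, 129686175, 130469273, 129686642, 128675003, 134011548, 137509281, 131352023, 135365502, 131207906, 132964558, 130845170, 135327674, 134740714, 132130879, 133628775, 131111251, 133159154, 134861487, 134125325, 133351305, 133567199, 134495946, 133288316, 134948978, 136526268, 134217728, 134217728, 134217728, 134217728, 134217728, 134217728, 134217728, 134217728, 134217728, 134217728, 134217728, 134217728, 134217728, 134217728, 134217728, 134217728, 134217728, 134217728, 134217728, 134217728, 134217728, 134217728, 134217728]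
def lfA49 : Lf := .mk 39649101498278103438943226426568150535908567454650899246030050708868223787260166769008073751926530023035053587277560480136470548114373438479725695353291287524696595920807746556268469713939402280580834050156104006188216764032853000472087869946247156545647464541181276908220452349440460527952174936310730256252721288910512183206820979199749915470368658735215317878683768970557424850062354786437808716799187330950720776464932696056344572041938673170672065618635329085602502769148369940305740630496910198866930964743866502023928280424238663013333604278423640374553432146501450136757537186476012996968068325259015685207354886649059655298424245080202375886 1470 [144394119, 113914670, 145539886, 148583215, 151258362, 126837892, 125758671, 131759718, 144859207, 140597195, 127717016, 130244252, 126832024, 126267049, 139695645, 124233881, 135981708, 137955172, 134657755, 133633240, 135043365, 134613239, 134246893, 134330419, 133845610, 133516857, 133170397, 131752917, 133813576, 133048080, 134131528, 134246850, 133330650, 132970031, 134694595, 135962968, 133846358, 134229456, 134776287, 134165416, 134523562, 134410922, 134277018, 134335015, 134303229, 134102278, 133715628, 133669561, 134534230, 134327033, 134063977, 133991305, 133560523, 134223710, 133929527, 134403961, 134235202, 134120054, 134163238, 134093386, 134223350, 134217011, 134222056, 134221319, 134201436]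
def lfA50 : Lf := .mk 49709633475008338695937597759021313511367203520951798795202050536546776658088650744422671110487935632530148613248588689996061173144001393580697571961557439732898906001303925481397207154325160944614226885635912073843944205077997282693606622562906180216008467654424651480575027380508742913990694626900451959723085389366198779255807865510587489150237010863514444273304851685370889750997257234494336289076372358426573040761074905386032134958694431362833948891081413828291194474064032992706858711416750945040796316662867431413835447612485409491535297395067439935285443424042580283876927704149183577823759236059078888373201103350529598335927845571400159488 1500 [130337268, 158385047, 128028185, 113445576, 109577378, 101785439, 144287861, 137567649, 154268285, 124504737, 138009338, 141505143, 136970634, 151939436, 124053183, 144150334, 133317140, 120536100, 134269662, 132371967, 133905506, 134959512, 136429310, 134317847, 134972378, 134267631, 136014812, 140752742, 134217728, 134217728, 134217728, 134217728, 134217728, 134217728, 134217728, 134217728, 134217728, 134217728, 134217728, 134217728, 134217728, 134217728, 134217728, 134217728, 134217728, 134217728, 134217728, 134217728, 134217728, 134217728, 134217728, 134217728, 134217728, 134217728, 134217728, 134217728, 134217728, 134217728, 134217728, 134217728, 134217728, 134217728, 134217728, 134217728, 134217728]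
def lfA51 : Lf := .mk 32830219361126287439690606666515297627954221661681614317845908530168910657754462385069209438204197008376305505519417203394974119995412860148231901631025849153706922095370203125121637376367676134422044113085243189061117421667390568438648605200420597159955331776824135635582243943552557623326681318460018423015435635066905466547818656321384901325891000409263513446106106176236363126188041988595870498419319089055653508184443841548846048703364886753104216936773436542308931604063084935010522761505284007096170471386736411480128078782314119431543256653891279755347941628144821721926367650565556227218126237595576999758651586402197216720074227501599975795 1530 [121978358, 123453311, 85400451, 133631968, 143522817, 145656452, 130696711, 132392532, 137045522, 138200735, 141140744, 133833387, 121345940, 137456377, 134178657, 135079665, 137318717, 135372079, 138583641, 134686029, 138141173, 134261757, 134584205, 133738197, 133542094, 134872833, 134887793, 133933535, 133682896, 135585519, 135542826, 133111424, 133986663, 135670999, 135449092, 133586135, 133488782, 132665707, 133792794, 134364919, 133359061, 134119530, 134479930, 133261146, 132778884, 134279510, 133713061, 134123511, 134542679, 134423451, 134311151, 133622920, 134815366, 133896415, 134050402, 134135737, 134170911, 134219696, 134186811, 134242840, 134233483, 134160936, 134175561, 134214337, 134207063]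
def lfA52 : Lf := .mk 49215032918612132191124262264680351693869000882342138910113739107572385681919085666622296043806281321528220757179714463953124679885407698648866013437631908175354721329161651255403435681561587810967104576228292721553619234738850418780211215625627474171337008437983080180431250267282924264623390364886270195352094833348845674984310173457418381233864329835924846071603316222871864955957019675593253410921619274309357620315169665635512435492345556656824458780117144796361093375341281334584375187517452750089000941273615496426935120644520799339064719845450533556004834470432649078156874775740241257867330266731638105272731974903445492757395458162538006743 1560 [137790568, 143172804, 163431029, 131235643, 143718931, 100434425, 94710655, 138749942, 117482766, 136388979, 138943695, 164469820, 141843197, 130515738, 140169077, 137728999, 116921601, 131095932, 134642592, 133682074, 139001172, 135261348, 136690166, 133992177, 133389109, 134298383, 141942475, 134217728, 134217728, 134217728, 134217728, 134217728, 134217728, 134217728, 134217728, 134217728, 134217728, 134217728, 134217728, 134217728, 134217728, 134217728, 134217728, 134217728, 134217728, 134217728, 134217728, 134217728, 134217728, 134217728, 134217728, 134217728, 134217728, 134217728, 134217728, 134217728, 134217728, 134217728, 134217728, 134217728, 134217728, 134217728, 134217728, 134217728, 134217728]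
def lfA53 : Lf := .mk 39649101498278103438538377268932614811845896015977397988424083563960894347181061027243236134968466899424977598344236313274268667712271390619876641524103602117401833820471401247539637912103332186432739229246119332004234209909766540219513995140240363828712852367409101038044996968410271202302832932488536257570050209257679291792284498214939343941000749120304687618758640945288838760872098185859259057243451058485797235696608665406057751259125084506636613536777213031788125575039914907981079669026537268413700015004600164605488087646847595449213483361622714578733941660765796521001687901511726507588079860812191049484165118032892649592736929373450629838 1590 [144394119, 143167773, 112763075, 121248038, 146567553, 149399340, 136784991, 132806159, 135325006, 137177679, 123523920, 130275389, 127112778, 120664752, 141641298, 144091113, 133324154, 130197786, 132864741, 133794533, 132518367, 134955727, 133835742, 134162167, 134440518, 133074402, 135154902, 133439432, 133701353, 133949354, 133945191, 132018165, 134760286, 133283137, 133687719, 135517708, 133969492, 133442854, 133755867, 133891211, 134485123, 134815985, 134503484, 133710109, 134783424, 134618271, 134511857, 133872207, 134432285, 134128714, 134053620, 135151123, 134217728, 134217728, 134217728, 134217728, 134217728, 134217728, 134217728, 134217728, 134217728, 134217728, 134217728, 134217728, 134217728]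
def lfA54 : Lf := .mk 41380108578092197683216148247774354496905672713867685395151753545143195215702717586783472300580826720864668843942324649882214840186831096845003662304968940685175918341939947691092166152695544743659731400292134363851969559537465863667803693597590682395145973636905522583407657644297267192768624644142297346193876596646229461437204688648143798479299323402078620014402835657090599016824076744025112201682864751294614540874225246125495839529916654854262661939852097625781255235957838584321521666836009829937567297799439221207859118212590319120393018808864863375651066232069182845193021326805547481810944773658951890529610720117704846444490344797250613494 1620 [102331378, 146967430, 145596759, 136991775, 121689715, 134973999, 103999810, 176225615, 133029146, 129326966, 122188376, 156654872, 135219924, 122859074, 139397762, 138705069, 126998879, 133815358, 121233264, 132709306, 134398130, 136592566, 134073763, 134287934, 134563270, 133220107, 134809755, 132483102, 133002548, 133368599, 133467690, 133196525, 134881441, 133182887, 132811350, 137665580, 134217728, 134217728, 134217728, 134217728, 134217728, 134217728, 134217728, 134217728, 134217728, 134217728, 134217728, 134217728, 134217728, 134217728, 134217728, 134217728, 134217728, 134217728, 134217728, 134217728, 134217728, 134217728, 134217728, 134217728, 134217728, 134217728, 134217728, 134217728, 134217728]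
def lfA55 : Lf := .mk 49215032920652649006518196845805167175032023890865815044100881439164730091605495359822655811665967557982415002968453128276732454236925585037128299026646681913448996716407545039225039542001879201760305517031147328211678452938423355789522695028259525647562119148676367359664993409431543356751877063764447120398817662799689238934414563600970397568288256988767364327211805210340900447951359413344329555331360305343572816875077890813615188437730088760291854726995426648233097625790661265926075184159674980849086628313779726465732824699220569402474597744015845917700559828008951600465645877135494515455777588287110375416972738945220718235691597543691471063 1650 [143555765, 136617652, 163431029, 131235643, 99207700, 136643091, 170652005, 126351368, 142275051, 118275065, 139524796, 105999704, 137477396, 152887663, 131194381, 134983160, 154744534, 134217728, 134217728, 134217728, 134217728, 134217728, 134217728, 134217728, 134217728, 134217728, 134217728, 134217728, 134217728, 134217728, 134217728, 134217728, 134217728, 134217728, 134217728, 134217728, 134217728, 134217728, 134217728, 134217728, 134217728, 134217728, 134217728, 134217728, 134217728, 134217728, 134217728, 134217728, 134217728, 134217728, 134217728, 134217728, 134217728, 134217728, 134217728, 134217728, 134217728, 134217728, 134217728, 134217728, 134217728, 134217728, 134217728, 134217728, 134217728]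
def lfA56 : Lf := .mk 46057307065223759202751525640673482170876840904614801014834894298356939668505501378360695688552027747114471478733333472477993327198573371609910426474328097933836890225047423256237476371882505681593184133959077206274425134896844123334038278751901614005287315009163618804491479024380470122142850756178538489167173941738097446336518409805968039880965869922317593915637505753431776623398359808318015374637069636650818156921465449615826468060232067703876081188992438790226396542837528821786040695447871559788910846398508693975090060245704890063937813641726216273871867639816997856143214406035091318745754887966891110045878790849275938498331502638168900334 1680 [110681291, 113517642, 178603288, 132674953, 112152401, 107092872, 131478674, 132364877, 130788985, 128473779, 138223450, 135615248, 157185816, 145460361, 124707589, 120733236, 134259834, 137369663, 131648782, 135174361, 133939620, 133337309, 135890685, 133569617, 133164033, 134949243, 139177332, 133776836, 133503375, 134554343, 134373875, 139330443, 134217728, 134217728, 134217728, 134217728, 134217728, 134217728, 134217728, 134217728, 134217728, 134217728, 134217728, 134217728, 134217728, 134217728, 134217728, 134217728, 134217728, 134217728, 134217728, 134217728, 134217728, 134217728, 134217728, 134217728, 134217728, 134217728, 134217728, 134217728, 134217728, 134217728, 134217728, 134217728, 134217728]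
def lfA57 : Lf := .mk 32830219357769403749975813712725226731262348916818099703173805599106464999496282559946558590263222502416483686915966810031688734980708921648692377436317738718163236607174727958772501462364885325197396781565292741397029629840072823014532568661404916954144697099412750340956463982900946013921551957352745160580798588987036430409738453608245051757703535492590227213228443521578505088147670464101975652837344375854965024996991963325055073587326769079215137690004491289599337515922958037729311801470028224056301354366050772471024485582543817556858575850370038286452048115369486414644367849067972559083317297717297400027193619143442952631562700391162210675 1710 [83339511, 128428645, 129051007, 143487833, 135214187, 145656452, 130696711, 134807319, 137062433, 132968494, 119020658, 136161992, 135924501, 136085591, 134050557, 135119365, 137114838, 135985994, 129798868, 132633484, 131663592, 134936346, 135089941, 134704395, 135735875, 133480215, 133532689, 132726123, 135516336, 135431812, 132237547, 134950351, 134405379, 133053635, 135166889, 134229124, 134577188, 134560671, 133805436, 132678491, 133631945, 134154800, 133014251, 134279993, 136069447, 134217728, 134217728, 134217728, 134217728, 134217728, 134217728, 134217728, 134217728, 134217728, 134217728, 134217728, 134217728, 134217728, 134217728, 134217728, 134217728, 134217728, 134217728, 134217728, 134217728]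
def lfA58 : Lf := .mk 39649101497843399964804699431989859861859177215978217520062532498721937831320706584744925378826851042835986839625506702946101547447503555332810757953121532795394069869367163616713480519893583364241066529881176111836760564996648385249957528563636003317601676669055500650637784718476550007784650018780064392444661080732598377959348434368875801879340868280706461167238171530555206844797475634553981682496087840451054034812453160334126965595176337226165997205579715084957397434865117115492022147000153693936274956738652234662365079062653225552009389696732108660598748350160781142902357690593006121444015959242025497490811117668596981561285185873261064910 1740 [115380556, 146903707, 145539886, 148583215, 123523625, 149399340, 136784991, 127208387, 135285805, 147525873, 131175109, 127861257, 127204709, 126198734, 122470367, 135616300, 132322514, 137628158, 136386999, 134062813, 135611449, 134508355, 133766111, 133741393, 134464121, 134494370, 134348691, 133981834, 132279000, 133951323, 133064633, 134177582, 135995331, 133530234, 133345210, 134954907, 134275689, 134337848, 133591494, 133898998, 134139304, 133833503, 133739927, 134519798, 133436333, 133573766, 134527534, 134047602, 134527985, 134093061, 134122830, 134041938, 134347464, 134491439, 134646565, 134101763, 134242150, 134330623, 134249334, 134254547, 134169386, 134126430, 134221477, 134220729, 134204043]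
def lfA59 : Lf := .mk 49215032920300695668384702056715957567299761704113904109940349365694121090579908768401544425431234092770462597767368783478098986334956436061508086710292064300466344411253634885736841789242782015296914530944456355561192365358944284829403198123920727186957745892773005068268237218917786364448075825352354054608478444310489034991741765466332186416695363321569697370633149309109844486603420264120137761315519560473989405025751982548206888984127694964336526135240299686126655114281920253617292939238501727132346543755763052042703586825519536870384558811108445614875909867667396195812586104945703345913102802150291048559769490422317017672694500996703799511 1770 [164467546, 139737741, 133293873, 144086416, 132885554, 100434425, 94710655, 133789837, 117448030, 122492943, 143186982, 104241462, 143957673, 145619141, 127822420, 135233901, 133218096, 134992914, 133771422, 130023964, 131991679, 134362696, 135958733, 131172944, 142024738, 134217728, 134217728, 134217728, 134217728, 134217728, 134217728, 134217728, 134217728, 134217728, 134217728, 134217728, 134217728, 134217728, 134217728, 134217728, 134217728, 134217728, 134217728, 134217728, 134217728, 134217728, 134217728, 134217728, 134217728, 134217728, 134217728, 134217728, 134217728, 134217728, 134217728, 134217728, 134217728, 134217728, 134217728, 134217728, 134217728, 134217728, 134217728, 134217728, 134217728]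
def lfA60 : Lf := .mk 41380108582642082776611560294832900631449814526122153163073943564731903382855679997216880840912279447946213494109954693347950607089878388420724926965855229009995160567695639951608400363832695650443338779381685210281853512860538644578935050395666221078089937274491833947352247676233939877783208848344256764055979647507908386360317232688338474596137474402986805063640534545642699746413780624494922618539174162278797763306446736674629510404895421824712607093908380102855698015042372354493418517815933413312258914801432902834873970066767137962393977563784442677671321302989918289912692864537483096666052348187791074667213834974771722721185278299275096310 1800 [142790801, 141757669, 99889485, 121401021, 134832933, 134973998, 103999810, 94836308, 132459177, 133950759, 151121375, 114976280, 138432169, 152926479, 129510162, 130192841, 141027515, 135956270, 148432277, 134217728, 134217728, 134217728, 134217728, 134217728, 134217728, 134217728, 134217728, 134217728, 134217728, 134217728, 134217728, 134217728, 134217728, 134217728, 134217728, 134217728, 134217728, 134217728, 134217728, 134217728, 134217728, 134217728, 134217728, 134217728, 134217728, 134217728, 134217728, 134217728, 134217728, 134217728, 134217728, 134217728, 134217728, 134217728, 134217728, 134217728, 134217728, 134217728, 134217728, 134217728, 134217728, 134217728, 134217728, 134217728, 134217728]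
def lfA61 : Lf := .mk 49215032920300695670285081434707244302968317253964437361204107820688759762094799112070973755918314501834283074897692335295001116106136694684944453630233071529499375835342267638791644940587199263604494121151766713248349847407932573590854267057692460308251569893898639278180435103204233607043082656650555366251968302570215477188427234632481588225745564514726991902383708453971249970075440837853739758537980533978517331000299238195723903279141552858477100658066240783363750575655812563353546386761436892632275330285797928508959029239948407172439002193865151165069345258136598701453598450485785668490876160663340843830419259917489259967092264516329621719 1830 [164467546, 133924945, 139806854, 100216434, 125357318, 136643092, 170652006, 147244546, 142421366, 139140437, 134327732, 175864045, 134217728, 134217728, 134217728, 134217728, 134217728, 134217728, 134217728, 134217728, 134217728, 134217728, 134217728, 134217728, 134217728, 134217728, 134217728, 134217728, 134217728, 134217728, 134217728, 134217728, 134217728, 134217728, 134217728, 134217728, 134217728, 134217728, 134217728, 134217728, 134217728, 134217728, 134217728, 134217728, 134217728, 134217728, 134217728, 134217728, 134217728, 134217728, 134217728, 134217728, 134217728, 134217728, 134217728, 134217728, 134217728, 134217728, 134217728, 134217728, 134217728, 134217728, 134217728, 134217728, 134217728]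
def lfA62 : Lf := .mk 41380108582642082780848971002629254238111295865102345502110564213621721424900232575251812459938904804593109103666883126735187002183568213335908814091895296125991678608358755496475426035327197540891457283921704551202110743957091836660789479729843044673443803483611358904929383867832714349273289706170856532801348792761844749589467073831023027423300233436813931811932602615180112875577006390278177149135639758741569905071642915581464203471067994426482285791238439420714161606209514318892681786622440778594447103423806995298349474059445346519517576662087335562752883981200628048987751393578030189438188024768348517668084722465181063736299548951951274230 1860 [142790801, 100964208, 145596759, 136991775, 137508359, 122105965, 195705435, 134217728, 134217728, 134217728, 134217728, 134217728, 134217728, 134217728, 134217728, 134217728, 134217728, 134217728, 134217728, 134217728, 134217728, 134217728, 134217728, 134217728, 134217728, 134217728, 134217728, 134217728, 134217728, 134217728, 134217728, 134217728, 134217728, 134217728, 134217728, 134217728, 134217728, 134217728, 134217728, 134217728, 134217728, 134217728, 134217728, 134217728, 134217728, 134217728, 134217728, 134217728, 134217728, 134217728, 134217728, 134217728, 134217728, 134217728, 134217728, 134217728, 134217728, 134217728, 134217728, 134217728, 134217728, 134217728, 134217728, 134217728, 134217728]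
def lfA63 : Lf := .mk 46057307068878454868303102171628546630851585768833060560751247624146281128626591886543338695532666568384735078124077972139624801364996417038032921075535634000111349819937823740499903015339646403752380056395581800287582571942114469679727976294846390838396456388661555231794531414716854481090010760192651051160628636431847745764034840199398679377878305047250987580525127758809098076724538659112589741239770661435470734090656599945547707567389109777719062585408677875429598093873368596044910802032373141426825318877132154046119294008049737870134218775547245040863601347314851575566976780350288818719076588765889460589334913325636950914786715041619084014 1890 [172625735, 105541361, 108624246, 112731215, 128965244, 107092872, 131478674, 145355117, 130879955, 121198813, 153219492, 141630245, 138003256, 136330104, 148774368, 131742148, 133608749, 127701761, 135488718, 134114178, 134073351, 132514005, 133532711, 132026559, 139084414, 135424670, 134269975, 135082299, 135780223, 134446496, 139565206, 134217728, 134217728, 134217728, 134217728, 134217728, 134217728, 134217728, 134217728, 134217728, 134217728, 134217728, 134217728, 134217728, 134217728, 134217728, 134217728, 134217728, 134217728, 134217728, 134217728, 134217728, 134217728, 134217728, 134217728, 134217728, 134217728, 134217728, 134217728, 134217728, 134217728, 134217728, 134217728, 134217728, 134217728]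
def lfA64 : Lf := .mk 23339943386893639167292912698363393971852319918528392497503215261681383625478050718179123881839638688849950103369015169256590535672083415011431583933728522464439258515072322311449116955692961395560108075855015798505593683120945352416803864721251425631999760335358402895315139903161327731578181902556043567385252356793153799966260702337979059973250589212239860555836401992617230103509931970199084942427944855868754276506796444569955838077121438029833309974679921897424508605843676129147739429777023350473485239357715749894758857511906679059653188399326224247037635677956407025691350356042076146206213060260116821473516320357245627049529418418499350915 1920 [81852453, 88162937, 93114109, 144021552, 145847224, 148513840, 133337972, 131838054, 136847181, 138848032, 129889317, 131280950, 129618991, 127774057, 133742252, 133605493, 134165218, 132404744, 133293737, 135693465, 133988498, 131850103, 133944181, 133492690, 133320983, 134868990, 133169208, 134953197, 134731820, 135152288, 134961084, 135019438, 133914640, 134333497, 135070828, 133485992, 133993248, 133862832, 133306500, 133998517, 134620744, 133796830, 133571324, 133573777, 134205305, 134096660, 133639267, 134336476, 133590204, 134132863, 134511914, 134318593, 134061856, 134220193, 134166867, 133906096, 134213375, 134209633, 134204723, 134223654, 134212091, 134230543, 134214317, 134178946, 134221516]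
def lfA65 : Lf := .mk 48213455416189317675235251598891296235695197584818481681230783411670518386200874773214903852363354867020633595499272329925087580267800038527307314930965869748258549927267380185196679383053085794739367311700492453609045149849524836959230321707399808453165217796620332069930215629744745519040180299810395965691271555495751255221069576163793246834650999402617901459123960006101077908563273070298776511789223981849308565274539740445110146564932930432175210536329681618617391174342023259846811417431769717797758561917271223125736784079091806484791438157638742191655706126577722020837624991647245656920314640309480210411641544303123523073495801687683871473 1950 [142169137, 150931734, 149134876, 125313765, 138312979, 124281248, 123805859, 151036312, 130146733, 128367173, 107423340, 145049622, 148620742, 152541891, 149259070, 134006260, 133112225, 134139070, 136626184, 134037850, 134801689, 133863278, 134794585, 134206471, 133771062, 134374831, 135106319, 133718915, 134634754, 133000961, 135032037, 132925679, 133650564, 134023731, 134464573, 133444264, 134007345, 133973276, 133718447, 133926514, 134481036, 134401247, 133931175, 133988194, 133943863, 133917565, 133960703, 134204594, 133936389, 133818222, 134252907, 134412330, 134082642, 133970421, 133823686, 134456838, 134250610, 134182154, 134122527, 134180531, 134187846, 134338610, 134217728, 134217728, 134217728]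
def lfA66 : Lf := .mk 48213455421661784089756662499307883127592145196844319776757358128602976597364206524011726588520354493712616852437605221447520433060371258853061097193133936463072128970553592736060494961146579278799511829020860939642366531139469801089748555673479648244149805611233263155774889934360424506840072343586973307033548514980879850966511303292836358514578349708301868908227749162214668400258789919062869922996164987728469056170290822824423956144711557816060642085157106240008400020720120983934030678790188961282658886230687537060325175460660881611967772587042028501461891306476192631064096665841634133124323849218310642447839930999740102042721284212340798193 1980 [151810351, 149690282, 138243134, 139759919, 126134674, 124281248, 123805859, 125157697, 129965505, 126977222, 159513621, 133901124, 113346608, 156186822, 127680633, 124668309, 132018220, 143732162, 132119991, 133815941, 134171538, 134233860, 134041438, 135053533, 135480692, 133858076, 133851761, 133516468, 133510198, 132890635, 132892433, 135095102, 134151019, 133793838, 134336718, 134146030, 134162780, 134003862, 133694460, 134154414, 134349336, 134015696, 133994726, 133937727, 134357764, 134359854, 133951674, 134157376, 133908661, 134226276, 134345138, 134187561, 133970187, 134950492, 134217728, 134217728, 134217728, 134217728, 134217728, 134217728, 134217728, 134217728, 134217728, 134217728, 134217728]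
def lfA67 : Lf := .mk 49142048531837961772445968167047753853935375147109839588622381559852167355306312044916468282353451195662315692763540204679528142790803037169811548533880104951955105102422819704118156923646935498322582572322644983205023083539998208895015422933821986391475175290853666887933383148060752839708637098193707908768921777040287350567308908598709357343801205964459008870674521558281454575212415403468752277954157519745080574345416896139698640803666726150908038554862853985134027198962512771678925622115052826761488142311920422932513682587089489826164940030125037377553833135359545630687419741911256876845733296373871094598921741173284717187144309731310502586 2010 [138214000, 152221941, 135703033, 121738202, 119414260, 114915190, 120050942, 139434828, 128852473, 124308323, 127500982, 144640358, 121502709, 172031335, 134217728, 134217728, 134217728, 134217728, 134217728, 134217728, 134217728, 134217728, 134217728, 134217728, 134217728, 134217728, 134217728, 134217728, 134217728, 134217728, 134217728, 134217728, 134217728, 134217728, 134217728, 134217728, 134217728, 134217728, 134217728, 134217728, 134217728, 134217728, 134217728, 134217728, 134217728, 134217728, 134217728, 134217728, 134217728, 134217728, 134217728, 134217728, 134217728, 134217728, 134217728, 134217728, 134217728, 134217728, 134217728, 134217728, 134217728, 134217728, 134217728, 134217728, 134217728]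
def lfA68 : Lf := .mk 48213455421661784094853294020388696411903206859214362159062116349453924885774730842448584962646079491942239328602572134460174220529808699246577035125617788912695078620025794302353198850190336971318216983803234579337820649490243038143864151034250401607130367028229250850585058518237546512458411772712312809498637650982493455161833609075791702976506777933336128780347395413939032159391316007223030107144242217641594889959499763106217755980562435933589222164225146451958140230965442676967242366089783836667781179709068111172253784517484851535070125311658826159028063765257203603307494903365291301021757380261212536845961476046974435665697887399663874801 2040 [151810351, 139969470, 149134876, 125313765, 123655666, 136204572, 158263598, 135796536, 132176541, 128996035, 153493178, 135420059, 159778068, 120414463, 128543051, 147888645, 136864345, 134482478, 134306483, 134246524, 134213712, 134239613, 134285832, 134108706, 134273160, 134450906, 134270357, 134424327, 133573554, 134670811, 132767074, 132587400, 134869124, 133949640, 134826149, 134385258, 134105740, 134171338, 134220199, 134188407, 134278246, 133939055, 133956132, 133957120, 134142748, 134127093, 133977377, 134199250, 133938282, 134313688, 134352049, 134559219, 134123321, 134048872, 134822710, 134217728, 134217728, 134217728, 134217728, 134217728, 134217728, 134217728, 134217728, 134217728, 134217728]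
def lfA69 : Lf := .mk 49142048531837961777811861782732933655659543146097211274561643850987018151256251526501187434582138885475246811795998066163220144800023970099451470851220936433513485831019851924909047635656734187948019551330727178315046469543800309699405725932608853063307123718043668765827671029195068480043215329293796960473272484298256242202007011024924568835906112026153303664098988713134598780763043085552193687199478092429538717234427999915921163105876432884344985013466315438007829740767822163300823406261957416370847225276905426084150308122026719258142813250781103305004936188905877824042879336680295255966474350386582489308164186318440459360635803246439498426 2070 [138214000, 137732414, 151937909, 120672243, 119231338, 115794993, 143560884, 145472710, 129014597, 125414112, 123092914, 141383854, 174299201, 134217728, 134217728, 134217728, 134217728, 134217728, 134217728, 134217728, 134217728, 134217728, 134217728, 134217728, 134217728, 134217728, 134217728, 134217728, 134217728, 134217728, 134217728, 134217728, 134217728, 134217728, 134217728, 134217728, 134217728, 134217728, 134217728, 134217728, 134217728, 134217728, 134217728, 134217728, 134217728, 134217728, 134217728, 134217728, 134217728, 134217728, 134217728, 134217728, 134217728, 134217728, 134217728, 134217728, 134217728, 134217728, 134217728, 134217728, 134217728, 134217728, 134217728, 134217728, 134217728]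
def lfA70 : Lf := .mk 49142048537599546165645096631447581315164078332179122317661801942308208838237195927429272511181991610652131714209796744606244978570797825304585601237116043417216445075700420214678262684619769973865679472954521458400540306130788642501944450438269810749299163499260436178773803294398302578118083481839709967556707412926889877642703776423333961463074372915074564135317896837939853905506591820630228314355994399569019426039309787025035916471675884054638792221293192085236549298133237759503238154911910181835581985275785196058825506716645552215508217696698776945177030436156441685689977769401186467596856763985679258189242214119967111293792646150694699706 2100 [152584880, 135881946, 135703033, 121738202, 118332720, 115794993, 143560883, 131425951, 128916228, 124948070, 177704090, 134217728, 134217728, 134217728, 134217728, 134217728, 134217728, 134217728, 134217728, 134217728, 134217728, 134217728, 134217728, 134217728, 134217728, 134217728, 134217728, 134217728, 134217728, 134217728, 134217728, 134217728, 134217728, 134217728, 134217728, 134217728, 134217728, 134217728, 134217728, 134217728, 134217728, 134217728, 134217728, 134217728, 134217728, 134217728, 134217728, 134217728, 134217728, 134217728, 134217728, 134217728, 134217728, 134217728, 134217728, 134217728, 134217728, 134217728, 134217728, 134217728, 134217728, 134217728, 134217728, 134217728, 134217728]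
def lfA71 : Lf := .mk 65125353887580808084560322219415255243017657026121479932203647812998671252151212467884829600707294916720645827234141846175104618319571503573148106777045499319889493539649051500681357465156757674600191868720121971161464716575954154613513417413874502843099182474293801845232820635179281628055480390931245607925456596626027184720959274467365858031153663151680204020841119296761976529993558838883766473699907461403995576992188155072152264975438680655058317371327721102310977655400394775717820808542573892647270096017506922451941973382766075778337997069683138811543578325134912989168720794723511946021573823414470676783468850750578245951494861940985392074 2130 [187261316, 180869090, 175853783, 111456183, 107217519, 101026433, 136301232, 140351091, 127131894, 121735954, 145594536, 142048056, 146331752, 151010448, 134119632, 134026986, 134288327, 133908557, 134835155, 133298256, 134374209, 135938810, 134143656, 134560033, 134749738, 133520836, 134830687, 133358623, 133500481, 133396099, 133559133, 133365778, 134298438, 133923359, 133570569, 134512054, 134500530, 134613781, 134861166, 134570310, 133839495, 134222844, 134590609, 134586164, 134292857, 134267536, 134533846, 134441157, 135544691, 134217728, 134217728, 134217728, 134217728, 134217728, 134217728, 134217728, 134217728, 134217728, 134217728, 134217728, 134217728, 134217728, 134217728, 134217728, 134217728]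
def trA : Tr := .node (.node (.node (.node (.node (.node (.node (.leaf lfA0) (.leaf lfA36)) (.node (.leaf lfA10) (.leaf lfA46))) (.node (.node (.leaf lfA3) (.leaf lfA39)) (.node (.leaf lfA21) (.leaf lfA57)))) (.node (.node (.node (.leaf lfA1) (.leaf lfA37)) (.node (.leaf lfA15) (.leaf lfA51))) (.node (.node (.leaf lfA6) (.leaf lfA42)) (.node (.leaf lfA28) (.leaf lfA64))))) (.node (.node (.node (.node (.leaf lfA10) (.leaf lfA46)) (.node (.leaf lfA14) (.leaf lfA50))) (.node (.node (.leaf lfA12) (.leaf lfA48)) (.node (.leaf lfA25) (.leaf lfA61)))) (.node (.node (.node (.leaf lfA11) (.leaf lfA47)) (.node (.leaf lfA19) (.leaf lfA55))) (.node (.node (.leaf lfA13) (.leaf lfA49)) (.node (.leaf lfA32) (.leaf lfA68)))))) (.node (.node (.node (.node (.node (.leaf lfA3) (.leaf lfA39)) (.node (.leaf lfA12) (.leaf lfA48))) (.node (.node (.leaf lfA5) (.leaf lfA41)) (.node (.leaf lfA23) (.leaf lfA59)))) (.node (.node (.node (.leaf lfA4) (.leaf lfA40)) (.node (.leaf lfA17)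 (.leaf lfA53))) (.node (.node (.leaf lfA8) (.leaf lfA44)) (.node (.leaf lfA30) (.leaf lfA66))))) (.node (.node (.node (.node (.leaf lfA21) (.leaf lfA57)) (.node (.leaf lfA25) (.leaf lfA61))) (.node (.node (.leaf lfA23) (.leaf lfA59)) (.node (.leaf lfA27) (.leaf lfA63)))) (.node (.node (.node (.leaf lfA22) (.leaf lfA58)) (.node (.leaf lfA26) (.leaf lfA62))) (.node (.node (.leaf lfA24) (.leaf lfA60)) (.node (.leaf lfA34) (.leaf lfA70))))))) (.node (.node (.node (.node (.node (.node (.leaf lfA1) (.leaf lfA37)) (.node (.leaf lfA11) (.leaf lfA47))) (.node (.node (.leaf lfA4) (.leaf lfA40)) (.node (.leaf lfA22) (.leaf lfA58)))) (.node (.node (.node (.leaf lfA2) (.leaf lfA38)) (.node (.leaf lfA16) (.leaf lfA52))) (.node (.node (.leaf lfA7) (.leaf lfA43)) (.node (.leaf lfA29) (.leaf lfA65))))) (.node (.node (.node (.node (.leaf lfA15) (.leaf lfA51)) (.node (.leaf lfA19) (.leaf lfA55))) (.node (.node (.leaf lfA17) (.leaf lfA53)) (.node (.leaf lfA26) (.leaf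 lfA62)))) (.node (.node (.node (.leaf lfA16) (.leaf lfA52)) (.node (.leaf lfA20) (.leaf lfA56))) (.node (.node (.leaf lfA18) (.leaf lfA54)) (.node (.leaf lfA33) (.leaf lfA69)))))) (.node (.node (.node (.node (.node (.leaf lfA6) (.leaf lfA42)) (.node (.leaf lfA13) (.leaf lfA49))) (.node (.node (.leaf lfA8) (.leaf lfA44)) (.node (.leaf lfA24) (.leaf lfA60)))) (.node (.node (.node (.leaf lfA7) (.leaf lfA43)) (.node (.leaf lfA18) (.leaf lfA54))) (.node (.node (.leaf lfA9) (.leaf lfA45)) (.node (.leaf lfA31) (.leaf lfA67))))) (.node (.node (.node (.node (.leaf lfA28) (.leaf lfA64)) (.node (.leaf lfA32) (.leaf lfA68))) (.node (.node (.leaf lfA30) (.leaf lfA66)) (.node (.leaf lfA34) (.leaf lfA70)))) (.node (.node (.node (.leaf lfA29) (.leaf lfA65)) (.node (.leaf lfA33) (.leaf lfA69))) (.node (.node (.leaf lfA31) (.leaf lfA67)) (.node (.leaf lfA35) (.leaf lfA71)))))))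
def lsA : List Lf := [lfA0, lfA1, lfA2, lfA3, lfA4, lfA5, lfA6, lfA7, lfA8, lfA9, lfA10, lfA11, lfA12, lfA13, lfA14, lfA15, lfA16, lfA17, lfA18, lfA19, lfA20, lfA21, lfA22, lfA23, lfA24, lfA25, lfA26, lfA27, lfA28, lfA29, lfA30, lfA31, lfA32, lfA33, lfA34, lfA35, lfA36, lfA37, lfA38, lfA39, lfA40, lfA41, lfA42, lfA43, lfA44, lfA45, lfA46, lfA47, lfA48, lfA49, lfA50, lfA51, lfA52, lfA53, lfA54, lfA55, lfA56, lfA57, lfA58, lfA59, lfA60, lfA61, lfA62, lfA63, lfA64, lfA65, lfA66, lfA67, lfA68, lfA69, lfA70, lfA71]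
def lfB0 : Lf := .mk 38595132339838056748146395876311355854745174581716061978095853661158075431256689011719250835737828552781635431921575626957657570756680200752030355874245034753106822064505888927983756756388184223011406968806825111086333264559304570883702666623489807744517808015697791634929917313572777220343844970694462542009168903904982838532262986966968382027323991735379503108445787638204341107271715627416293554921269985806563023996126057528784613052557516397526033328969221997398290380459108833113398021063832152922290393373438298100610648500839621605947584600798382138648197767874177733219635920027104609251423147134514465674005625553842714224381916166005586514 0 [145392574, 153426916, 132446143, 130264439, 107736628, 131042057, 111565685, 137460323, 150024459, 136862145, 189473588, 134217728, 134217728, 134217728, 134217728, 134217728, 134217728, 134217728, 134217728, 134217728, 134217728, 134217728, 134217728, 134217728, 134217728, 134217728, 134217728, 134217728, 134217728, 134217728, 134217728, 134217728, 134217728, 134217728, 134217728, 134217728, 134217728, 134217728, 134217728, 134217728, 134217728, 134217728, 134217728, 134217728, 134217728, 134217728, 134217728, 134217728, 134217728, 134217728, 134217728, 134217728, 134217728, 134217728, 134217728, 134217728, 134217728, 134217728, 134217728, 134217728, 134217728, 134217728, 134217728, 134217728, 134217728, 134217728]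
def lfB1 : Lf := .mk 40674034831427455862035015578734266341275614247124521726024346287751312295730670571799217636186997982565530236180017944707937282541238422763083858367817092728149872628149057730438098889374191877235189812851663297404219680059941911882247006848221313045960447999503713881465289762429128232295887072328076055004844396510451456266719950006349305142032169010710861990525952285680472910365746672842958093157897630899307489555772161334064418010047146260179328179873106566133668078406036391925556578706321784558333518896363184322740225126774742311933374140849193634678147041440922631236360629556908967475646518768349604487300911082546500198521681207581595300 30 [123680998, 150983914, 155750545, 115501770, 129604855, 153726070, 116343377, 125812626, 153487135, 150623308, 151136290, 105474132, 149594030, 157103902, 139568862, 129161498, 148009936, 129894495, 130425548, 132105903, 133783481, 137115724, 135022295, 136147895, 131036948, 132008083, 133197617, 134539835, 135487877, 135470714, 133620072, 133939848, 134847900, 135896762, 134000270, 136037565, 133726247, 134789803, 134611616, 134007059, 132946564, 133313075, 134382630, 134297907, 133719260, 136037525, 134217728, 134217728, 134217728, 134217728, 134217728, 134217728, 134217728, 134217728, 134217728, 134217728, 134217728, 134217728, 134217728, 134217728, 134217728, 134217728, 134217728, 134217728, 134217728, 134217728]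
def lfB2 : Lf := .mk 41130519491118624034098628905992206167704988944143224704476340947289267028346778318243899334022480679192265581705380262639913553685538714087615513504680336393723438236679582856004519779855493781180092440514611551211700031317885661832331099313146600546963445060220668224168328559275939064265388537092082716442449033129762500506965170434454097140852445746100553039314459419153924919574503874632971112970349453222680175692413290961018896584191970794771320033967681523800353439370571347078496553491522033451336426079402160803115939581858426877131358410887947206701830042391742221145888150043326297512544095216580332492797486420575909034599654035670066525 60 [161595422, 174555675, 157951877, 135398398, 135635430, 217578627, 134217728, 134217728, 134217728, 134217728, 134217728, 134217728, 134217728, 134217728, 134217728, 134217728, 134217728, 134217728, 134217728, 134217728, 134217728, 134217728, 134217728, 134217728, 134217728, 134217728, 134217728, 134217728, 134217728, 134217728, 134217728, 134217728, 134217728, 134217728, 134217728, 134217728, 134217728, 134217728, 134217728, 134217728, 134217728, 134217728, 134217728, 134217728, 134217728, 134217728, 134217728, 134217728, 134217728, 134217728, 134217728, 134217728, 134217728, 134217728, 134217728, 134217728, 134217728, 134217728, 134217728, 134217728, 134217728, 134217728, 134217728, 134217728, 134217728, 134217728]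
def lfB3 : Lf := .mk 40674034834734712930757917105178036460564359455214113273377700796819520072573239173583438290824950877093502721545509187261769710760877381849781648278173348031635094581435138392991338620145502704172967269480140027421018722709061626215611421625414993760431552185627296308674644933435606750244640267184324277505205878477680492024828747020600989600598413338466419961195515890765614338894264715983965460611273762098930646567254104348773699297878321696884649886906593930249124801951017900186153019427660788353798405302581391707952495244696581093767837606558729443994141199271986946324154699629257367073267767950523344234006087062722625758561354298597168804 90 [154000726, 133345569, 129074819, 158783523, 125956623, 116986675, 124763650, 157053645, 153487135, 119442543, 152628527, 160997619, 118611456, 112166789, 121210229, 139612956, 119852258, 137364147, 136434400, 135287318, 131558581, 130946778, 132814274, 134305989, 136090540, 136210582, 133456572, 133210762, 132464013, 132934020, 134951605, 134621949, 134224346, 132465715, 134555268, 134353197, 135257242, 133864555, 134135807, 133823066, 136700350, 134217728, 134217728, 134217728, 134217728, 134217728, 134217728, 134217728, 134217728, 134217728, 134217728, 134217728, 134217728, 134217728, 134217728, 134217728, 134217728, 134217728, 134217728, 134217728, 134217728, 134217728, 134217728, 134217728, 134217728, 134217728]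
def lfB4 : Lf := .mk 43951954326262002451919920319826344080038922335846723409959810484266729685790991498180000222007135482314349810303492720882527618936608719244762664952107592033938659640148241845527656509512857359639450189002485755973895208070635366831128317071976573705624076871366688707750545406672840028872472249987771729913121318258775790797248016910793760587389475537988666622164189793903363086016837927969835784551023484133828312499121712413677891615439098233888110724202324648957684015700500442819071585473660669293346977899289937895014515637473978124826899806451754419784102587783593680863932572873494401838607787775073825155880125624902671891871187793357966938 120 [101398693, 77802899, 160497580, 120040842, 111811363, 113756920, 116322918, 154442820, 169782045, 128541789, 133622230, 125040755, 130759751, 127663974, 126046869, 131158646, 139081825, 131568873, 131553189, 134262936, 133425219, 135916998, 131600753, 134255493, 132287768, 133705941, 132547867, 133892208, 133475231, 133439067, 133764205, 135111673, 133904301, 133726235, 135390842, 137460318, 134217728, 134217728, 134217728, 134217728, 134217728, 134217728, 134217728, 134217728, 134217728, 134217728, 134217728, 134217728, 134217728, 134217728, 134217728, 134217728, 134217728, 134217728, 134217728, 134217728, 134217728, 134217728, 134217728, 134217728, 134217728, 134217728, 134217728, 134217728, 134217728, 134217728]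
def lfB5 : Lf := .mk 41130519495978911288120673575082809086255037764507306970787804240399692709526878065996166054553986863239450849855235968525778030779284485476939733493354773355221707691959464666626648171226396838056828199901356319613021423526766297554949154626350173901508840070802155819768099264064107020174798482146221871890389846317577395688501244993569853734442320380073996523105213332569369689547365547008304921050567325565525782757847687639561196840431764809515436641432416508394742094427994328939286128497834766989619581718186610494612955960147256852894661749512856285039406440900435147063488820300578401318314001670608408953956759049307807851066189085376144733 150 [155750798, 177955756, 137928238, 220831729, 134217728, 134217728, 134217728, 134217728, 134217728, 134217728, 134217728, 134217728, 134217728, 134217728, 134217728, 134217728, 134217728, 134217728, 134217728, 134217728, 134217728, 134217728, 134217728, 134217728, 134217728, 134217728, 134217728, 134217728, 134217728, 134217728, 134217728, 134217728, 134217728, 134217728, 134217728, 134217728, 134217728, 134217728, 134217728, 134217728, 134217728, 134217728, 134217728, 134217728, 134217728, 134217728, 134217728, 134217728, 134217728, 134217728, 134217728, 134217728, 134217728, 134217728, 134217728, 134217728, 134217728, 134217728, 134217728, 134217728, 134217728, 134217728, 134217728, 134217728, 134217728, 134217728]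
def lfB6 : Lf := .mk 41783086871943937131359394643874594528536478315890842437125249611083863258701924523810643168757694485193530327420838786315402579753214926636164403182009688794857165582131828313218124913705386724720697818608823054016730699951900195162323308100533472896037475301304007879093611278893284682781158402135588683402582019456489375924924917790489010283354193163458778650881131034123249046665322764817398151227372851458732852147854397836332348651126130421471301793957749404781544257384323718820664662046894968836253311746271696342998390796663331898842383988196126384779609175334304137139675380154318032526009110868617100813996792683371856307438585461811571335 180 [122569443, 114194714, 149412524, 149323554, 161650694, 145582698, 130698862, 143781416, 100461688, 125205079, 123202921, 119226364, 128704603, 124451223, 117472521, 129115306, 143334565, 131185609, 132555670, 133413641, 135736671, 136052913, 132654445, 133482110, 135044699, 134845878, 132273106, 134649514, 134292377, 134073315, 134130367, 134519110, 134210019, 134022964, 133756414, 134401393, 134169797, 134630437, 134785483, 133864267, 134738431, 133711545, 133884493, 133650476, 134015329, 134827929, 134364849, 134374509, 134782133, 134448884, 133874167, 133672851, 133883969, 133958445, 134071146, 133877032, 134240443, 134259195, 134177913, 133988758, 134176354, 134185584, 134145561, 134213623, 134164063, 134237584]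
def lfB7 : Lf := .mk 43223421613811591249064398969208883415051378474157462583666385403412187600681651782709448409063679566391492207946172395793055878980061776988737492948131929861061776962201664773343775070309614570588611159903030257215404625022908629426413421770580966742332816764877760556439033498595118059622978137744823925242423164173179800447264722743530800033078942324603680133252015140961608611791181260601660414366786289560223456700971741095912412943605616804109039084284057945763640583659014767066475966094819179433252282421079081571131970221707361494895464848661066793416107998674704926870120717342952994908971334579896618887884540601746473289537500356346444357 210 [118886711, 123031341, 151766842, 159030032, 143245723, 136933849, 139940091, 140598083, 111348780, 118050021, 120460954, 143265166, 101246643, 133485238, 117728050, 148592405, 151642245, 135441966, 134807963, 141821261, 136743235, 135593669, 133462825, 131018922, 130151897, 134667207, 132624156, 134265264, 134494891, 134403729, 134762698, 131769440, 133347412, 133528217, 134955869, 134273822, 132438594, 134505252, 134924028, 134048593, 133957835, 134012292, 133576140, 134023160, 134452721, 133606260, 134598252, 133722280, 134815331, 134447355, 133244771, 133797080, 134079685, 134295416, 134072573, 134042981, 133846603, 134128573, 134190395, 134044914, 134218608, 134265756, 134148913, 134211574, 134218769, 134227471]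
def lfB8 : Lf := .mk 43223421610378915389183282226507795727334431598479723941217197342202084878952344180636270191816673549447789854058403543363822680576216461689621393348564264364331527482337442238677681071083743521706718921656647433930248018521601067734946012881863335393051118892956093726931750400699838424926963585825702602743097071396131022615162406915287829899837564009593396686002658365425246579705663400047787192910458150278430075836584052317714591196694250082754618637535116709216735024409397200785595576271183018957313472515112830823883920929743154320193197013798803155700433818427008561423105995303112729998379013004978445219141219429532784110372730568749152837 240 [132071433, 115361197, 154930282, 141239360, 143362593, 154627288, 140452643, 142499763, 111348779, 139589346, 119430132, 106397255, 160749049, 123797367, 125640138, 113818772, 127519316, 129876984, 134082566, 127243831, 140762884, 135568495, 134404088, 134495218, 137879327, 134189600, 132932068, 135296773, 133445410, 133502990, 133479307, 138306051, 134217728, 134217728, 134217728, 134217728, 134217728, 134217728, 134217728, 134217728, 134217728, 134217728, 134217728, 134217728, 134217728, 134217728, 134217728, 134217728, 134217728, 134217728, 134217728, 134217728, 134217728, 134217728, 134217728, 134217728, 134217728, 134217728, 134217728, 134217728, 134217728, 134217728, 134217728, 134217728, 134217728, 134217728]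
def lfB9 : Lf := .mk 44270747657138693533741513646891814680405932758877629520321871608118872510053171286408780283642446078665802766177653163556059730007595139877550239725973047684152621567834044470690377168817423753016853569125541345476463875273305273647011378722292062872249519816353811902998834537151228564359945527662032293968645048813318593574433323528482945257964275889953004010692438551114251125532029402141833534117007671688739882875514862776903633777703171591478255318251602733627829574494847637582155547066445362357395935368744213539086688635360481350343338870907805603092116283737055199295656714498899752922687483788718510923392064717017655461085970545936408418 270 [125027745, 118420453, 164844796, 119717977, 121413128, 112218513, 179970206, 140759562, 110679722, 136712262, 141557236, 130871985, 134792754, 137658354, 115006436, 134959251, 132534150, 135678057, 137166887, 139161468, 146434864, 134217728, 134217728, 134217728, 134217728, 134217728, 134217728, 134217728, 134217728, 134217728, 134217728, 134217728, 134217728, 134217728, 134217728, 134217728, 134217728, 134217728, 134217728, 134217728, 134217728, 134217728, 134217728, 134217728, 134217728, 134217728, 134217728, 134217728, 134217728, 134217728, 134217728, 134217728, 134217728, 134217728, 134217728, 134217728, 134217728, 134217728, 134217728, 134217728, 134217728, 134217728, 134217728, 134217728, 134217728, 134217728]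
def lfB10 : Lf := .mk 41963625335869494885388132393184394690305767466735946826302863595245906902581847585886861257790008686778454823713760843434671961842364454776979809460623548786220962436121638496048321412648196729014909171393437949498463568766709587090947620431299572951366223416307520970595384721574666674400414576382706598229063547009178955778871930203284377236671290413497216035840438219739760318893248108585755709274691464541418166519255856017477405722100268975566383196637763371325320241972336975019129950572802657701365596701190493001604246527058710720055156780568709484414553688736935224081919395945810591509960295237873650020737909516575103115640028411699219118 300 [131074592, 128814782, 150197025, 135746675, 111287176, 132336367, 154343751, 135428995, 130397569, 145065155, 151030783, 150482678, 140506022, 146151290, 148796068, 140446500, 123466762, 136979346, 136312079, 134568229, 132301960, 131425123, 135496417, 136342039, 132913171, 133726905, 135244778, 133604950, 134172993, 134686742, 134562947, 133855651, 134160093, 134505469, 134592182, 133981367, 134203099, 133351935, 133804610, 134275462, 133562011, 134753617, 134790916, 134502326, 134403855, 133296745, 133926361, 133943533, 133572163, 134025071, 134418574, 134731389, 134509582, 134696683, 134133063, 134807048, 134217728, 134217728, 134217728, 134217728, 134217728, 134217728, 134217728, 134217728, 134217728, 134217728]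
def lfB11 : Lf := .mk 40118490290612661116076234507073428959395165519045027317370203023221078311448493937756282424996180800040988043769814893706793169302634519802487073799181527935242124478678924232630197640050074188777324009661368240625075563515351877244747470236990256178894045904514345592928198541615857630538830791603682986945900377290774128158778499447104459688661098494695564833618685667219775627032012173421299024215067569678066453485712013270707142979823002087960993168895641874027127892886508956195407258222707501153467714344378150054852817513777374935522676856925329635838285546614129824015163347306302086241337305728234668726152563048824391605067442931828459764 330 [103512088, 151007092, 128272355, 148793956, 143990450, 127254340, 137609434, 130065217, 137509851, 124672127, 139843720, 119261481, 166056708, 152742912, 148684870, 126531817, 136104270, 132786317, 134507722, 127916834, 136516860, 136649552, 134095246, 135417106, 135204615, 135344043, 134822342, 131688910, 134153951, 134585835, 133530413, 134124752, 134240598, 137867830, 134217728, 134217728, 134217728, 134217728, 134217728, 134217728, 134217728, 134217728, 134217728, 134217728, 134217728, 134217728, 134217728, 134217728, 134217728, 134217728, 134217728, 134217728, 134217728, 134217728, 134217728, 134217728, 134217728, 134217728, 134217728, 134217728, 134217728, 134217728, 134217728, 134217728, 134217728, 134217728]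
def lfB12 : Lf := .mk 40118490290079372442069488885271490409438544813799172236405876322386862726610266899226327126345164226292304542376259998702604249827772549828683957971952286120038245375291143333179862544265837940615297795283337355461524271779447844236938038077391758861248001424494620795731982258684336550716103396531438551674568370596151727720624397896873352573539953781734767950360901589317854824284946791888876835679483045980284571143912886177607808848209156086352459623723916688939604495898549619592185381880966647809759456028546880370708841516162735059966252272606100863823140170526895004020596854133276194268262416064015509942402988764608964912873281783145367796 360 [163990193, 115824267, 132232358, 126330419, 144131931, 149606515, 138274104, 132531285, 137509851, 145484056, 138847710, 155645073, 103440592, 116387946, 137201810, 142690009, 131244438, 137055285, 133754014, 139569901, 131263995, 129855757, 135450753, 133694576, 135171499, 133676635, 135896035, 136626767, 135186153, 134699629, 135451105, 133464832, 134469835, 131703714, 133961703, 133535736, 135059956, 132800821, 134053496, 134497393, 134386746, 134313914, 134388632, 134379581, 133829956, 134037949, 134238007, 134582637, 133609556, 134230455, 134504696, 134039893, 134030310, 133976087, 134019318, 134576609, 134385870, 134403998, 134238302, 134497477, 134217728, 134217728, 134217728, 134217728, 134217728, 134217728]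
def lfB13 : Lf := .mk 38508584496136250988695414930764501527745639471157704223053724953372831976304416186207517466121214194054534778574977628770988872584850015764281996897316809598062362759633133874256391049591107201502762829831484008915072822959696890036184642239797570585705595705047351573023115633931028144093526027271300459717115855208713683764477687223271747516289787905840798675769815758736348438803683397989000752571709958533578246339774060741410665448223019325406511794843329867887171077711156231232104603768079607176708017929687528418141869348901294196825139772990866282025817821362837142812279359156586933294070641220921719358473575678715584989830730446961464120 390 [136538364, 138206824, 142440059, 148974419, 156178212, 146992768, 115164207, 143517720, 126409031, 135086671, 150342213, 128028834, 133737246, 136169759, 110490838, 133929212, 134622198, 134460964, 134072472, 133869572, 133933292, 134460547, 135082102, 134109521, 134441426, 134892972, 134696721, 134343847, 134966271, 134264620, 134231842, 134201646, 134144230, 134580757, 134537420, 134689824, 134394657, 133137080, 134131938, 134444460, 134333281, 134219440, 134033138, 134440647, 134213338, 134440415, 134366872, 134295295, 134246278, 134175112, 134301481, 134245210, 134250724, 134026678, 134401410, 134032384, 134192694, 134176723, 134246398, 134375383, 134245079, 134242737, 134269569, 134217741, 134254883, 134204819]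
def lfB14 : Lf := .mk 43826849108734060871424628563139533347907801474114385629379171579238810623914077966362554613959020644576281548513976831481268780134905438965319071774755139510919976430936227316662407724063847872752111831337083980431190478035869134436085873806696148171043405006764950894060966458080090531032023282288644985070413666457974210241376650197418704388489092534990099059461051044034552373635184301953610408952048844869767354663853400177357828689416034819446534521955468557645700786129413134015770644669126839820121042936138600849873045753083949963092508659667076900203415474277813830129405213965389643089973042891541548874015067198732080623621524481515051362 420 [123935727, 116543311, 171395431, 130306720, 123694542, 121458213, 211869554, 134217728, 134217728, 134217728, 134217728, 134217728, 134217728, 134217728, 134217728, 134217728, 134217728, 134217728, 134217728, 134217728, 134217728, 134217728, 134217728, 134217728, 134217728, 134217728, 134217728, 134217728, 134217728, 134217728, 134217728, 134217728, 134217728, 134217728, 134217728, 134217728, 134217728, 134217728, 134217728, 134217728, 134217728, 134217728, 134217728, 134217728, 134217728, 134217728, 134217728, 134217728, 134217728, 134217728, 134217728, 134217728, 134217728, 134217728, 134217728, 134217728, 134217728, 134217728, 134217728, 134217728, 134217728, 134217728, 134217728, 134217728, 134217728, 134217728]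
def lfB15 : Lf := .mk 41834681835002933033042683059488821497719777121981879946834380427679471537011024400533226713429513877699721444473107145597246161937350343020234637089024422968261460618340902202312499485600140221108946250259985860170987999430975887543554491181046063121511553134408088358189211219272691388583094213660168084390837470059234469219638024106488501083545325649966410619535773481580590722915633086554490287063775622134379432253933759608760639468108951577212789611347989924699926248022752215907576199733988322502309416878899361541602053465486838519575406778514057021289789249997320373157360256094029392986244276032248381120392497782338872557149548695505822707 450 [133712591, 161974320, 132342682, 141704055, 143508575, 134673806, 131114711, 118814799, 124725467, 161979485, 127092800, 108399682, 143340909, 151397069, 155594321, 142663884, 120243570, 139370302, 138938304, 131755431, 131227705, 131914065, 144023339, 134217728, 134217728, 134217728, 134217728, 134217728, 134217728, 134217728, 134217728, 134217728, 134217728, 134217728, 134217728, 134217728, 134217728, 134217728, 134217728, 134217728, 134217728, 134217728, 134217728, 134217728, 134217728, 134217728, 134217728, 134217728, 134217728, 134217728, 134217728, 134217728, 134217728, 134217728, 134217728, 134217728, 134217728, 134217728, 134217728, 134217728, 134217728, 134217728, 134217728, 134217728, 134217728, 134217728]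
def lfB16 : Lf := .mk 40824898308717534844389626274847792483986125345130755556074393302641733186095326572056451828201197480558728086454649857958224754543440346966057108501406795937599308884161106919735337492519351738350590609254116330168461055851215849973797284160944750288758695142134193168121289232495496357908336710492071581367021644749807517560509508920691843728791716410850940788673222427456974009553937356640694860004535921435007668071064105551744632608834480030749339924903695037040189475211746184130704025912212264242762781979481730024117234581515223499382906454149707923077990898575164688439627134023766813237129365850790774812762818300033758029196545421699337713 480 [146728425, 169758087, 116087229, 140391855, 162058540, 140409764, 140545675, 137320075, 144940166, 141699976, 125693759, 125930821, 125610382, 116576398, 161358633, 120460928, 122795999, 131790274, 135582563, 126491595, 134697690, 132069296, 136071172, 131441894, 142386935, 134217728, 134217728, 134217728, 134217728, 134217728, 134217728, 134217728, 134217728, 134217728, 134217728, 134217728, 134217728, 134217728, 134217728, 134217728, 134217728, 134217728, 134217728, 134217728, 134217728, 134217728, 134217728, 134217728, 134217728, 134217728, 134217728, 134217728, 134217728, 134217728, 134217728, 134217728, 134217728, 134217728, 134217728, 134217728, 134217728, 134217728, 134217728, 134217728, 134217728, 134217728]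
def lfB17 : Lf := .mk 39867630839450703545378164170500256007477612088176336317473502622472088804399223831405293202405636845044272424769463451039644023714414224769523645645568063531857367265126461369022370564114198705024596332812577174890445500408813698293089783831300626558186401854450693293791688693986346237325455812938711706130206955430447158211804157240258871693612852565683269102700181606810509827929064998889860537800951677329493424841396738572517143102293849285143969333888428210530515355066679243822495507364859287757123718586832767472238015032687158294074396192589751408766222815383938940865054444377895488662981393543534159117099199208071756629374702673659938829 510 [130413559, 109274550, 120823654, 128359878, 126560115, 153265224, 131426668, 123999899, 136909660, 123387862, 141331150, 129459629, 141572013, 146922306, 134170604, 137890391, 135425114, 140768014, 137801691, 134645138, 132479091, 133526758, 134328015, 137740873, 130515758, 134846661, 134023474, 134741723, 132777572, 131634010, 134530099, 133367680, 134825858, 134505355, 133203657, 134873698, 132556328, 134303818, 133290620, 135040724, 133582030, 134375922, 133728147, 134653899, 133745825, 133801045, 134162186, 135756579, 134217728, 134217728, 134217728, 134217728, 134217728, 134217728, 134217728, 134217728, 134217728, 134217728, 134217728, 134217728, 134217728, 134217728, 134217728, 134217728, 134217728, 134217728]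
def lfB18 : Lf := .mk 37532581005439235469967660217860045970490406159037928814474719421958759684656534926667998743045587087814707237209410426868171725606515927233031103063642249771948515427026109225453831758906289336870815324622606897105240160769292844445870861857656273588448059050685159173248885416474133013254899536398114070451758789675476056302785158965220805892234124908621567613111477164856857757446777589234996185012745334889181835069412323369670423448920562374261638768907041820535182816864368054284673259768763321999442143037088475660392713692912546528750736776908848167182553429615248701255926339585288565721541627747590021797048358764018185954509139987238631697 540 [147628064, 118307604, 113753939, 155303272, 173366818, 148311841, 147454352, 156015064, 128920665, 127576978, 134646091, 142569760, 130230589, 123029160, 127610365, 141978121, 131841525, 140070096, 135209089, 128976592, 133149511, 131208428, 132460212, 135897657, 133859936, 132570858, 132173052, 133860761, 134996807, 135578230, 134909340, 134351226, 133865119, 135017417, 133918023, 134453152, 133981919, 134300400, 133691838, 133482800, 133086425, 133954321, 134211331, 134661651, 134353893, 134537856, 133443830, 133774319, 134116091, 134232799, 133537286, 134450864, 133731288, 134544335, 134859269, 134217728, 134217728, 134217728, 134217728, 134217728, 134217728, 134217728, 134217728, 134217728, 134217728, 134217728]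
def lfB19 : Lf := .mk 46320570099834106691018481957228069269058442230446917129844061950633151908165332127407656849948863448027529118181088270369520014215948688979385127471033495877868570447437304632973938216822253112234677580589740033197606632832862244645068720366845968763540679668071756042396047344237339615611822878285881368005301244049744022113687321671246411881228832007185864558243586382550012484010721065227544857612016767565954139248413381050926115239332946788612262912656642986433449901462455855713264179357158393687475021914540402166659998523213527938100877310431908476137779023283142551427333411121069862542148087547840724167578895595303059212448645166340607378 570 [108896523, 162362967, 135287484, 145796399, 129665431, 110814537, 143729107, 127812639, 116959947, 131760267, 108007771, 105809559, 143676524, 149519849, 147735701, 120833325, 122564706, 134799979, 139571094, 125859522, 136075078, 138757212, 137177536, 131423778, 134859893, 135188765, 131364675, 130912705, 134371443, 133373660, 133134584, 134615368, 134840554, 135487491, 133892678, 132985392, 133788961, 133545354, 133753526, 134440844, 134916966, 134402392, 133368260, 133343585, 134199974, 133630727, 134963029, 133703566, 133723756, 134432490, 134189517, 133630017, 133951756, 134263509, 134062459, 134019272, 134739316, 134217728, 134217728, 134217728, 134217728, 134217728, 134217728, 134217728, 134217728, 134217728]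
def lfB20 : Lf := .mk 43712527050912282654184854302598565110381303433376506864320510934422590458704805113108713424726315136103325492615559775900653448642944305557557181389385794426937382607644965598939503270767178615658860126498663681041406437350864757851374834734755221687680943304871304259725385847590027427582575418568248451646807037032213887735058351212266835494218842065231084260432139803137052887688688732241325954912365948537204942292383784860910217664095666964883581700348419889514768575358299221367763623143734856289820336931640999546428320208895913380732258387024568861835459750165308897736674163846151492122451491056951690830822592923444881868011257231311062549 600 [126110292, 175126500, 111050808, 138218248, 120472249, 77824183, 142112499, 131489252, 137863664, 190014744, 134217728, 134217728, 134217728, 134217728, 134217728, 134217728, 134217728, 134217728, 134217728, 134217728, 134217728, 134217728, 134217728, 134217728, 134217728, 134217728, 134217728, 134217728, 134217728, 134217728, 134217728, 134217728, 134217728, 134217728, 134217728, 134217728, 134217728, 134217728, 134217728, 134217728, 134217728, 134217728, 134217728, 134217728, 134217728, 134217728, 134217728, 134217728, 134217728, 134217728, 134217728, 134217728, 134217728, 134217728, 134217728, 134217728, 134217728, 134217728, 134217728, 134217728, 134217728, 134217728, 134217728, 134217728, 134217728, 134217728]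
def lfB21 : Lf := .mk 41834681834567676205369105724614333418258588885065131446072741789984049437402062896052524732999179300546806968249260054278346192010566110452700112445416261967786504929589452167255812906683018064400960148395542843012554730641046427498712365633821227344915626495322506721695544589629857852467051718509656593124004819602480660082587506778616219619497878967857614647700991992120541928388976900427596970620499795134598472510629500458221868254344187040437854804302896450958504663591560411963302468991833078889601911468831567601065977963192958245171215785437310861519244020524964365709191876263067298126641406163784903135319335397237912693779784844457501683 630 [158596115, 147498458, 121859077, 134926434, 141481405, 145297875, 137263629, 141628599, 124725468, 120612390, 129072532, 184652849, 134217728, 134217728, 134217728, 134217728, 134217728, 134217728, 134217728, 134217728, 134217728, 134217728, 134217728, 134217728, 134217728, 134217728, 134217728, 134217728, 134217728, 134217728, 134217728, 134217728, 134217728, 134217728, 134217728, 134217728, 134217728, 134217728, 134217728, 134217728, 134217728, 134217728, 134217728, 134217728, 134217728, 134217728, 134217728, 134217728, 134217728, 134217728, 134217728, 134217728, 134217728, 134217728, 134217728, 134217728, 134217728, 134217728, 134217728, 134217728, 134217728, 134217728, 134217728, 134217728, 134217728, 134217728]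
def lfB22 : Lf := .mk 39867630839524712961096873822071504491576653569068714794708602479945485323121562469808379536411278261366871496381679226111423558543219293082484269576851409375140476757485512373051090427445291570489615107310216926536648700536672194211410598555141009268725592840979498898030575101716593613560477464371684550466856050729077885350192333942625884202684094442248140576707329725597131943909254766877705608495862677385280823484091167941097626149715648016819021907839370804572872759197442285478084030144029993083684572671158963628826378147481603135882611413215918511597945482337053228164552586188055312234418426258462953761993169034379093731952122194105452557 660 [114415084, 118581580, 115647335, 149469912, 126169293, 132743227, 131543108, 124431914, 136909661, 148403620, 140133954, 141175770, 128542859, 125690894, 129756156, 132324561, 129333171, 128174394, 129591461, 134065349, 134170071, 133736113, 133346115, 131523749, 135663595, 133445630, 135159793, 133503574, 135760989, 136375466, 133422380, 134447502, 133051065, 134072323, 135142512, 133849331, 137276382, 134217728, 134217728, 134217728, 134217728, 134217728, 134217728, 134217728, 134217728, 134217728, 134217728, 134217728, 134217728, 134217728, 134217728, 134217728, 134217728, 134217728, 134217728, 134217728, 134217728, 134217728, 134217728, 134217728, 134217728, 134217728, 134217728, 134217728, 134217728, 134217728]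
def lfB23 : Lf := .mk 40824898310022100378102512949808758411238934546456489690340664880242832037464534587606013128384775939822289805295602224696482512961963841409455410368068741347151494945048675351529780218586891915915887225720963496648538987482320855663768924489959780862632921853330778983847464003573516160897008061520385223958370545009937499548595759194293767855126426625112575691088335152442384155054978897396188913660281080610922832850959775325760378060884794272901661489722444872031545453812725729510565465817065722825510603550284854780443230551247825990208730906417640095359643003535153821007515513407731034226408623175443079949220696182183523860520155140404170225 690 [158928900, 162660523, 126967758, 136059490, 163878907, 141359436, 135520892, 118677054, 144940167, 115128477, 126965410, 143378531, 136787349, 134018189, 158065494, 142021195, 159751123, 134217728, 134217728, 134217728, 134217728, 134217728, 134217728, 134217728, 134217728, 134217728, 134217728, 134217728, 134217728, 134217728, 134217728, 134217728, 134217728, 134217728, 134217728, 134217728, 134217728, 134217728, 134217728, 134217728, 134217728, 134217728, 134217728, 134217728, 134217728, 134217728, 134217728, 134217728, 134217728, 134217728, 134217728, 134217728, 134217728, 134217728, 134217728, 134217728, 134217728, 134217728, 134217728, 134217728, 134217728, 134217728, 134217728, 134217728, 134217728, 134217728]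
def lfB24 : Lf := .mk 37532581002700940211517976312444810131487149873999220089200759346977202115048041416685711141225995927258854342213036498085746735829161109453032384919110002850237492799581999656901907165057227120193069757207496759635457358904020473392075614309637000082667141909578538833075890827148547139048984135628541907660035643954453792756176256759127470736357165153441896738227724002191529075240750996564582614360154334690313078109763321429846652645639398094729652615823883901368178091545258860504882320387229594461069952182384086722883197745100910136529035530160982024603891437127846856063445432783049435974281009007876004402386312166093624799193061403282258193 720 [113758503, 138011046, 143529909, 142704245, 178329952, 151693521, 133792079, 105325103, 128920665, 139829748, 134059703, 123154988, 136715158, 144776024, 134684996, 126875062, 139000528, 125506525, 133842418, 131348450, 133392406, 130769635, 135310330, 134486161, 133857682, 135397400, 134502360, 133870816, 132645512, 133753714, 134637814, 134240865, 134978578, 133529564, 135308521, 134148596, 134019910, 133504933, 133390795, 133374807, 135084081, 134403333, 134893441, 134122328, 133537829, 133759081, 133557396, 134432176, 133834694, 134218653, 134306227, 134219203, 135236292, 134217728, 134217728, 134217728, 134217728, 134217728, 134217728, 134217728, 134217728, 134217728, 134217728, 134217728, 134217728, 134217728]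
def lfB25 : Lf := .mk 46320570099567024633874591592400301628247815513333237228987440951213413990928222555145544194936082785459190705374210500674668905007649349902583941047139116968378181216889276607571238016675683712572190661406253367588825623769911043664739375603345173942330010462755409886548825837516411615428400700616242597480706687800012462500867603314216705580318070325754139204765554041078155256145442382893749452153490518844938372617755923415748914136296209394353239430754869878956304407287151689813603455045401587610517824846323778332392891371608515447183231063543920653439252072061313831796833603059159353153499429434208516625772349617225065080526306265526013330 750 [171200333, 126118047, 137665516, 111922284, 129241873, 145714628, 146561743, 138322324, 116959946, 132148354, 107989198, 162742673, 123527869, 114089629, 130283009, 145974005, 149405750, 132300793, 132877213, 140245292, 133346875, 134243137, 135382547, 133431926, 131948566, 134327235, 134217719, 139932608, 134217728, 134217728, 134217728, 134217728, 134217728, 134217728, 134217728, 134217728, 134217728, 134217728, 134217728, 134217728, 134217728, 134217728, 134217728, 134217728, 134217728, 134217728, 134217728, 134217728, 134217728, 134217728, 134217728, 134217728, 134217728, 134217728, 134217728, 134217728, 134217728, 134217728, 134217728, 134217728, 134217728, 134217728, 134217728, 134217728, 134217728, 134217728]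
def lfB26 : Lf := .mk 44462102414537131494414576152001189664609903320776600525752621552276759997807480024756854288921219351889120827935554228190831792171328689151500284621676040114862214176481805066526930580282656247679084620838524845336922207335763597480623744506865888396981814711754154480135888433637832732966648766198422741568744797218643459044156711272423991743257447726295950592606625296027764391363006927025139152181964845771952459023830430976671125091876018575785291653974686083177974179340629451327908755757604762482758604032798472668170384055437020768138298700527805192690915339903011713931037045078331572922461522464241926850860258012680076385439098551804575906 780 [135688704, 136746287, 117437787, 134168628, 132442561, 138228210, 142319630, 122283234, 109812727, 123692248, 114672884, 124375992, 128409308, 120746291, 141697398, 128714675, 144345682, 130443774, 133598770, 131352381, 137092054, 135588364, 132775327, 132460904, 132152621, 135315310, 133081138, 135222959, 134287062, 133957436, 133782913, 134004220, 134963298, 134503693, 134470089, 133843088, 134936391, 134584133, 134909845, 136770730, 134217728, 134217728, 134217728, 134217728, 134217728, 134217728, 134217728, 134217728, 134217728, 134217728, 134217728, 134217728, 134217728, 134217728, 134217728, 134217728, 134217728, 134217728, 134217728, 134217728, 134217728, 134217728, 134217728, 134217728, 134217728, 134217728]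
def lfB27 : Lf := .mk 43712527048965971947502058600849736429973035514817101194110165095348211012524407917791422276477857443897702877581749501068297383974062183431515516695504107347588914039087910407450307818771567561216941647502889536351363217877029927045946372105081206577318672810802718938708597303275060220225225961122890988276259884040508875523993006252921965705702501154820639704102199067313613166607286115275451624214100256239701288538120249711824155651526589499771829387922956445670863600490394121821470428981338429133629594991945878604090702292325750257580297033450705113421698425870717396937314919569446201622565213296722534798586036746270667407526091374228358677 810 [173787008, 147390818, 129624924, 73620298, 122152808, 139714264, 140363490, 125000049, 137863662, 98605709, 138592353, 155770524, 145125104, 157282172, 129413068, 145514410, 117571572, 137815837, 150641810, 134217728, 134217728, 134217728, 134217728, 134217728, 134217728, 134217728, 134217728, 134217728, 134217728, 134217728, 134217728, 134217728, 134217728, 134217728, 134217728, 134217728, 134217728, 134217728, 134217728, 134217728, 134217728, 134217728, 134217728, 134217728, 134217728, 134217728, 134217728, 134217728, 134217728, 134217728, 134217728, 134217728, 134217728, 134217728, 134217728, 134217728, 134217728, 134217728, 134217728, 134217728, 134217728, 134217728, 134217728, 134217728, 134217728, 134217728]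
def lfB28 : Lf := .mk 33912165259606426047340648969305060274669448038234838929795995992463516737587816794174562313901260698826785617877441893917032895056085344729403648421278407230786993542766810639421106352334945804574842854240815892357727188921466125120454929052311483981483386214973367430947265780267645594227981675588766390432915358194534197895743546458788682178656022009821262422148478927587372345644045614951219192766564567915637750567001043614465787820294235158071678901010293855067694114753234865904760371186259482228532056836531174085366489660824448172732350729385843611591091363476860251066210250581982889984546314682603974249533319088823615096663141570216663987 840 [114509308, 100339610, 108110017, 125147814, 181847171, 130383484, 129148952, 126909886, 130257452, 137045633, 158916712, 135494901, 135554362, 136763599, 131894424, 134657126, 131944969, 136494191, 133454963, 138122826, 134165946, 135691483, 133431734, 132999897, 135323692, 132817858, 136897497, 133704653, 132416251, 134865051, 135045613, 134110567, 133813852, 134008688, 134383018, 135020082, 134709159, 134210686, 133918689, 134774395, 134229100, 133575908, 134029191, 134815315, 134559803, 134715234, 134378056, 134373150, 134585517, 134541271, 134719909, 134111220, 134182010, 133928212, 134422681, 134122905, 134103545, 134715317, 134217728, 134217728, 134217728, 134217728, 134217728, 134217728, 134217728, 134217728]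
def lfB29 : Lf := .mk 38298149437750441563549866454526190402500749032458026355598645496541639049513408162778860670219347784104693864838055132385340635456951540949666991509742964096767545284401731897913308519001544984864647424156656883054468682835620421578551442110914734503462374032191067419688056891371630812883066263204586823118404262203607975362384602471650715611407313616642622614815828183668601552128283841780645231702219474223308324865139435781108726024332978531945827965032475365629517559442184025713881328280272266882322616313562368400177886904349521747530715791207729829989692317152392357465909397603329450112453465964376613467237578171877227809339291379001762984 870 [119434508, 126701224, 109807972, 150928889, 148099177, 114861803, 111170730, 108358964, 169451041, 139785601, 140602267, 131798673, 100249007, 131585590, 150229159, 119500960, 148092160, 129419247, 130844873, 140591014, 130899816, 132615705, 132768351, 129493644, 133504768, 132887767, 135286167, 135369153, 130493394, 132716588, 133605020, 132827870, 134486816, 133884950, 137706420, 134217728, 134217728, 134217728, 134217728, 134217728, 134217728, 134217728, 134217728, 134217728, 134217728, 134217728, 134217728, 134217728, 134217728, 134217728, 134217728, 134217728, 134217728, 134217728, 134217728, 134217728, 134217728, 134217728, 134217728, 134217728, 134217728, 134217728, 134217728, 134217728, 134217728, 134217728]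
def lfB30 : Lf := .mk 38298149437175998900391657962084398313233258516187290060950981348990974742940012843260876433802975944663512583027411716762067187283523130038545172361016660621904289791973521969545405955664626827236837252100509660319745883581091527391242505063798050317643977513760877817027948061088195575168729117224150501225826932639313120775973009550991309095741940816710862027832516402347007849714554478874855417878110502316941136241013138088108225421181914467559670199149615853606552182651440138670183261336508981122150380433884669723979982919537670995271072168450809203764088846697685395576134766986096585224386065678034079569623481021245575082839080863592129704 900 [134990877, 117651387, 101793581, 110744019, 145676257, 159863773, 120050106, 141303351, 169451040, 112702120, 141898419, 124905887, 159484431, 113991001, 149075733, 139340504, 136408138, 136218175, 130884741, 127319502, 135850564, 138645489, 131284107, 132785409, 137671818, 130721556, 136004020, 133042570, 132323201, 134795056, 134159737, 136484059, 133515883, 134490537, 132617727, 135173105, 133920190, 133840295, 133691071, 135352235, 133944040, 133148966, 133861866, 136183647, 134217728, 134217728, 134217728, 134217728, 134217728, 134217728, 134217728, 134217728, 134217728, 134217728, 134217728, 134217728, 134217728, 134217728, 134217728, 134217728, 134217728, 134217728, 134217728, 134217728, 134217728, 134217728]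
def lfB31 : Lf := .mk 42380142389854952240548099810691199654903569157243325200627152550291658789253974017563419972487301280696349323757160228230956200810588313043692120077997026249133057987210921009808154802998815861472731561682433384063331460876033902434952699989147640060952826645531628480982011496176052675252352017642123735488161559680015639628797810123828732001132758806500413563514029929630023543519363655022818420201706021343039476389030879635882621530013694298717784894257052407313157915549535482128162350904265945443914837116421615203066758132129733318105945761940839369770592387463382481525122211078539931786152246262365650036873843179466813394678261508725032034 930 [133518537, 133015842, 139038817, 145565854, 123512321, 144871998, 136198734, 133357778, 167539434, 122011781, 131438869, 122833481, 127364733, 118548882, 145498844, 127656201, 145879966, 131218794, 128809441, 131136304, 134788157, 133576021, 131555994, 130834626, 133584150, 131138705, 136101751, 134260037, 131042069, 132777261, 132632211, 134241568, 135138796, 134497518, 135443071, 134847050, 134684615, 134003826, 133398374, 134792019, 134029460, 133709737, 134951728, 134987435, 133707603, 134190109, 133316858, 134179756, 134008560, 133651270, 133905877, 134196698, 134299605, 133934725, 134557484, 134244126, 134422076, 134115277, 134186627, 134225503, 134122234, 134223451, 134159553, 134221054, 134218747, 134185042]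
def lfB32 : Lf := .mk 45149219793585612122809691296537505380880307946412451802541576678252129027046229867032554880951178848198045379183968265416246514807002311428524410847067429432802130397655684595981625707483840818743499731566754623051042129680447049493462612465612988026162081073201280057721714136347234197764754545550603736032060262721733378082686173236690103919077080450902655405887801792408369048424748891529603608756711527919827096000387011113607362426145260729826340488455243555108911524680941745724424124182346004166032072787177736877139280218141015355771697292527508277994796029948134162147171707494166559465893600751975519024645450992861988112170760863047618474 960 [138892295, 142253153, 131724947, 126406095, 89632062, 127568926, 120123122, 133684873, 108579947, 139704906, 144919071, 136573585, 137128878, 140886951, 122064633, 136274183, 129080560, 136474539, 136845337, 139378513, 136214844, 137530538, 134790880, 134500903, 134209587, 136294672, 134547025, 134916735, 136218802, 135536428, 135716066, 134313309, 133724068, 134808054, 133601177, 133813274, 133970951, 133573631, 132834288, 133670241, 134558777, 134870829, 133334162, 133679885, 134516839, 134086137, 135820666, 134217728, 134217728, 134217728, 134217728, 134217728, 134217728, 134217728, 134217728, 134217728, 134217728, 134217728, 134217728, 134217728, 134217728, 134217728, 134217728, 134217728, 134217728, 134217728]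
def lfB33 : Lf := .mk 41027827767764169806614855151277830978475797631684360085295856027055823332773164836933378817125352839276297576762868964813149388735686258088712286822035932312315099208031016509909809529397296476526093570943212108492599292823508180073212712232560450346851871494989096451972558698016095460478748584003132780742306882287420333693129880937816369765472292815334331592507868735768276116463491488474656017435548277126191292735021972917197491456457925494031730292442171097861692341121193991311034990049336665320494645626747948337599843391315699437724098749931197042926741822713079241515124768920579548968362095731977903183013218430493569414090211757477887699 990 [133758773, 145038005, 105912918, 144988913, 113146447, 115909074, 141457825, 131914344, 129855013, 159854621, 150442487, 137022061, 142289512, 128683020, 135219250, 128189843, 134172998, 135288561, 134156937, 134765589, 134168805, 131925494, 132998009, 137811047, 133053537, 132580139, 135246481, 135191306, 134701500, 133333384, 138557801, 134217728, 134217728, 134217728, 134217728, 134217728, 134217728, 134217728, 134217728, 134217728, 134217728, 134217728, 134217728, 134217728, 134217728, 134217728, 134217728, 134217728, 134217728, 134217728, 134217728, 134217728, 134217728, 134217728, 134217728, 134217728, 134217728, 134217728, 134217728, 134217728, 134217728, 134217728, 134217728, 134217728, 134217728, 134217728]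
def lfB34 : Lf := .mk 41027827766911461282143961654326462428019673943829126717623812768828743289995869580633729996862813773415121544437920739371999797640734517784210587567248462163327786576220162842591043356800452225886135262852282124103444769651369273880439309402124587441543702895381846970785243893205241020937971796076255297275408440522576018995050478344142053039617956809828122817947605215439671867176834934484327312245955729009144398126182505248536536852602030561123669183541467092799022472939617471973919863514393154416451772451726740611546033653729082845413364491160420583952001288936120310061556777878923473791398645418840286460326452224628279093323532278639394515 1020 [143850613, 139167130, 125141087, 109031349, 115657400, 147406001, 135956593, 111503594, 129855012, 118258380, 152433187, 141104596, 130727252, 149131488, 135644298, 144787043, 126585142, 134761950, 139486782, 134810207, 134743268, 134533771, 132698207, 132526576, 133942151, 136997500, 134930489, 132576740, 133387472, 138940048, 134217728, 134217728, 134217728, 134217728, 134217728, 134217728, 134217728, 134217728, 134217728, 134217728, 134217728, 134217728, 134217728, 134217728, 134217728, 134217728, 134217728, 134217728, 134217728, 134217728, 134217728, 134217728, 134217728, 134217728, 134217728, 134217728, 134217728, 134217728, 134217728, 134217728, 134217728, 134217728, 134217728, 134217728, 134217728, 134217728]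
def lfB35 : Lf := .mk 43075392657472112099720166269684438001166302957397924333002981122880802118831301986594981472206081126509083318699242836056145061491820619274648917221999167357265535176892745819911865720602934711420194551154790112648433386638807854304485936049027911793543703955088209842728411544115651660027015961146828822962452531635450577217988469415394315835406200660283891484250812874186998930373484038624298448364962060646817618402574214232198759341745725893087126816602364603354452797792740695310506925734123005579475796505921415190169425160928764296677940675842847836262490181800556939165744252681715613945046249042997224465140431940402885516409024490359831351 1050 [145000970, 152753762, 139108592, 160913284, 69182267, 161508201, 139488213, 124487858, 124425701, 130695242, 165306394, 130254732, 131712173, 127856290, 141453519, 131030688, 138761814, 134439781, 130996151, 133836073, 134168436, 133315586, 132571206, 131421139, 133700420, 133060021, 138387075, 134365714, 131773497, 135758512, 135825531, 133846000, 134277425, 134198092, 133727486, 133496379, 134865261, 134300809, 134576358, 134653215, 133823913, 133246407, 133924491, 134123534, 134427560, 133855889, 133924745, 134511001, 134557763, 133627113, 134453186, 134008444, 134155219, 134229077, 134345319, 134093313, 134232539, 134308391, 134187365, 134149379, 134133617, 134464904, 134217728, 134217728, 134217728, 134217728]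
def lfB36 : Lf := .mk 42193363685691702764000427216661295009602448971788041002413950466190352669704407600023920392207383917349738109960278504402651196947668303361959368007895049069435271184956777517234321642526718814234334174532899261587014098366995952259119864279495443973245045835571435575992795429646383298449836860674333076220924561648095533948980955453056520667130695932758946735545001353740579445509092695216590619833257388884805144059379519511995604331717671637975242584730434763259291392501809531166597506231563958021307680840993407413277374435156647760620846478640995046172528653896002041632106207902612391286745658754327774767400325140436185080763228882866397046 1080 [153878696, 168014277, 107338263, 109403334, 122572228, 115441038, 117640888, 126671016, 198680469, 134217728, 134217728, 134217728, 134217728, 134217728, 134217728, 134217728, 134217728, 134217728, 134217728, 134217728, 134217728, 134217728, 134217728, 134217728, 134217728, 134217728, 134217728, 134217728, 134217728, 134217728, 134217728, 134217728, 134217728, 134217728, 134217728, 134217728, 134217728, 134217728, 134217728, 134217728, 134217728, 134217728, 134217728, 134217728, 134217728, 134217728, 134217728, 134217728, 134217728, 134217728, 134217728, 134217728, 134217728, 134217728, 134217728, 134217728, 134217728, 134217728, 134217728, 134217728, 134217728, 134217728, 134217728, 134217728, 134217728, 134217728]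
def lfB37 : Lf := .mk 42546323986513415391598030345735294587660984944179037437471315977167921078512874836031184500896792140892062381819017657749640885111714905174544897910176988949025632378324140986038302596771930307587332213239912283862792098264871325671168190553184756245305340171216387516091563335221718915415020535897034574276380241724282678362553762656233144214835604931830182176717788565270458720640077014226315021854010427131011293446862890428596034831630473095552491460442593673764184440966182362796446270705578778682649524136150422247669483680930844260132983407689633356315167128617611602835264197804616846709105049720367765040637167098102774929812925517868664101 1110 [166718573, 126545571, 141293507, 118184787, 124235208, 125748946, 129494185, 111118681, 146470714, 131690777, 141608107, 113483492, 135331624, 150005006, 136543437, 112619308, 138017231, 125361231, 134358648, 134099281, 134388503, 132989467, 132741516, 133141018, 133709108, 135738784, 134555480, 133835846, 133692390, 133141117, 133064848, 133986144, 138075435, 134217728, 134217728, 134217728, 134217728, 134217728, 134217728, 134217728, 134217728, 134217728, 134217728, 134217728, 134217728, 134217728, 134217728, 134217728, 134217728, 134217728, 134217728, 134217728, 134217728, 134217728, 134217728, 134217728, 134217728, 134217728, 134217728, 134217728, 134217728, 134217728, 134217728, 134217728, 134217728, 134217728]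
def lfB38 : Lf := .mk 43430277332022289892408916563203042766518938474668096701840109722743943271517124176486010625418794106344946118137911091030160473100183524164673165060061063273807380054478369123812805684346523032039614566129921199875866470578244570139735946674393229838572362965261500081088575731463562430913012030206331056600929953649674577877023204275698694318707292751968999929531626632663220098583565484763800433127994603577840486461750101863580948220577590548733459932044736064252314614810938634005881995780464251545556297083071149439222085095384371420583903823849351537914789139754613746730154126130417438696754616914777977261344846015836056725569608569867563699 1140 [252857614, 134217728, 134217728, 134217728, 134217728, 134217728, 134217728, 134217728, 134217728, 134217728, 134217728, 134217728, 134217728, 134217728, 134217728, 134217728, 134217728, 134217728, 134217728, 134217728, 134217728, 134217728, 134217728, 134217728, 134217728, 134217728, 134217728, 134217728, 134217728, 134217728, 134217728, 134217728, 134217728, 134217728, 134217728, 134217728, 134217728, 134217728, 134217728, 134217728, 134217728, 134217728, 134217728, 134217728, 134217728, 134217728, 134217728, 134217728, 134217728, 134217728, 134217728, 134217728, 134217728, 134217728, 134217728, 134217728, 134217728, 134217728, 134217728, 134217728, 134217728, 134217728, 134217728, 134217728, 134217728, 134217728]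
def lfB39 : Lf := .mk 42546323989030731621343120141410447291668918504729106067792599333481508708341269982982067689575718505427080417617315433122880830401347471924583252044067724098430708703422095692332594712972997354764584628416937053653165193873957577789628892438701912788917026771164219334820695886436678385511912065225926133943377496785814550932847110116531956932701244041295703513508585874641846123917481496825759126158703671431492143486471290459691196090170181989549375539364190381033953027618541531664967017919401623512105333122015033765640013396579317003204350231546262047207274866964669096512658248078921725351278538182406573873704277263867647154284122303779144997 1170 [111483463, 158678311, 116938811, 128364218, 120172570, 123115411, 140683992, 152635262, 146470715, 128908298, 141741270, 142500128, 127868106, 108230293, 125298432, 151128929, 138498596, 139978780, 130794858, 133330462, 134409534, 135160883, 130599648, 135499546, 133648140, 133228795, 135189178, 134548041, 135473662, 135133226, 134937113, 133487017, 132154217, 134114796, 133394175, 133468399, 135004872, 135114941, 134478033, 134113711, 134702990, 133930717, 135059814, 133820449, 134297165, 135368354, 134055865, 133778049, 134736999, 133833519, 134727623, 135258887, 134217728, 134217728, 134217728, 134217728, 134217728, 134217728, 134217728, 134217728, 134217728, 134217728, 134217728, 134217728, 134217728, 134217728]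
def lfB40 : Lf := .mk 44250928177115792794964113628358971731500418477159740585294760487765669238362870583859213193996558150789234090889266154745867787089789811462575178801549946677177094500791962079215540266467852510216930893503521946584283061937913985475078552781828362217957209447301336807195478817751265003218143379533301974936334654188240817131759589789510226271820595895444646699617494899495789393869135406159389243881685391339072995025804820429024852387789405147002818218919957126582228451154875914274166401866353961407079021291614141540990138584286383322710734851639297233931028272354540572977238810782008618623156708136452145775342464395270150473739114187736333560 1200 [109048236, 90952210, 154733735, 97336355, 122439581, 91691725, 129393498, 152746004, 139053614, 136782710, 139528086, 134042520, 135280158, 137994146, 122864976, 135899201, 131473876, 133295574, 134243356, 133113456, 132150967, 133727480, 134341991, 135737158, 131603447, 133903769, 131838270, 133870610, 133546972, 133936917, 134056273, 134471950, 134350332, 133688928, 134551328, 135633314, 134051239, 134242989, 134116723, 133895399, 134062194, 134142080, 134556004, 133967808, 134677423, 134258146, 133890735, 133495937, 134515357, 134451759, 134366547, 135038806, 134435074, 134405029, 134159460, 134134589, 134355946, 134351203, 134207882, 134205700, 134315217, 134077208, 134070641, 134253138, 134183665, 134303467]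
def lfB41 : Lf := .mk 43430277330409800065199010352030050704734930873461737464177531092461525812927249132582355592043462373873859636414568487246592832577085308339634275523153179545007367078068397542902320046641726960707581135158252517971881357905141370131507031347630936420933716557002127260047087273577672082237768632649924150640631950254012676983578478855691395383931689765227652506984719835364030924774825671305065450758028407330649494619452037564923343525898095718838246984640476771756201258911807347693277748986025881127221827099427152080636476726136914231453785720465879483754886504713904148322709957734384395643262383889023089662195501166302017874982278260692185779 1230 [75575055, 237350940, 134217728, 134217728, 134217728, 134217728, 134217728, 134217728, 134217728, 134217728, 134217728, 134217728, 134217728, 134217728, 134217728, 134217728, 134217728, 134217728, 134217728, 134217728, 134217728, 134217728, 134217728, 134217728, 134217728, 134217728, 134217728, 134217728, 134217728, 134217728, 134217728, 134217728, 134217728, 134217728, 134217728, 134217728, 134217728, 134217728, 134217728, 134217728, 134217728, 134217728, 134217728, 134217728, 134217728, 134217728, 134217728, 134217728, 134217728, 134217728, 134217728, 134217728, 134217728, 134217728, 134217728, 134217728, 134217728, 134217728, 134217728, 134217728, 134217728, 134217728, 134217728, 134217728, 134217728, 134217728]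
def lfB42 : Lf := .mk 37759018352328588734134547910541024590589977754048614022914341187365971730974704381402675607916035167846579235721260702280441834235104377451241128679855239071786484794353075515851114512877925365527764416349555141391830677708659091741673735566662815356333472492929915971137948482919627164055227552771308804969047515312177387535706571144107743467219210419104479337848532533923925571724331938799897685310315654268891620925417630107047518374035261585500811665804707418467623849688469865126845195128935027903710907022069049957936914899543909898904508566593432703261887600192165627580496057267970125692048116998579248696334222292617632443479783291724300889 1260 [131642920, 129791719, 114091180, 168074181, 168557139, 173166363, 123439488, 122845698, 115677017, 128136995, 126835859, 130151185, 131203844, 126533413, 143671901, 130998938, 139865975, 132334380, 131587215, 130874728, 129459918, 134165584, 133188827, 132537229, 133522983, 134597992, 134984173, 135008423, 134024350, 134564472, 134490619, 133771479, 134469705, 134130937, 132698231, 132396310, 134494854, 135236409, 134463240, 133888053, 134322255, 133880982, 133562997, 133294403, 134193606, 134245408, 133654455, 134470635, 134864920, 134257968, 134162081, 134042440, 133911521, 134073517, 133822968, 134176313, 134410520, 134026228, 134251274, 134299071, 134189083, 134216262, 134407875, 134217728, 134217728, 134217728]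
def lfB43 : Lf := .mk 41289409278983857075816449079362434856766229511956769476736457639153414202652094147434496247921735967286146655692069913245765976853371374312012654948301950415528491117508965035079416635452333320642635120018288760912409994682576879375980860139888378485692386315651123529373002158343433562601009410491286867552279091458628548875971060461614331816517383646138829289318748587983755598100448166783078950420026665166803379594002625464759047841282173614359828069882590618564452057362420292255512687395274577939703413628068119530938550465161558580563992245302080197385049300191628524000190767631818984258481585157241911861638178606913872620621412844109975717 1290 [161163049, 114814893, 97283001, 138846273, 124958899, 125343856, 134644996, 144366806, 121172910, 139755427, 137401038, 149712269, 89605913, 144158086, 130755711, 138115411, 125507479, 137449009, 136531677, 139367979, 131653172, 137263349, 133679518, 132456130, 132930986, 133772930, 136124313, 134647874, 133708806, 134374055, 134567256, 134356066, 132976733, 133245537, 133426869, 132692087, 133423541, 134981691, 133936450, 134305619, 133319169, 134654739, 133194580, 133973275, 135205845, 133690078, 134055212, 134228967, 135726902, 134217728, 134217728, 134217728, 134217728, 134217728, 134217728, 134217728, 134217728, 134217728, 134217728, 134217728, 134217728, 134217728, 134217728, 134217728, 134217728, 134217728]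
def lfB44 : Lf := .mk 41289409275575000032093736422410370131738471426178341749352796294728823711802557475198635151960884374695855901453539242754162457460322702467579249760072734250345228067370196138259964395190495391689512688289933469951822174326968970156293110689202742599318091108698422716783020790319435437174087609885874298966297563186265001267812673299051670971886021720103261203140861404545901439431290530114013555409039955551370908893625933683606163599263562191707639610607762020420637818946504460429636445247078085284353690524451192671356218762537827172280628837524409756459026180613435843067918600292574254662071943716800700078195514354536904377132866866312269989 1320 [104032076, 148050541, 125204967, 115853863, 129334156, 140292105, 123167816, 101784009, 121172910, 136881433, 137538582, 127060199, 184054115, 134217728, 134217728, 134217728, 134217728, 134217728, 134217728, 134217728, 134217728, 134217728, 134217728, 134217728, 134217728, 134217728, 134217728, 134217728, 134217728, 134217728, 134217728, 134217728, 134217728, 134217728, 134217728, 134217728, 134217728, 134217728, 134217728, 134217728, 134217728, 134217728, 134217728, 134217728, 134217728, 134217728, 134217728, 134217728, 134217728, 134217728, 134217728, 134217728, 134217728, 134217728, 134217728, 134217728, 134217728, 134217728, 134217728, 134217728, 134217728, 134217728, 134217728, 134217728, 134217728, 134217728]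
def lfB45 : Lf := .mk 46994536895005315665325906300663717406866105951738902529455822086119961524539706149122588347255340942454379848483031675424001118033867109534330251222673470612876358819583406017758401148332394520860697155601549580327835170252803939566479337027304831122246763954235496789406692145200605183199717555522289261300003098191035877443447726663282239381004689989325152934543503060578512240427981628181773136389221332339328697279078418916322912220688533310667005546877589568949509668644359466578352160638218648491865686835981519062744359455124599449468135612346219194647002780219525707532260267635480330510289214085295137933669280696747592495754571432389604647 1350 [139408486, 143140468, 123160063, 108903929, 98068987, 111545476, 144707201, 126134967, 160967547, 132839333, 118675916, 144394345, 134751813, 130357206, 174621715, 134217728, 134217728, 134217728, 134217728, 134217728, 134217728, 134217728, 134217728, 134217728, 134217728, 134217728, 134217728, 134217728, 134217728, 134217728, 134217728, 134217728, 134217728, 134217728, 134217728, 134217728, 134217728, 134217728, 134217728, 134217728, 134217728, 134217728, 134217728, 134217728, 134217728, 134217728, 134217728, 134217728, 134217728, 134217728, 134217728, 134217728, 134217728, 134217728, 134217728, 134217728, 134217728, 134217728, 134217728, 134217728, 134217728, 134217728, 134217728, 134217728, 134217728, 134217728]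
def lfB46 : Lf := .mk 41180501068785582768903033141556051552739322294008828787967507950253124293602904855802785505194707719692722578863461136863325501681908993742091197878047290313155937567459348559002950882867573811310890535117227799733207079076716082745126234412694367523342680537672497373661809297548875242006947593970096209607882856018441934935913460203501233123499134429445464259688143757585091416317300881715860328542886504919704218755538876812212779185981478753967084954495676496682850260829767436102291181305249806443714091637993299447440978203844781424224626643050072971518619077833193330741798311421362857446884760202128215950985533497790227264758701716717666491 1380 [134815583, 135245421, 116912991, 133144213, 133896723, 137279654, 115964070, 129412193, 154873017, 138123260, 128708345, 145360083, 137239118, 138172814, 156292294, 137116799, 129163539, 135281798, 134347157, 133955883, 132494429, 132176118, 134021351, 135323863, 132953349, 133347156, 135119456, 133706937, 133361970, 134506970, 134379224, 133767813, 134339842, 134137821, 134264478, 134049686, 134537379, 134097290, 133743150, 134225794, 133548893, 134198346, 134978157, 134171827, 134410376, 133558508, 133557665, 134086136, 133972420, 134269566, 134376317, 134304158, 134461341, 135145807, 134217728, 134217728, 134217728, 134217728, 134217728, 134217728, 134217728, 134217728, 134217728, 134217728, 134217728, 134217728]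
def lfB47 : Lf := .mk 42719939609947941339349827902970239450762434509356908149611518914778809580562785677335656054830101818637690524662122737277278542250639124532732690730479330727921620654472514295626619179979646293227415148061834815926608659780156089248469104204087130451743006868287302744998977996458983741445861248286587458628938853880478920373022819046417092481356442112311379213989549856536893575790529253310579521377398524720582553101409571070833239261875895282915564877698860018885846964303567724728353037978663407827568191520589491738907622258704330332078018129866731335365148799356098108016494274389910400492329947161926178084477006428256245413030984217639464773 1410 [110116651, 136764515, 136322969, 129912597, 108322191, 97013139, 136741648, 141199737, 133006206, 146969001, 154278025, 126042869, 170718645, 131776624, 127361294, 142879162, 130222521, 142107587, 135442339, 133429072, 135262439, 132239920, 132208968, 143455875, 134217728, 134217728, 134217728, 134217728, 134217728, 134217728, 134217728, 134217728, 134217728, 134217728, 134217728, 134217728, 134217728, 134217728, 134217728, 134217728, 134217728, 134217728, 134217728, 134217728, 134217728, 134217728, 134217728, 134217728, 134217728, 134217728, 134217728, 134217728, 134217728, 134217728, 134217728, 134217728, 134217728, 134217728, 134217728, 134217728, 134217728, 134217728, 134217728, 134217728, 134217728, 134217728]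
def lfB48 : Lf := .mk 42719939608250991246077071233154449958260828767884846528848018325870249018751644506683559072846476282402350691581993170114939609162804376696619062839665125945319691190523626293371970524610597648030061148167173048060459757752049517605402086122877487900180413643979691396160044856456349614877763440721470839167987072268369669458794125845110194225448200929178925395944300033480844693707260509062024512596888981313110867037366729320604183458604969851879382490202621056202822321064039089128709172616045337126621169803518503915532629734697352126902580136211213950701945593261241732249812838463720791908762661746074425513148082058885605903598021150347571013 1440 [148344595, 114525606, 146213933, 97990918, 109278917, 127360015, 135514504, 136646766, 133006206, 135025799, 154849599, 150929792, 104054691, 152983710, 123812901, 132876852, 125493404, 128297289, 135874807, 140395239, 134441450, 132786914, 130845452, 133023251, 135130820, 134990004, 134177332, 132025576, 136105308, 135518263, 134988097, 132724601, 134300872, 134167254, 133701658, 133723135, 135088888, 133313176, 135052976, 134269975, 133677592, 134444180, 136405537, 134217728, 134217728, 134217728, 134217728, 134217728, 134217728, 134217728, 134217728, 134217728, 134217728, 134217728, 134217728, 134217728, 134217728, 134217728, 134217728, 134217728, 134217728, 134217728, 134217728, 134217728, 134217728, 134217728]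
def lfB49 : Lf := .mk 43677506348485210783674756270698036969927934586059779141266475824933267015398710117328465605578688420348437833013278524994123011421587031190243699137581164555904092988026727184551797341685100833925455817986247032360419879581716508132644371928509320663352643591192863195194731303655303009561858359620759438384094269225069690228213891063544933317579389149823310334606182512426440121778980258709261047819521944059480345235522504175602835318534651151259101078757534098770499484864179327024026256324667613018891071726289341445097842575458343095804333999979732838004102437489236167777768652831792460854637405552602834879850531302814666236625900317164736962 1470 [147981266, 157876792, 150432373, 138717633, 142665250, 134791014, 128812208, 144946262, 121445068, 137507305, 125644905, 134535317, 135616730, 140146588, 117774324, 136569726, 131858294, 133788661, 136412265, 130429564, 131860939, 131776634, 136774296, 136933830, 135359463, 135881599, 131558432, 133747090, 135876538, 134570910, 134576286, 134556456, 133765530, 133747897, 134279405, 134445542, 133617343, 134023625, 136909389, 134217728, 134217728, 134217728, 134217728, 134217728, 134217728, 134217728, 134217728, 134217728, 134217728, 134217728, 134217728, 134217728, 134217728, 134217728, 134217728, 134217728, 134217728, 134217728, 134217728, 134217728, 134217728, 134217728, 134217728, 134217728, 134217728, 134217728]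
def lfB50 : Lf := .mk 44349282631552510880407650111215360884190851811285506603818880800365547956051465653940085700026156867771195422445887660178009071671984401332642996419474954127649995235741999635246421073300562963029892815734746751436454379075673482382060525410741143381559348881415903533283066714526525347774430812041381870857676327491598213253882997619940820921314006587472005134166723046023289692692211879235054269554436813905867935389401563066581883947319255908338303681903420605950481321682667264020734871926387345417109151971144113407182297311496899867186872297363065517077908168196125564690041533921267750172499720775670379544151170324348909681602290366920082483 1500 [134807296, 135231175, 102381475, 121162165, 121449203, 128701945, 145568630, 114084125, 134259216, 130339015, 112043499, 133769487, 132930343, 129609632, 145903296, 132599614, 136878992, 133784454, 133774705, 135247187, 135533112, 135270732, 132948760, 132240589, 134616980, 132732998, 134356812, 134293340, 132771243, 133528993, 133706010, 134439599, 134475170, 133348469, 133796533, 133395064, 133860466, 137110737, 134217728, 134217728, 134217728, 134217728, 134217728, 134217728, 134217728, 134217728, 134217728, 134217728, 134217728, 134217728, 134217728, 134217728, 134217728, 134217728, 134217728, 134217728, 134217728, 134217728, 134217728, 134217728, 134217728, 134217728, 134217728, 134217728, 134217728, 134217728]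
def lfB51 : Lf := .mk 40596796939687721157119630205600082592515849461935601855122540060893538350013490424513506447632172483503023287389960112923989465049283758546201068307331571067836119341506996047807839834145272128192570565051535596717561873787363049682008469184452419953380892298484724196746209262540673456250838498626884687058079768754727642620564141291113721849844337440799769219969005035345139319877359168384177799949627618383072499915894039621349747363654638011815822772158491142823927222552435659443756428753563099971057435644762329556208483434746240400521949602216426155441531580902508812149335631773915936279184425318752593543725769148291595724996693525620773602 1530 [139209809, 125817079, 133227102, 131242240, 134966514, 146309790, 129042827, 124818129, 148829519, 139745074, 135923838, 141020093, 123061994, 144102680, 136424345, 122093848, 139751981, 121528165, 128555161, 140608411, 135654146, 136212873, 135908166, 131304203, 135109159, 133343221, 140840552, 134217728, 134217728, 134217728, 134217728, 134217728, 134217728, 134217728, 134217728, 134217728, 134217728, 134217728, 134217728, 134217728, 134217728, 134217728, 134217728, 134217728, 134217728, 134217728, 134217728, 134217728, 134217728, 134217728, 134217728, 134217728, 134217728, 134217728, 134217728, 134217728, 134217728, 134217728, 134217728, 134217728, 134217728, 134217728, 134217728, 134217728, 134217728, 134217728]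
def lfB52 : Lf := .mk 40732435751980823164536706225720272349477224538778276264316211518591793553089261536671274653656117179212733166084914160567513593707561670226090475532534969621817716651868344519352311043695470010514782696533503302031437660387579215064934357576549718291235171889214122868606236417237778716466592164148618257672723054780043572418094191063371987479687028222123147515895123274405873205812425059288991424434297952989766437665552760949510643169236970344755238256980764410813410569440193237100261196943644782415986190991271397706708865741865161257850799661802872482645946231185915151373118096440541104521220311789795778593874214528929244942731409115684382117 1560 [159582979, 149102714, 163373281, 156843025, 132631566, 111770359, 154665948, 132624410, 153156942, 145023232, 153832523, 161629182, 145227266, 112074187, 117719293, 143988697, 117699559, 140013469, 135146013, 136378771, 132224997, 126396135, 135217258, 138168856, 137850244, 132174437, 136568848, 132551948, 134244254, 134261669, 134380388, 134105746, 131962254, 133843701, 133139184, 134133835, 133750002, 134447761, 133886743, 133941735, 134662524, 134517614, 133302945, 134574257, 134628760, 134908449, 134644286, 134038572, 133553588, 134332086, 133898026, 134028516, 134671313, 133997700, 133655602, 134217424, 134372664, 134262529, 134201181, 134266658, 134236750, 134237900, 134191758, 134350718, 134217728, 134217728]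
def lfB53 : Lf := .mk 42733471812122635669023493415274081869704053850040085902184069952433673617627632432117419001618414938300882883268551114642814207476812088224637769722784543038833638932102429548594963839774467389804361678066331865388203317816603057688398765890044415466729947215125815873145337252044716553841943515074537421504086257195533911920603696355985903554313212826741892978162848450262004052317684466474558452384519682698640853286192965354877082786941830744213892306110018936388834598036298431382452074224322445913363629157159758261703572002813085771295879202889036531592067571727699545635369780874394965665907034188460657165430267349096712449927102206155705814 1590 [144101362, 95746220, 146696201, 113556800, 124295869, 147681551, 125028921, 128982773, 141311224, 116007636, 131483314, 134609805, 121615629, 145868975, 137542950, 139247257, 133918690, 136316544, 135565272, 137165346, 131076508, 132134406, 135269920, 134087726, 131206830, 136728185, 133057687, 134066959, 132829602, 134770190, 132444518, 133859035, 134567894, 134480473, 135128621, 134051753, 134411455, 134131961, 134173328, 133307756, 134260424, 134598471, 134739435, 133837789, 134173452, 133990711, 134565162, 134599179, 133783762, 134267563, 133964883, 134170791, 134097643, 134054219, 134157705, 134398483, 134126339, 134159222, 134687133, 134217728, 134217728, 134217728, 134217728, 134217728, 134217728, 134217728]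
def lfB54 : Lf := .mk 38011107065600722390391177740521066617835755278558453174840683437097984517081275814445023862289004641887756037912520783452947507449857661495450469994615209786107991748651011630850565963246543885345708649904630131664050171643176922746007264628333607117725732252897441062802558885128386171826000760621543446286580596237093236237651122652059769377483841183242518983734913263120673941266882202255244536819008794990676478993202033746070161410498726461985630911119343702389244876337246944262412510821616793303631010777014910328335810587664723645825540098135788060493862653967428939985432829279140361917557170396747769609342353566068599385384445627756185112 1620 [166411267, 114448545, 127848102, 152087026, 151948359, 162535603, 143033036, 132932714, 138928475, 120304295, 141146952, 159682572, 131238388, 115835332, 128662497, 148097835, 129964916, 143895623, 135213721, 133762937, 128356833, 126526841, 132655702, 135788835, 133798450, 133658898, 133233372, 133432993, 133987679, 136238092, 132374412, 135593352, 133650503, 134682685, 134508941, 133526800, 135228065, 135357240, 134569795, 132895068, 134459292, 134683489, 133562290, 134458723, 136167370, 134217728, 134217728, 134217728, 134217728, 134217728, 134217728, 134217728, 134217728, 134217728, 134217728, 134217728, 134217728, 134217728, 134217728, 134217728, 134217728, 134217728, 134217728, 134217728, 134217728, 134217728]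
def lfB55 : Lf := .mk 45497143644683667152480996751612369031448751794258342642755311164337713551958401113555945395406454407103712239611458748191660061145316216514706440299357605678622337948270706286509444037583649661736144512855787999663609943895492525352106840722515143202182918164249954281668444706489856869111674663302946022235227671261558999247113712301273364033962186742612543321418281196865675287037775047280012900222530824185888688905403428861031508274853651809690390970483295096629865542124787683996997897332712180752362496651129113053679907827319062918349245963196446450650931628580494116913579029876689580406195537132893861101766525411039801223521351261077748550 1650 [106379288, 139753636, 145886771, 88924233, 96709526, 129146369, 116164962, 135176711, 130329067, 125983487, 140904475, 110149414, 148802745, 171001052, 124271663, 130675115, 128186878, 134316986, 137024034, 136259407, 139180213, 145188764, 134217728, 134217728, 134217728, 134217728, 134217728, 134217728, 134217728, 134217728, 134217728, 134217728, 134217728, 134217728, 134217728, 134217728, 134217728, 134217728, 134217728, 134217728, 134217728, 134217728, 134217728, 134217728, 134217728, 134217728, 134217728, 134217728, 134217728, 134217728, 134217728, 134217728, 134217728, 134217728, 134217728, 134217728, 134217728, 134217728, 134217728, 134217728, 134217728, 134217728, 134217728, 134217728, 134217728, 134217728]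
def lfB56 : Lf := .mk 45050930346835389237469356252918187750458202466709260120308441173450221977958368041418717064408005788249650579417399940406994569447721294762367858188123682665585112924361898706080539144754617617903448917338041650979842964477433186147744554611357088965268564757226855809082015887034910391558228265479199983328747062728000261707353468495239472053379872396912088515825543571259545807555614292642333832015578401259419690507998652952361385984601552894865185134548522885317447833022925747969377630581414155833076816577884545111047309137611454748119753824994005129294518109670575228848339466988615409321621061979345691254237208746668503893075309196996759002 1680 [96882694, 135923913, 225537404, 134217728, 134217728, 134217728, 134217728, 134217728, 134217728, 134217728, 134217728, 134217728, 134217728, 134217728, 134217728, 134217728, 134217728, 134217728, 134217728, 134217728, 134217728, 134217728, 134217728, 134217728, 134217728, 134217728, 134217728, 134217728, 134217728, 134217728, 134217728, 134217728, 134217728, 134217728, 134217728, 134217728, 134217728, 134217728, 134217728, 134217728, 134217728, 134217728, 134217728, 134217728, 134217728, 134217728, 134217728, 134217728, 134217728, 134217728, 134217728, 134217728, 134217728, 134217728, 134217728, 134217728, 134217728, 134217728, 134217728, 134217728, 134217728, 134217728, 134217728, 134217728, 134217728, 134217728]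
def lfB57 : Lf := .mk 40596796941708908132773645135375026279682269859746053757217195867626883091984313874575374453175039473458158441303305685970700814319635987395298441244669992361538642831527439522487373074908571805238289858009784512005446038106448644006288493441012218223393615084519513067675685958023897441990418843976324684234356582767112993666404222201871050829012662343447201967800969834107764450164444765918226052738840843342921275419499547439079492623889663867380125363200513820169958153326070671001275266536322126549060303465018778008548749257122262620078031643266051929110796979328015860446356857350676866549575929323388844371280316609705595371171306334026912482 1710 [124447532, 134404956, 123260282, 146025285, 133568797, 134045588, 132354614, 137105570, 148829520, 128575817, 136458372, 128978254, 146290334, 124842357, 137134581, 145242246, 126863296, 151510493, 134217728, 134217728, 134217728, 134217728, 134217728, 134217728, 134217728, 134217728, 134217728, 134217728, 134217728, 134217728, 134217728, 134217728, 134217728, 134217728, 134217728, 134217728, 134217728, 134217728, 134217728, 134217728, 134217728, 134217728, 134217728, 134217728, 134217728, 134217728, 134217728, 134217728, 134217728, 134217728, 134217728, 134217728, 134217728, 134217728, 134217728, 134217728, 134217728, 134217728, 134217728, 134217728, 134217728, 134217728, 134217728, 134217728, 134217728, 134217728]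
def lfB58 : Lf := .mk 42733471812714749418087250971729913389571940672686847764876431885779661074136213498171991046196162849650338772412406542545892747239156810868657419217590388626256193062592921362981727532071579331329125152644556031333397891390281609608026709991421352909526006597059337797743655002976858649863495756688425986699609124053281962038996721342569393898881907405284081795542180080394570667247625627812469316824830182110902801029533943776519165373619902446524157955624325277954924566966712417581504199102196544533474934307233903681281130547816975574978480825147775373645446717163110660406632937083281389873101057439561918129719580401075408850262011687689801174 1740 [95889194, 123793399, 129050323, 150372577, 122086767, 114754698, 129621763, 146023198, 141311225, 149483102, 129881256, 132761427, 145719980, 120227096, 135765623, 128291582, 134849854, 131150600, 126368758, 130438281, 134342541, 134735387, 133772467, 136590173, 134511053, 131742011, 134582678, 134257832, 135930994, 133396292, 135513374, 134486927, 133981126, 134454367, 133250949, 134544685, 134329629, 133884706, 134048141, 134045670, 134175536, 133448975, 134280338, 134365193, 133646265, 133791431, 134702264, 134228544, 133993411, 134263055, 134149612, 134090664, 134066625, 134088644, 134176225, 134354250, 134087975, 134135196, 133837071, 134241385, 134413353, 134198979, 134365176, 134139307, 134198554, 134178493]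
def lfB59 : Lf := .mk 40732435751159315098813333788768752869202699139642996565765045133623356372366041921727243615119531130749257900723503143293155077875095215748254576555512774985147714952080394299747498802293249929998715463161406773483828974753286248007533818994179176455103584707385373059001209730942264748001590990782050994773322692971293000990012260787411576850601412766213585811403523328789688295161195866096971839088185407257397393314529906997679909057509229874651349365876602537623592791309269923126041362682069978638559961380597159912507623377474447423601826034187647768474162553034265645666877385500202618223433365217957756481633731175225393947036080198076442021 1770 [134619366, 163625167, 161083836, 119734235, 131300062, 151629271, 160262110, 153387371, 153156942, 141419988, 154004966, 122236402, 132498149, 179734859, 134217728, 134217728, 134217728, 134217728, 134217728, 134217728, 134217728, 134217728, 134217728, 134217728, 134217728, 134217728, 134217728, 134217728, 134217728, 134217728, 134217728, 134217728, 134217728, 134217728, 134217728, 134217728, 134217728, 134217728, 134217728, 134217728, 134217728, 134217728, 134217728, 134217728, 134217728, 134217728, 134217728, 134217728, 134217728, 134217728, 134217728, 134217728, 134217728, 134217728, 134217728, 134217728, 134217728, 134217728, 134217728, 134217728, 134217728, 134217728, 134217728, 134217728, 134217728, 134217728]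
def lfB60 : Lf := .mk 38011107064432135073151495333354267814411386202652410430696620080468019516859419171692277204396580042724695580769439557870978163123416694548423364244816386993868064664830765115028479831929576194655050288331713322086704071788352202432151404603443208554206735457853524882267234444144338629750040464920665256710520522878089129028445786303883050001547245141032367265908415294103629682349513273909114015571836787210886160827410100989887895248701134576748537918967733617480471102528501178484490761816864478668898015769967764319385553632417084394626783594646054034407736047812813840644672913533921961281338531494094160343336921662412604035405487370095560216 1800 [101119462, 152431715, 131673522, 160369397, 152832983, 152538237, 140095817, 122035005, 138928476, 150771011, 139688886, 113415241, 138469668, 156612381, 144595026, 122702390, 136143356, 124298004, 129491659, 127925609, 132049685, 133595386, 135151403, 134291288, 135173158, 133113667, 136444535, 134203639, 133925806, 132029605, 136042169, 132850557, 133915134, 133175431, 133033316, 134334208, 132426501, 134246144, 134172680, 134043059, 134073753, 134061183, 134237562, 134186530, 132956783, 134155645, 134620237, 134163352, 133788619, 134046993, 135432988, 134217728, 134217728, 134217728, 134217728, 134217728, 134217728, 134217728, 134217728, 134217728, 134217728, 134217728, 134217728, 134217728, 134217728, 134217728]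
def lfB61 : Lf := .mk 45497143647124245474579103385004489722094656349700128001883167047820538126664659142272591281378573098904019855136157738976090701758515951890441528591139414594785457412598719500288601979233980194248255563008915690545348696139876633063875981083992628410989157851707144303023489512561297001832177660103378897012205978725243551734762865665207436350010670365957439313052128891822467235348701418684054045040657300941709026960999087503437857410461675732787895926592561460221584930061073319337930821947727892987467286287667388681398252082940459344350341522977435815661797979314545637563748606647168216673962432674292427249607570500371269848100489353936616262 1830 [152790373, 112754228, 129496198, 131505336, 94866736, 89728035, 119430153, 147291270, 130329067, 151527398, 139682003, 157695666, 124840995, 110092083, 107194323, 140921216, 129795909, 139043608, 133563275, 148120472, 134217728, 134217728, 134217728, 134217728, 134217728, 134217728, 134217728, 134217728, 134217728, 134217728, 134217728, 134217728, 134217728, 134217728, 134217728, 134217728, 134217728, 134217728, 134217728, 134217728, 134217728, 134217728, 134217728, 134217728, 134217728, 134217728, 134217728, 134217728, 134217728, 134217728, 134217728, 134217728, 134217728, 134217728, 134217728, 134217728, 134217728, 134217728, 134217728, 134217728, 134217728, 134217728, 134217728, 134217728, 134217728, 134217728]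
def lfB62 : Lf := .mk 48150736926564894485436441941528384291940585107374051877336204742408738481995743535290876242308559625824705021281019520532069945149014310594587943822216850038328621979479578449924487517655625093383351935142272678106530566702300923453526828675260830276377122933741418621613585992135210862008605557565380472269006296455838437525184540572378410949682417830749434495893880884065639043790012201811565434308964531228592027545271332071974455208420252780711849376190481429795816390496258682914298297749652218649580072691412098455737224308207103595514183706128342364134622588632774148489668701890423587937696798148104851507747165539666864717626093170225147634 1860 [141062557, 145983761, 150298516, 124966881, 110998808, 121269103, 96229358, 153064725, 111708264, 130784457, 119816804, 127860678, 132585215, 131062741, 122107341, 131757403, 136502023, 133870938, 133342976, 137669460, 136663575, 140999986, 138990126, 134031517, 133119825, 136252299, 130404138, 135185009, 134973415, 134063128, 133846105, 134206665, 134502053, 134790191, 134373165, 134308633, 134760492, 132879492, 134864314, 134907774, 134237203, 133261581, 134071693, 133921144, 133997422, 134114975, 133932015, 134253375, 134090381, 134240939, 133845834, 134142383, 134279303, 134632813, 134144934, 134067078, 133855533, 134202382, 134185303, 134328407, 134040980, 134269503, 134251973, 134240190, 134320864, 134217728]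
def lfB63 : Lf := .mk 45050930350536062182432329731698175689455526028413386877101360692253391365088018516197907762942410400868192502869275203606072774365237317875735366794074766827075981259849729682149633353831589758630339246959050105189948386625934466309603961973597782244766850657341434706355220750195123565527604546238259990207518523278391949011187115948758698037701906270051346397884947729795705333554260982877415719758666540993053822677898113122802570044066212800826497974562760295086582424570489586667040923473877530584310662590092307344622833081862290335141233849387517732958778189790255697914931067593479961999279267418499474857651150336902629884165164273122921946 1890 [154155294, 102605874, 183032422, 157150134, 127256309, 124177781, 153129907, 204385964, 134217728, 134217728, 134217728, 134217728, 134217728, 134217728, 134217728, 134217728, 134217728, 134217728, 134217728, 134217728, 134217728, 134217728, 134217728, 134217728, 134217728, 134217728, 134217728, 134217728, 134217728, 134217728, 134217728, 134217728, 134217728, 134217728, 134217728, 134217728, 134217728, 134217728, 134217728, 134217728, 134217728, 134217728, 134217728, 134217728, 134217728, 134217728, 134217728, 134217728, 134217728, 134217728, 134217728, 134217728, 134217728, 134217728, 134217728, 134217728, 134217728, 134217728, 134217728, 134217728, 134217728, 134217728, 134217728, 134217728, 134217728, 134217728]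
def lfB64 : Lf := .mk 34130477534607601934232684899930217499023593939177121474697803028662079598442239256805262913217019897228265274057442558913912452431400510482522650094082435005275140949652461888499316710341749385649879891077862123619609504010153327667280860836596363841559507948130243837493098047052555109853836851338036437676825595877100058378844174068176371707569813295714722787165914689857094545407150404986615780506210876552089511728954069611538575287103800638630001731311251339488945377797011139066133406639975694082639099313059709814226796603448210247212522363546276995332985632138245309428882328351282013492810962747235061092279621335472873416407843582908655396 1920 [115120655, 101390495, 119425317, 132135690, 217678446, 134217728, 134217728, 134217728, 134217728, 134217728, 134217728, 134217728, 134217728, 134217728, 134217728, 134217728, 134217728, 134217728, 134217728, 134217728, 134217728, 134217728, 134217728, 134217728, 134217728, 134217728, 134217728, 134217728, 134217728, 134217728, 134217728, 134217728, 134217728, 134217728, 134217728, 134217728, 134217728, 134217728, 134217728, 134217728, 134217728, 134217728, 134217728, 134217728, 134217728, 134217728, 134217728, 134217728, 134217728, 134217728, 134217728, 134217728, 134217728, 134217728, 134217728, 134217728, 134217728, 134217728, 134217728, 134217728, 134217728, 134217728, 134217728, 134217728, 134217728, 134217728]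
def lfB65 : Lf := .mk 39512436582651711776181202018892045848473538167815418204529813184912349581707514209025014121129732693856696673315030039922872339245151898788211591277930500106639424672890052396516958824391521995929562585344094744028297044462746243333478631981226763102825902225501090386160279057299890046550355518450023236164295589505769742245228667317539978474191214314548212084309730779952443383712325708000825064825871274354493286647577612016065537053634727813605075494513267091807894026111231331731228365679597538644658837049979868000983006986848384503483584719616920340834609775884018366474572473693407508789424627363264951401989507848873854578194545188344827208 1950 [115582951, 126118390, 121104872, 148102167, 158798447, 109669948, 143162692, 117291972, 138987486, 155607089, 125207528, 144295788, 110790136, 145247956, 123235371, 112824755, 120226526, 136203048, 137735795, 135142582, 131573508, 130563832, 132872833, 137051270, 133080643, 131225347, 132705726, 133498668, 133412344, 132229736, 132055990, 134312184, 133963493, 134074588, 134189978, 133111829, 132950380, 134574348, 133736307, 133507845, 134197200, 136598616, 134217728, 134217728, 134217728, 134217728, 134217728, 134217728, 134217728, 134217728, 134217728, 134217728, 134217728, 134217728, 134217728, 134217728, 134217728, 134217728, 134217728, 134217728, 134217728, 134217728, 134217728, 134217728, 134217728, 134217728]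
def lfB66 : Lf := .mk 39512436584308223368984385858002858199480289815595033004774295831313134828731675591572367775395379439432757398577308992776747662082344054155653513810244132004554862611600571640153588327564611440830216278136249164544706486512045867784916286531664890205236994831108750866157986166598328715928078796594801978329613537216432493891709311510393124346991461959573337877393455056283086487249593767746670345172712486583922204044842234805216322514516827248217242488549677552817119662404297381724899063319611945515101827880944935495749198957315781797019563974543012421030368096657690015783346351540537645631671816488811036132955005040570682112521951031028223304 1980 [136388013, 114015152, 120367083, 108183676, 157671863, 151973670, 148303942, 136367112, 138987486, 125684464, 126639555, 134737868, 165180522, 142230871, 124165521, 164375077, 134217728, 134217728, 134217728, 134217728, 134217728, 134217728, 134217728, 134217728, 134217728, 134217728, 134217728, 134217728, 134217728, 134217728, 134217728, 134217728, 134217728, 134217728, 134217728, 134217728, 134217728, 134217728, 134217728, 134217728, 134217728, 134217728, 134217728, 134217728, 134217728, 134217728, 134217728, 134217728, 134217728, 134217728, 134217728, 134217728, 134217728, 134217728, 134217728, 134217728, 134217728, 134217728, 134217728, 134217728, 134217728, 134217728, 134217728, 134217728, 134217728, 134217728]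
def lfB67 : Lf := .mk 42047217384920092758574256970315684610165792181836403807623702049337140904105857781747989469062211511361549395409098722576903934480997226243454896948718716354408713368006819515779222234931695489194574782791697367965920297409523195834486353042737293518530017439792628204999989230344122484379435292479879517537028190502900117701766162107214563858139796323886994053960302478670353588954574087449207473743425982874923422172008353648005725500695380827703364248641973040258501721445481918686805804721797945992289358058332640591746108886585797014242095728661657431661446006730865345930000289661200550583004334804146598876330335174153970854934129708141458007 2010 [137891632, 140533047, 133912547, 146918457, 147831278, 147075993, 146255709, 129827871, 173774740, 132820366, 108010054, 140176989, 134256786, 133255245, 154745342, 135715391, 134184491, 131944097, 132366100, 126920170, 128702241, 128619563, 133981804, 135238116, 132920767, 131157587, 132388543, 133766522, 132259164, 132291327, 132087700, 134266104, 135067815, 134314151, 134519627, 134341665, 133768996, 134627224, 133936219, 133699348, 134566790, 135537364, 134775595, 133985650, 133999735, 134511670, 133820598, 134023044, 133910266, 134589821, 134584709, 134284552, 134010015, 134139054, 134176332, 133928871, 134048160, 134127178, 134201846, 134307399, 134172546, 134129415, 134143628, 134217419, 134248530, 134248980]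
def lfB68 : Lf := .mk 48659809056704633745501219276972174949472317535540567411935606971280085163733915445822144439237604055734099175934664377412646910483836928404649005260028840947894070687516701017091087026037142390112769798425088675406742217128990988657706867525484581986237142198340882081747006849991831101656891108363914456158368674520918691547386378724383625648972895388310302268165727198524335631069258181779533981497374548616901397941003884702533662260556215153057939363397071980019087527115603684747149049482585453665193283663873350025181018974958529080030697050896799451180060903768224221199817882984411962933201766202901978049286542084248800951220888768705815816 2040 [148291342, 158409802, 144235287, 101469239, 84894049, 99087659, 121207132, 144575544, 115414503, 142646666, 136453196, 135165754, 138533830, 145931505, 102964019, 137693983, 126336042, 137436637, 139746472, 142289289, 139446326, 139986795, 136474996, 136209945, 135249462, 138534140, 133038917, 134315390, 138999625, 134519449, 134687360, 134439068, 133486787, 134020050, 134404833, 135007277, 134300133, 134102782, 134405550, 134538236, 134349239, 133855360, 133908776, 134689009, 134110003, 134623715, 134902236, 134366638, 134081916, 133661113, 133676154, 134476076, 134458697, 134097439, 134040735, 134525843, 134018115, 134091386, 134277270, 134205297, 134486189, 134217728, 134217728, 134217728, 134217728, 134217728]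
def lfB69 : Lf := .mk 47472489896779796988162033947018993170407612776282403864485579052245752410090868001736350684592618527103085448921373600408098888614058378140694690232245213426489872269057123465317396136787747549342702843674228139863097756503832274315444399092751313276136584090299583660087219995605891128658113821806069393515521899755717139747563869596016717800653667746967147801402284775930780653089267746155709102320917263360142608661564201461298555552125407616333339736968190040263129614916576471641492305769269139625169963829876730423621250233457989546256100042164032185131961629156834239622349762675683678205704798547448598970410740927847899817169310376868374846 2070 [133199951, 139677410, 161396877, 118590569, 120271662, 139088409, 131516640, 134935409, 104409446, 137711950, 113578036, 135765168, 135432873, 127544870, 125983840, 107378341, 130734667, 134289399, 135885255, 131884682, 137930031, 136699940, 133066245, 136862404, 135558184, 131781015, 131189137, 135061070, 139832264, 134217728, 134217728, 134217728, 134217728, 134217728, 134217728, 134217728, 134217728, 134217728, 134217728, 134217728, 134217728, 134217728, 134217728, 134217728, 134217728, 134217728, 134217728, 134217728, 134217728, 134217728, 134217728, 134217728, 134217728, 134217728, 134217728, 134217728, 134217728, 134217728, 134217728, 134217728, 134217728, 134217728, 134217728, 134217728, 134217728, 134217728]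
def lfB70 : Lf := .mk 47472489902503233283456311009466245029432476796603804256373167957975881665339766484059004175735125311356666587627741787511065092568562598516937204070429935893584559878583346606703308717996178547597663253389528646576891954001996376249489841417495025538980965740262006107130345158439486860532101238460043352580768877906520657535196526709992079321083450154638011797018541071407097153562560428014100703598078685445836946460451514314635370935937712147398763192219966454568573559292964239843597088230706986073505178973944548529482806262169987071519843473977024432111042286249490485901237388784111796198295641111440555378666959543959102012745757322019268926 2100 [139466887, 136031652, 145341634, 145435326, 118095741, 116138667, 136489632, 153386275, 104409446, 125256010, 114174148, 124449791, 130385195, 136107367, 129523078, 158087119, 142405452, 133039067, 135471079, 139344403, 136169321, 137285487, 137465612, 132519455, 134431079, 142093132, 134217728, 134217728, 134217728, 134217728, 134217728, 134217728, 134217728, 134217728, 134217728, 134217728, 134217728, 134217728, 134217728, 134217728, 134217728, 134217728, 134217728, 134217728, 134217728, 134217728, 134217728, 134217728, 134217728, 134217728, 134217728, 134217728, 134217728, 134217728, 134217728, 134217728, 134217728, 134217728, 134217728, 134217728, 134217728, 134217728, 134217728, 134217728, 134217728, 134217728]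
def lfB71 : Lf := .mk 51654647913123615565021821288756044195991313366737794661213681966574747076883730705697939958021522873774945381639767379704259319163147950767467497795872520669874957216673905063436073314330484988342162170845761819305498965922690796462887793982593195345424648099330070211944865063267455928373244804886256724141158763691566899394982357260359182409677768563127395835825361944142015735984041921759843168176310778385670311177624363091751023695630604544222731643847273330819835067760358116535647766554162944959936499041662565350762787601091424021339990912239817525834391680970948245926387793331975911491345422742223370496615375164315588216470198092404650281 2130 [139576174, 143428719, 150818963, 123460743, 101507972, 119761915, 132105634, 143045386, 122528311, 128298964, 89359364, 130784702, 131840297, 128743604, 138508193, 132227338, 138634412, 132169752, 134545249, 132851773, 134765978, 135541226, 134945174, 134539395, 135516069, 134871625, 130986756, 134565455, 135252164, 133160860, 133109785, 134560809, 134045701, 134303646, 134532666, 134416883, 133663431, 134043042, 133672805, 134031755, 134367935, 134580561, 134288253, 134208754, 134290292, 134193180, 134161724, 133823161, 134036248, 135576671, 134217728, 134217728, 134217728, 134217728, 134217728, 134217728, 134217728, 134217728, 134217728, 134217728, 134217728, 134217728, 134217728, 134217728, 134217728, 134217728]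
def trB : Tr := .node (.node (.node (.node (.node (.node (.node (.leaf lfB0) (.leaf lfB36)) (.node (.leaf lfB10) (.leaf lfB46))) (.node (.node (.leaf lfB3) (.leaf lfB39)) (.node (.leaf lfB21) (.leaf lfB57)))) (.node (.node (.node (.leaf lfB1) (.leaf lfB37)) (.node (.leaf lfB15) (.leaf lfB51))) (.node (.node (.leaf lfB6) (.leaf lfB42)) (.node (.leaf lfB28) (.leaf lfB64))))) (.node (.node (.node (.node (.leaf lfB10) (.leaf lfB46)) (.node (.leaf lfB14) (.leaf lfB50))) (.node (.node (.leaf lfB12) (.leaf lfB48)) (.node (.leaf lfB25) (.leaf lfB61)))) (.node (.node (.node (.leaf lfB11) (.leaf lfB47)) (.node (.leaf lfB19) (.leaf lfB55))) (.node (.node (.leaf lfB13) (.leaf lfB49)) (.node (.leaf lfB32) (.leaf lfB68)))))) (.node (.node (.node (.node (.node (.leaf lfB3) (.leaf lfB39)) (.node (.leaf lfB12) (.leaf lfB48))) (.node (.node (.leaf lfB5) (.leaf lfB41)) (.node (.leaf lfB23) (.leaf lfB59)))) (.node (.node (.node (.leaf lfB4) (.leaf lfB40)) (.node (.leaf lfB17)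 (.leaf lfB53))) (.node (.node (.leaf lfB8) (.leaf lfB44)) (.node (.leaf lfB30) (.leaf lfB66))))) (.node (.node (.node (.node (.leaf lfB21) (.leaf lfB57)) (.node (.leaf lfB25) (.leaf lfB61))) (.node (.node (.leaf lfB23) (.leaf lfB59)) (.node (.leaf lfB27) (.leaf lfB63)))) (.node (.node (.node (.leaf lfB22) (.leaf lfB58)) (.node (.leaf lfB26) (.leaf lfB62))) (.node (.node (.leaf lfB24) (.leaf lfB60)) (.node (.leaf lfB34) (.leaf lfB70))))))) (.node (.node (.node (.node (.node (.node (.leaf lfB1) (.leaf lfB37)) (.node (.leaf lfB11) (.leaf lfB47))) (.node (.node (.leaf lfB4) (.leaf lfB40)) (.node (.leaf lfB22) (.leaf lfB58)))) (.node (.node (.node (.leaf lfB2) (.leaf lfB38)) (.node (.leaf lfB16) (.leaf lfB52))) (.node (.node (.leaf lfB7) (.leaf lfB43)) (.node (.leaf lfB29) (.leaf lfB65))))) (.node (.node (.node (.node (.leaf lfB15) (.leaf lfB51)) (.node (.leaf lfB19) (.leaf lfB55))) (.node (.node (.leaf lfB17) (.leaf lfB53)) (.node (.leaf lfB26) (.leaf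 lfB62)))) (.node (.node (.node (.leaf lfB16) (.leaf lfB52)) (.node (.leaf lfB20) (.leaf lfB56))) (.node (.node (.leaf lfB18) (.leaf lfB54)) (.node (.leaf lfB33) (.leaf lfB69)))))) (.node (.node (.node (.node (.node (.leaf lfB6) (.leaf lfB42)) (.node (.leaf lfB13) (.leaf lfB49))) (.node (.node (.leaf lfB8) (.leaf lfB44)) (.node (.leaf lfB24) (.leaf lfB60)))) (.node (.node (.node (.leaf lfB7) (.leaf lfB43)) (.node (.leaf lfB18) (.leaf lfB54))) (.node (.node (.leaf lfB9) (.leaf lfB45)) (.node (.leaf lfB31) (.leaf lfB67))))) (.node (.node (.node (.node (.leaf lfB28) (.leaf lfB64)) (.node (.leaf lfB32) (.leaf lfB68))) (.node (.node (.leaf lfB30) (.leaf lfB66)) (.node (.leaf lfB34) (.leaf lfB70)))) (.node (.node (.node (.leaf lfB29) (.leaf lfB65)) (.node (.leaf lfB33) (.leaf lfB69))) (.node (.node (.leaf lfB31) (.leaf lfB67)) (.node (.leaf lfB35) (.leaf lfB71)))))))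
def lsB : List Lf := [lfB0, lfB1, lfB2, lfB3, lfB4, lfB5, lfB6, lfB7, lfB8, lfB9, lfB10, lfB11, lfB12, lfB13, lfB14, lfB15, lfB16, lfB17, lfB18, lfB19, lfB20, lfB21, lfB22, lfB23, lfB24, lfB25, lfB26, lfB27, lfB28, lfB29, lfB30, lfB31, lfB32, lfB33, lfB34, lfB35, lfB36, lfB37, lfB38, lfB39, lfB40, lfB41, lfB42, lfB43, lfB44, lfB45, lfB46, lfB47, lfB48, lfB49, lfB50, lfB51, lfB52, lfB53, lfB54, lfB55, lfB56, lfB57, lfB58, lfB59, lfB60, lfB61, lfB62, lfB63, lfB64, lfB65, lfB66, lfB67, lfB68, lfB69, lfB70, lfB71]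

def look (t : Tr) (x0 x1 x2 y0 y1 y2 z u0 u1 u2 v0 v1 v2 w : Bool) : Nat :=
  entry (t.path x0 x1 x2 y0 y1 y2 z) (t.path u0 u1 u2 v0 v1 v2 w)

def U (t : Tr) (d0 d1 d2 e0 e1 e2 f0 f1 f2 h0 h1 h2 de df dh ef eh fh : Bool) : Nat :=
  Nat.add (look t d0 d1 d2 e0 e1 e2 de f0 f1 f2 h0 h1 h2 fh)
    (Nat.add (look t d0 d1 d2 f0 f1 f2 df e0 e1 e2 h0 h1 h2 eh)
      (look t d0 d1 d2 h0 h1 h2 dh e0 e1 e2 f0 f1 f2 ef))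

def TU (ab ac bc da db dc ea eb ec fa fb fc ha hb hc de df dh ef eh fh : Bool) : Nat :=
  cond ab
    (cond ac
      (cond bc (U trA (not da) (not db) (not dc) (not ea) (not eb) (not ec) (not fa) (not fb) (not fc) (not ha) (not hb) (not hc) (not de) (not df) (not dh) (not ef) (not eh) (not fh))
        (U trB (not db) (not dc) (not da) (not eb) (not ec) (not ea) (not fb) (not fc) (not fa) (not hb) (not hc) (not ha) (not de) (not df) (not dh) (not ef) (not eh) (not fh)))
      (cond bc (U trB (not da) (not dc) (not db) (not ea) (not ec) (not eb) (not fa) (not fc) (not fb) (not ha) (not hc) (not hb) (not de) (not df) (not dh) (not ef) (not eh) (not fh))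
        (U trB da db dc ea eb ec fa fb fc ha hb hc de df dh ef eh fh)))
    (cond ac
      (cond bc (U trB (not da) (not db) (not dc) (not ea) (not eb) (not ec) (not fa) (not fb) (not fc) (not ha) (not hb) (not hc) (not de) (not df) (not dh) (not ef) (not eh) (not fh))
        (U trB da dc db ea ec eb fa fc fb ha hc hb de df dh ef eh fh))
      (cond bc (U trB db dc da eb ec ea fb fc fa hb hc ha de df dh ef eh fh)
        (U trA da db dc ea eb ec fa fb fc ha hb hc de df dh ef eh fh)))

/-- cost of a 4-set: zero when monochromatic -/
def nm (de df dh ef eh fh : Bool) : Nat :=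
  cond de (cond (and df (and dh (and ef (and eh fh)))) 0 1)
    (cond (or df (or dh (or ef (or eh fh)))) 1 0)

def TT (ab ac bc da db dc ea eb ec fa fb fc ha hb hc de df dh ef eh fh : Bool) : Nat :=
  Nat.add (TU ab ac bc da db dc ea eb ec fa fb fc ha hb hc de df dh ef eh fh)
    (Nat.mul 67108864 (nm de df dh ef eh fh))

def W21 (b01 b02 b12 b03 b13 b23 b04 b14 b24 b34 b05 b15 b25 b35 b45 b06 b16 b26 b36 b46 b56 : Bool) : Nat :=
  Nat.add (TT b01 b02 b12 b03 b13 b23 b04 b14 b24 b05 b15 b25 b06 b16 b26 b34 b35 b36 b45 b46 b56) <|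
  Nat.add (TT b01 b03 b13 b02 b12 b23 b04 b14 b34 b05 b15 b35 b06 b16 b36 b24 b25 b26 b45 b46 b56) <|
  Nat.add (TT b01 b04 b14 b02 b12 b24 b03 b13 b34 b05 b15 b45 b06 b16 b46 b23 b25 b26 b35 b36 b56) <|
  Nat.add (TT b01 b05 b15 b02 b12 b25 b03 b13 b35 b04 b14 b45 b06 b16 b56 b23 b24 b26 b34 b36 b46) <|
  Nat.add (TT b01 b06 b16 b02 b12 b26 b03 b13 b36 b04 b14 b46 b05 b15 b56 b23 b24 b25 b34 b35 b45) <|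
  Nat.add (TT b02 b03 b23 b01 b12 b13 b04 b24 b34 b05 b25 b35 b06 b26 b36 b14 b15 b16 b45 b46 b56) <|
  Nat.add (TT b02 b04 b24 b01 b12 b14 b03 b23 b34 b05 b25 b45 b06 b26 b46 b13 b15 b16 b35 b36 b56) <|
  Nat.add (TT b02 b05 b25 b01 b12 b15 b03 b23 b35 b04 b24 b45 b06 b26 b56 b13 b14 b16 b34 b36 b46) <|
  Nat.add (TT b02 b06 b26 b01 b12 b16 b03 b23 b36 b04 b24 b46 b05 b25 b56 b13 b14 b15 b34 b35 b45) <|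
  Nat.add (TT b03 b04 b34 b01 b13 b14 b02 b23 b24 b05 b35 b45 b06 b36 b46 b12 b15 b16 b25 b26 b56) <|
  Nat.add (TT b03 b05 b35 b01 b13 b15 b02 b23 b25 b04 b34 b45 b06 b36 b56 b12 b14 b16 b24 b26 b46) <|
  Nat.add (TT b03 b06 b36 b01 b13 b16 b02 b23 b26 b04 b34 b46 b05 b35 b56 b12 b14 b15 b24 b25 b45) <|
  Nat.add (TT b04 b05 b45 b01 b14 b15 b02 b24 b25 b03 b34 b35 b06 b46 b56 b12 b13 b16 b23 b26 b36) <|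
  Nat.add (TT b04 b06 b46 b01 b14 b16 b02 b24 b26 b03 b34 b36 b05 b45 b56 b12 b13 b15 b23 b25 b35) <|
  Nat.add (TT b05 b06 b56 b01 b15 b16 b02 b25 b26 b03 b35 b36 b04 b45 b46 b12 b13 b14 b23 b24 b34) <|
  Nat.add (TT b12 b13 b23 b01 b02 b03 b14 b24 b34 b15 b25 b35 b16 b26 b36 b04 b05 b06 b45 b46 b56) <|
  Nat.add (TT b12 b14 b24 b01 b02 b04 b13 b23 b34 b15 b25 b45 b16 b26 b46 b03 b05 b06 b35 b36 b56) <|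
  Nat.add (TT b12 b15 b25 b01 b02 b05 b13 b23 b35 b14 b24 b45 b16 b26 b56 b03 b04 b06 b34 b36 b46) <|
  Nat.add (TT b12 b16 b26 b01 b02 b06 b13 b23 b36 b14 b24 b46 b15 b25 b56 b03 b04 b05 b34 b35 b45) <|
  Nat.add (TT b13 b14 b34 b01 b03 b04 b12 b23 b24 b15 b35 b45 b16 b36 b46 b02 b05 b06 b25 b26 b56) <|
  Nat.add (TT b13 b15 b35 b01 b03 b05 b12 b23 b25 b14 b34 b45 b16 b36 b56 b02 b04 b06 b24 b26 b46) <|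
  Nat.add (TT b13 b16 b36 b01 b03 b06 b12 b23 b26 b14 b34 b46 b15 b35 b56 b02 b04 b05 b24 b25 b45) <|
  Nat.add (TT b14 b15 b45 b01 b04 b05 b12 b24 b25 b13 b34 b35 b16 b46 b56 b02 b03 b06 b23 b26 b36) <|
  Nat.add (TT b14 b16 b46 b01 b04 b06 b12 b24 b26 b13 b34 b36 b15 b45 b56 b02 b03 b05 b23 b25 b35) <|
  Nat.add (TT b15 b16 b56 b01 b05 b06 b12 b25 b26 b13 b35 b36 b14 b45 b46 b02 b03 b04 b23 b24 b34) <|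
  Nat.add (TT b23 b24 b34 b02 b03 b04 b12 b13 b14 b25 b35 b45 b26 b36 b46 b01 b05 b06 b15 b16 b56) <|
  Nat.add (TT b23 b25 b35 b02 b03 b05 b12 b13 b15 b24 b34 b45 b26 b36 b56 b01 b04 b06 b14 b16 b46) <|
  Nat.add (TT b23 b26 b36 b02 b03 b06 b12 b13 b16 b24 b34 b46 b25 b35 b56 b01 b04 b05 b14 b15 b45) <|
  Nat.add (TT b24 b25 b45 b02 b04 b05 b12 b14 b15 b23 b34 b35 b26 b46 b56 b01 b03 b06 b13 b16 b36) <|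
  Nat.add (TT b24 b26 b46 b02 b04 b06 b12 b14 b16 b23 b34 b36 b25 b45 b56 b01 b03 b05 b13 b15 b35) <|
  Nat.add (TT b25 b26 b56 b02 b05 b06 b12 b15 b16 b23 b35 b36 b24 b45 b46 b01 b03 b04 b13 b14 b34) <|
  Nat.add (TT b34 b35 b45 b03 b04 b05 b13 b14 b15 b23 b24 b25 b36 b46 b56 b01 b02 b06 b12 b16 b26) <|
  Nat.add (TT b34 b36 b46 b03 b04 b06 b13 b14 b16 b23 b24 b26 b35 b45 b56 b01 b02 b05 b12 b15 b25) <|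
  Nat.add (TT b35 b36 b56 b03 b05 b06 b13 b15 b16 b23 b25 b26 b34 b45 b46 b01 b02 b04 b12 b14 b24) <|
  TT b45 b46 b56 b04 b05 b06 b14 b15 b16 b24 b25 b26 b34 b35 b36 b01 b02 b03 b12 b13 b23
def KK : Nat := 30466965150

def bn (b : Bool) : Nat := cond b 1 0

def bf {α : Type} (b : Bool) (k : Bool → α) : α := Bool.casesOn b (k false) (k true)

def allB (f : Bool → Bool) : Bool := cond (f false) (f true) false

def mx21 (b01 b02 b12 b03 b13 b23 b04 b14 b24 b34 b05 b15 b25 b35 b45 b06 b16 b26 b36 b46 b56 : Bool) : Bool :=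
  Nat.ble (Nat.add (bn b01) (Nat.add (bn b02) (Nat.add (bn b03) (Nat.add (bn b04) (Nat.add (bn b05) (bn b06)))))) (Nat.add (bn b06) (Nat.add (bn b16) (Nat.add (bn b26) (Nat.add (bn b36) (Nat.add (bn b46) (bn b56)))))) && 
  Nat.ble (Nat.add (bn b01) (Nat.add (bn b12) (Nat.add (bn b13) (Nat.add (bn b14) (Nat.add (bn b15) (bn b16)))))) (Nat.add (bn b06) (Nat.add (bn b16) (Nat.add (bn b26) (Nat.add (bn b36) (Nat.add (bn b46) (bn b56)))))) && 
  Nat.ble (Nat.add (bn b02) (Nat.add (bn b12) (Nat.add (bn b23) (Nat.add (bn b24) (Nat.add (bn b25) (bn b26)))))) (Nat.add (bn b06) (Nat.add (bn b16) (Nat.add (bn b26) (Nat.add (bn b36) (Nat.add (bn b46) (bn b56)))))) && 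
  Nat.ble (Nat.add (bn b03) (Nat.add (bn b13) (Nat.add (bn b23) (Nat.add (bn b34) (Nat.add (bn b35) (bn b36)))))) (Nat.add (bn b06) (Nat.add (bn b16) (Nat.add (bn b26) (Nat.add (bn b36) (Nat.add (bn b46) (bn b56)))))) && 
  Nat.ble (Nat.add (bn b04) (Nat.add (bn b14) (Nat.add (bn b24) (Nat.add (bn b34) (Nat.add (bn b45) (bn b46)))))) (Nat.add (bn b06) (Nat.add (bn b16) (Nat.add (bn b26) (Nat.add (bn b36) (Nat.add (bn b46) (bn b56)))))) && 
  Nat.ble (Nat.add (bn b05) (Nat.add (bn b15) (Nat.add (bn b25) (Nat.add (bn b35) (Nat.add (bn b45) (bn b56)))))) (Nat.add (bn b06) (Nat.add (bn b16) (Nat.add (bn b26) (Nat.add (bn b36) (Nat.add (bn b46) (bn b56))))))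
def G21 (b01 b02 b12 b03 b13 b23 b04 b14 b24 b34 b05 b15 b25 b35 b45 b06 b16 b26 b36 b46 b56 : Bool) : Bool :=
  cond (mx21 b01 b02 b12 b03 b13 b23 b04 b14 b24 b34 b05 b15 b25 b35 b45 b06 b16 b26 b36 b46 b56) (Nat.ble (W21 b01 b02 b12 b03 b13 b23 b04 b14 b24 b34 b05 b15 b25 b35 b45 b06 b16 b26 b36 b46 b56) KK) true
def chk6 (r : Nat) : Bool :=
  bf (Nat.testBit r 0) fun b01 =>
  bf (Nat.testBit r 1) fun b02 =>
  bf (Nat.testBit r 2) fun b12 =>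
  bf (Nat.testBit r 3) fun b03 =>
  bf (Nat.testBit r 4) fun b13 =>
  bf (Nat.testBit r 5) fun b23 =>
  bf (Nat.testBit r 6) fun b04 =>
  bf (Nat.testBit r 7) fun b14 =>
  bf (Nat.testBit r 8) fun b24 =>
  bf (Nat.testBit r 9) fun b34 =>
  bf (Nat.testBit r 10) fun b05 =>
  bf (Nat.testBit r 11) fun b15 =>
  bf (Nat.testBit r 12) fun b25 =>
  bf (Nat.testBit r 13) fun b35 =>
  bf (Nat.testBit r 14) fun b45 =>
  allB fun b06 =>
  allB fun b16 =>
  allB fun b26 =>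
  allB fun b36 =>
  allB fun b46 =>
  allB fun b56 =>
  G21 b01 b02 b12 b03 b13 b23 b04 b14 b24 b34 b05 b15 b25 b35 b45 b06 b16 b26 b36 b46 b56
def lv1 : List Nat := [0]
def lv2 : List Nat := [0, 1]
def lv3 : List Nat := [0, 2, 6, 7]
def lv4 : List Nat := [0, 8, 24, 56, 18, 26, 42, 58, 30, 62, 63]
def lv5 : List Nat := [0, 64, 192, 448, 960, 136, 200, 392, 456, 584, 712, 968, 216, 344, 472, 728, 856, 984, 504, 1016, 338, 466, 978, 410, 474, 730, 986, 874, 1002, 506, 1018, 990, 1022, 1023]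
def lv6 : List Nat := [0, 1024, 3072, 7168, 15360, 31744, 2112, 3136, 6208, 7232, 14400, 15424, 17472, 19520, 23616, 31808, 3264, 5312, 7360, 12480, 13504, 15552, 19648, 21696, 23744, 28864, 29888, 31936, 7616, 11712, 15808, 24000, 28096, 32192, 16320, 32704, 4232, 5256, 7304, 9352, 11400, 13448, 15496, 27784, 31880, 6344, 7368, 10440, 11464, 13512, 14536, 15560, 19656, 21704, 23752, 27848, 31944, 6536, 7560, 9608, 11656, 15752, 22920, 23944, 25992, 28040, 32136, 7624, 11720, 14792, 15816, 24008, 26056, 28104, 31176, 32200, 26184, 28232, 32328, 11976, 14024, 16072, 28360, 30408, 32456, 16328, 32712, 13528, 15576, 27864, 31960, 6488, 7512, 11608, 14680, 15704, 27992, 31064, 32088, 7640, 11736, 13784, 15832, 24024, 28120, 30168, 32216, 28376, 30424, 32472, 31576, 32600, 16344, 32728, 7672, 15864, 32248, 32760, 10578, 11602, 15698, 21842, 23890, 32082, 11730, 13778, 15826, 24018, 28114, 30162, 32210, 16338, 32722, 15770, 32154, 14810, 15834, 24026, 28122, 32218, 28378, 30426, 32474, 16346, 32730, 30570, 32618, 16362,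 32746, 15866, 32250, 32762, 16350, 32734, 32766, 32767]
theorem allB_iff (f : Bool → Bool) : allB f = true ↔ ∀ b, f b = true := by
  unfold allB
  constructor
  · intro h b
    cases hf : f false <;> rw [hf] at h <;> cases b <;> simp_all
  · intro h; simp [h]

theorem bf_eq {α : Type} (b : Bool) (k : Bool → α) : bf b k = k b := by
  cases b <;> rfl

/-- dot product of two lists -/
noncomputable def dotL (l : List Nat) : List Nat → Nat :=
  List.rec (motive := fun _ => List Nat → Nat) (fun _ => 0)
    (fun x _ ih m => List.casesOn m 0 (fun y ys => Nat.add (Nat.mul x y) (ih ys))) l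

noncomputable def sumL (l : List Nat) : Nat :=
  List.rec (motive := fun _ => Nat) 0 (fun x _ ih => Nat.add x ih) l

/-- certificate for one table entry (all vectors have 66 or fewer coordinates) -/
noncomputable def psdOK (K : Nat) (l m : Lf) : Bool :=
  Nat.ble
    (Nat.add (Nat.add (dotL l.vec m.vec) K) 18014398509481984)
    (Nat.add (Nat.mul 67108864 (entry l m))
      (Nat.mul 134217728 (Nat.add (sumL l.vec) (sumL m.vec))))

noncomputable def symOK (l m : Lf) : Bool := Nat.beq (entry l m) (entry m l)

/-- run a Boolean test over ordered pairs (later element first) of a list -/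
noncomputable def allPairs (p : Lf → Lf → Bool) (l : List Lf) : Bool :=
  List.all l fun x => List.all l fun y => p x y
theorem psdA : allPairs (psdOK 1170935903116328960) lsA = true := by decide +kernel
theorem psdB : allPairs (psdOK 1188950301625810944) lsB = true := by decide +kernel
theorem symA : allPairs symOK lsA = true := by decide +kernel
theorem symB : allPairs symOK lsB = true := by decide +kernel
def inv01 (t : Tr) : Bool :=
  allB fun x0 => allB fun x1 => allB fun x2 => allB fun y0 => allB fun y1 => allB fun y2 =>
  allB fun z => allB fun u0 => allB fun u1 => allB fun u2 => allB fun v0 => allB fun v1 =>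
  allB fun v2 => allB fun w =>
    Nat.beq (look t x0 x1 x2 y0 y1 y2 z u0 u1 u2 v0 v1 v2 w)
      (look t x1 x0 x2 y1 y0 y2 z u1 u0 u2 v1 v0 v2 w)
def inv12 (t : Tr) : Bool :=
  allB fun x0 => allB fun x1 => allB fun x2 => allB fun y0 => allB fun y1 => allB fun y2 =>
  allB fun z => allB fun u0 => allB fun u1 => allB fun u2 => allB fun v0 => allB fun v1 =>
  allB fun v2 => allB fun w =>
    Nat.beq (look t x0 x1 x2 y0 y1 y2 z u0 u1 u2 v0 v1 v2 w)
      (look t x0 x2 x1 y0 y2 y1 z u0 u2 u1 v0 v2 v1 w)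
theorem inv01A : inv01 trA = true := by decide +kernel
theorem inv12A : inv12 trA = true := by decide +kernel
theorem inv01B : inv01 trB = true := by decide +kernel


theorem allPairs_iff (p : Lf → Lf → Bool) (l : List Lf) :
    allPairs p l = true ↔ ∀ x ∈ l, ∀ y ∈ l, p x y = true := by
  simp [allPairs, List.all_eq_true]

/-- index of a flag -/
def fIdx (x0 x1 x2 y0 y1 y2 z : Bool) : Nat :=
  let x := bn x0 + 2 * bn x1 + 4 * bn x2
  let y := bn y0 + 2 * bn y1 + 4 * bn y2
  max x y * (max x y + 1) / 2 + min x y + 36 * bn z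

theorem pathA_mem (x0 x1 x2 y0 y1 y2 z : Bool) : trA.path x0 x1 x2 y0 y1 y2 z ∈ lsA := by
  apply List.mem_of_getElem? (i := fIdx x0 x1 x2 y0 y1 y2 z)
  cases x0 <;> cases x1 <;> cases x2 <;> cases y0 <;> cases y1 <;> cases y2 <;> cases z <;> rfl

theorem pathB_mem (x0 x1 x2 y0 y1 y2 z : Bool) : trB.path x0 x1 x2 y0 y1 y2 z ∈ lsB := by
  apply List.mem_of_getElem? (i := fIdx x0 x1 x2 y0 y1 y2 z)
  cases x0 <;> cases x1 <;> cases x2 <;> cases y0 <;> cases y1 <;> cases y2 <;> cases z <;> rfl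

theorem pathA_symm (x0 x1 x2 y0 y1 y2 z : Bool) :
    trA.path x0 x1 x2 y0 y1 y2 z = trA.path y0 y1 y2 x0 x1 x2 z := by
  cases x0 <;> cases x1 <;> cases x2 <;> cases y0 <;> cases y1 <;> cases y2 <;> cases z <;> rfl

theorem pathB_symm (x0 x1 x2 y0 y1 y2 z : Bool) :
    trB.path x0 x1 x2 y0 y1 y2 z = trB.path y0 y1 y2 x0 x1 x2 z := by
  cases x0 <;> cases x1 <;> cases x2 <;> cases y0 <;> cases y1 <;> cases y2 <;> cases z <;> rfl

theorem lenA : lsA.all (fun l => Nat.beq l.vec.length 65) = true := by decide +kernel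
theorem lenB : lsB.all (fun l => Nat.beq l.vec.length 66) = true := by decide +kernel

/-- everything we need to know about a table -/
structure TabOK (t : Tr) (ls : List Lf) (N : Nat) : Prop where
  mem : ∀ x0 x1 x2 y0 y1 y2 z : Bool, t.path x0 x1 x2 y0 y1 y2 z ∈ ls
  psymm : ∀ x0 x1 x2 y0 y1 y2 z : Bool,
    t.path x0 x1 x2 y0 y1 y2 z = t.path y0 y1 y2 x0 x1 x2 z
  esymm : ∀ l ∈ ls, ∀ m ∈ ls, entry l m = entry m l
  len : ∀ l ∈ ls, l.vec.length = N
  psd : ∀ l ∈ ls, ∀ m ∈ ls, dotL l.vec m.vec + N * 18014398509481984 + 18014398509481984 ≤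
    67108864 * entry l m + 134217728 * (sumL l.vec + sumL m.vec)

theorem okA : TabOK trA lsA 65 where
  mem := pathA_mem
  psymm := pathA_symm
  esymm l hl m hm := Nat.eq_of_beq_eq_true ((allPairs_iff _ _).1 symA l hl m hm)
  len l hl := Nat.eq_of_beq_eq_true (List.all_eq_true.1 lenA l hl)
  psd l hl m hm := Nat.le_of_ble_eq_true ((allPairs_iff _ _).1 psdA l hl m hm)

theorem okB : TabOK trB lsB 66 where
  mem := pathB_mem
  psymm := pathB_symm
  esymm l hl m hm := Nat.eq_of_beq_eq_true ((allPairs_iff _ _).1 symB l hl m hm)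
  len l hl := Nat.eq_of_beq_eq_true (List.all_eq_true.1 lenB l hl)
  psd l hl m hm := Nat.le_of_ble_eq_true ((allPairs_iff _ _).1 psdB l hl m hm)

section symm
variable {t : Tr} {ls : List Lf} {N : Nat}

theorem TabOK.lsymm (h : TabOK t ls N) (x0 x1 x2 y0 y1 y2 z u0 u1 u2 v0 v1 v2 w : Bool) :
    look t x0 x1 x2 y0 y1 y2 z u0 u1 u2 v0 v1 v2 w
      = look t u0 u1 u2 v0 v1 v2 w x0 x1 x2 y0 y1 y2 z :=
  h.esymm _ (h.mem ..) _ (h.mem ..)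

theorem TabOK.l1 (h : TabOK t ls N) (x0 x1 x2 y0 y1 y2 z u0 u1 u2 v0 v1 v2 w : Bool) :
    look t x0 x1 x2 y0 y1 y2 z u0 u1 u2 v0 v1 v2 w
      = look t y0 y1 y2 x0 x1 x2 z u0 u1 u2 v0 v1 v2 w := by
  unfold look; rw [h.psymm x0 x1 x2]

theorem TabOK.l2 (h : TabOK t ls N) (x0 x1 x2 y0 y1 y2 z u0 u1 u2 v0 v1 v2 w : Bool) :
    look t x0 x1 x2 y0 y1 y2 z u0 u1 u2 v0 v1 v2 w
      = look t x0 x1 x2 y0 y1 y2 z v0 v1 v2 u0 u1 u2 w := by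
  unfold look; rw [h.psymm u0 u1 u2]

theorem TabOK.Ude (h : TabOK t ls N) (d0 d1 d2 e0 e1 e2 f0 f1 f2 h0 h1 h2 de df dh ef eh fh : Bool) :
    U t d0 d1 d2 e0 e1 e2 f0 f1 f2 h0 h1 h2 de df dh ef eh fh
      = U t e0 e1 e2 d0 d1 d2 f0 f1 f2 h0 h1 h2 de ef eh df dh fh := by
  unfold U
  rw [h.l1 e0 e1 e2 d0 d1 d2, h.lsymm e0 e1 e2 f0 f1 f2, h.lsymm e0 e1 e2 h0 h1 h2]
  simp only [Nat.add_eq]; omega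

theorem TabOK.Uef (h : TabOK t ls N) (d0 d1 d2 e0 e1 e2 f0 f1 f2 h0 h1 h2 de df dh ef eh fh : Bool) :
    U t d0 d1 d2 e0 e1 e2 f0 f1 f2 h0 h1 h2 de df dh ef eh fh
      = U t d0 d1 d2 f0 f1 f2 e0 e1 e2 h0 h1 h2 df de dh ef fh eh := by
  unfold U
  rw [h.l2 d0 d1 d2 h0 h1 h2 dh e0 e1 e2]
  simp only [Nat.add_eq]; omega

theorem TabOK.Ufh (h : TabOK t ls N) (d0 d1 d2 e0 e1 e2 f0 f1 f2 h0 h1 h2 de df dh ef eh fh : Bool) :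
    U t d0 d1 d2 e0 e1 e2 f0 f1 f2 h0 h1 h2 de df dh ef eh fh
      = U t d0 d1 d2 e0 e1 e2 h0 h1 h2 f0 f1 f2 de dh df eh ef fh := by
  unfold U
  rw [h.l2 d0 d1 d2 e0 e1 e2 de f0 f1 f2]
  simp only [Nat.add_eq]; omega

theorem U01 (h : inv01 t = true) (d0 d1 d2 e0 e1 e2 f0 f1 f2 h0 h1 h2 de df dh ef eh fh : Bool) :
    U t d0 d1 d2 e0 e1 e2 f0 f1 f2 h0 h1 h2 de df dh ef eh fh
      = U t d1 d0 d2 e1 e0 e2 f1 f0 f2 h1 h0 h2 de df dh ef eh fh := by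
  simp only [inv01, allB_iff, Nat.beq_eq] at h
  unfold U
  rw [h d0 d1 d2 e0 e1 e2, h d0 d1 d2 f0 f1 f2, h d0 d1 d2 h0 h1 h2]

theorem U12 (h : inv12 t = true) (d0 d1 d2 e0 e1 e2 f0 f1 f2 h0 h1 h2 de df dh ef eh fh : Bool) :
    U t d0 d1 d2 e0 e1 e2 f0 f1 f2 h0 h1 h2 de df dh ef eh fh
      = U t d0 d2 d1 e0 e2 e1 f0 f2 f1 h0 h2 h1 de df dh ef eh fh := by
  simp only [inv12, allB_iff, Nat.beq_eq] at h
  unfold U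
  rw [h d0 d1 d2 e0 e1 e2, h d0 d1 d2 f0 f1 f2, h d0 d1 d2 h0 h1 h2]

end symm

theorem nm_de (de df dh ef eh fh : Bool) : nm de df dh ef eh fh = nm de ef eh df dh fh := by
  cases de <;> cases df <;> cases dh <;> cases ef <;> cases eh <;> cases fh <;> rfl
theorem nm_ef (de df dh ef eh fh : Bool) : nm de df dh ef eh fh = nm df de dh ef fh eh := by
  cases de <;> cases df <;> cases dh <;> cases ef <;> cases eh <;> cases fh <;> rfl
theorem nm_fh (de df dh ef eh fh : Bool) : nm de df dh ef eh fh = nm de dh df eh ef fh := by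
  cases de <;> cases df <;> cases dh <;> cases ef <;> cases eh <;> cases fh <;> rfl

theorem TT_ab (ab ac bc da db dc ea eb ec fa fb fc ha hb hc de df dh ef eh fh : Bool) :
    TT ab ac bc da db dc ea eb ec fa fb fc ha hb hc de df dh ef eh fh
      = TT ab bc ac db da dc eb ea ec fb fa fc hb ha hc de df dh ef eh fh := by
  unfold TT; congr 1; unfold TU
  cases ab <;> cases ac <;> cases bc <;> simp only [cond_true, cond_false] <;>
    first | rfl | exact U01 inv01A .. | exact U01 inv01B ..

theorem TT_bc (ab ac bc da db dc ea eb ec fa fb fc ha hb hc de df dh ef eh fh : Bool) :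
    TT ab ac bc da db dc ea eb ec fa fb fc ha hb hc de df dh ef eh fh
      = TT ac ab bc da dc db ea ec eb fa fc fb ha hc hb de df dh ef eh fh := by
  unfold TT; congr 1; unfold TU
  cases ab <;> cases ac <;> cases bc <;> simp only [cond_true, cond_false] <;>
    first | rfl | exact U12 inv12A .. | exact U01 inv01B ..

theorem TT_de (ab ac bc da db dc ea eb ec fa fb fc ha hb hc de df dh ef eh fh : Bool) :
    TT ab ac bc da db dc ea eb ec fa fb fc ha hb hc de df dh ef eh fh
      = TT ab ac bc ea eb ec da db dc fa fb fc ha hb hc de ef eh df dh fh := by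
  unfold TT; rw [nm_de de df dh ef eh fh]; congr 1; unfold TU
  cases ab <;> cases ac <;> cases bc <;> simp only [cond_true, cond_false] <;>
    first | exact okA.Ude .. | exact okB.Ude ..

theorem TT_ef (ab ac bc da db dc ea eb ec fa fb fc ha hb hc de df dh ef eh fh : Bool) :
    TT ab ac bc da db dc ea eb ec fa fb fc ha hb hc de df dh ef eh fh
      = TT ab ac bc da db dc fa fb fc ea eb ec ha hb hc df de dh ef fh eh := by
  unfold TT; rw [nm_ef de df dh ef eh fh]; congr 1; unfold TU
  cases ab <;> cases ac <;> cases bc <;> simp only [cond_true, cond_false] <;>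
    first | exact okA.Uef .. | exact okB.Uef ..

theorem TT_fh (ab ac bc da db dc ea eb ec fa fb fc ha hb hc de df dh ef eh fh : Bool) :
    TT ab ac bc da db dc ea eb ec fa fb fc ha hb hc de df dh ef eh fh
      = TT ab ac bc da db dc ea eb ec ha hb hc fa fb fc de dh df eh ef fh := by
  unfold TT; rw [nm_fh de df dh ef eh fh]; congr 1; unfold TU
  cases ab <;> cases ac <;> cases bc <;> simp only [cond_true, cond_false] <;>
    first | exact okA.Ufh .. | exact okB.Ufh ..

abbrev Gr := Fin 7 → Fin 7 → Bool

def tt (B : Gr) (a b c d e f h : Fin 7) : Nat :=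
  TT (B a b) (B a c) (B b c) (B d a) (B d b) (B d c) (B e a) (B e b) (B e c) (B f a) (B f b) (B f c) (B h a) (B h b) (B h c) (B d e) (B d f) (B d h) (B e f) (B e h) (B f h)

def W (B : Gr) : Nat :=
  tt B 0 1 2 3 4 5 6 +
  tt B 0 1 3 2 4 5 6 +
  tt B 0 1 4 2 3 5 6 +
  tt B 0 1 5 2 3 4 6 +
  tt B 0 1 6 2 3 4 5 +
  tt B 0 2 3 1 4 5 6 +
  tt B 0 2 4 1 3 5 6 +
  tt B 0 2 5 1 3 4 6 +
  tt B 0 2 6 1 3 4 5 +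
  tt B 0 3 4 1 2 5 6 +
  tt B 0 3 5 1 2 4 6 +
  tt B 0 3 6 1 2 4 5 +
  tt B 0 4 5 1 2 3 6 +
  tt B 0 4 6 1 2 3 5 +
  tt B 0 5 6 1 2 3 4 +
  tt B 1 2 3 0 4 5 6 +
  tt B 1 2 4 0 3 5 6 +
  tt B 1 2 5 0 3 4 6 +
  tt B 1 2 6 0 3 4 5 +
  tt B 1 3 4 0 2 5 6 +
  tt B 1 3 5 0 2 4 6 +
  tt B 1 3 6 0 2 4 5 +
  tt B 1 4 5 0 2 3 6 +
  tt B 1 4 6 0 2 3 5 +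
  tt B 1 5 6 0 2 3 4 +
  tt B 2 3 4 0 1 5 6 +
  tt B 2 3 5 0 1 4 6 +
  tt B 2 3 6 0 1 4 5 +
  tt B 2 4 5 0 1 3 6 +
  tt B 2 4 6 0 1 3 5 +
  tt B 2 5 6 0 1 3 4 +
  tt B 3 4 5 0 1 2 6 +
  tt B 3 4 6 0 1 2 5 +
  tt B 3 5 6 0 1 2 4 +
  tt B 4 5 6 0 1 2 3

theorem tt_ab (B : Gr) (hB : ∀ i j, B i j = B j i) (a b c d e f h : Fin 7) :
    tt B a b c d e f h = tt B b a c d e f h := by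
  unfold tt; rw [hB b a]; exact TT_ab ..

theorem tt_bc (B : Gr) (hB : ∀ i j, B i j = B j i) (a b c d e f h : Fin 7) :
    tt B a b c d e f h = tt B a c b d e f h := by
  unfold tt; rw [hB c b]; exact TT_bc ..

theorem tt_de (B : Gr) (hB : ∀ i j, B i j = B j i) (a b c d e f h : Fin 7) :
    tt B a b c d e f h = tt B a b c e d f h := by
  unfold tt; rw [hB e d]; exact TT_de ..

theorem tt_ef (B : Gr) (hB : ∀ i j, B i j = B j i) (a b c d e f h : Fin 7) :
    tt B a b c d e f h = tt B a b c d f e h := by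
  unfold tt; rw [hB f e]; exact TT_ef ..

theorem tt_fh (B : Gr) (hB : ∀ i j, B i j = B j i) (a b c d e f h : Fin 7) :
    tt B a b c d e f h = tt B a b c d e h f := by
  unfold tt; rw [hB h f]; exact TT_fh ..

theorem W_sw0 (B : Gr) (hB : ∀ i j, B i j = B j i) :
    W (fun x y => B (![1, 0, 2, 3, 4, 5, 6] x) (![1, 0, 2, 3, 4, 5, 6] y)) = W B := by
  change tt B 1 0 2 3 4 5 6 +
    tt B 1 0 3 2 4 5 6 +
    tt B 1 0 4 2 3 5 6 +
    tt B 1 0 5 2 3 4 6 +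
    tt B 1 0 6 2 3 4 5 +
    tt B 1 2 3 0 4 5 6 +
    tt B 1 2 4 0 3 5 6 +
    tt B 1 2 5 0 3 4 6 +
    tt B 1 2 6 0 3 4 5 +
    tt B 1 3 4 0 2 5 6 +
    tt B 1 3 5 0 2 4 6 +
    tt B 1 3 6 0 2 4 5 +
    tt B 1 4 5 0 2 3 6 +
    tt B 1 4 6 0 2 3 5 +
    tt B 1 5 6 0 2 3 4 +
    tt B 0 2 3 1 4 5 6 +
    tt B 0 2 4 1 3 5 6 +
    tt B 0 2 5 1 3 4 6 +
    tt B 0 2 6 1 3 4 5 +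
    tt B 0 3 4 1 2 5 6 +
    tt B 0 3 5 1 2 4 6 +
    tt B 0 3 6 1 2 4 5 +
    tt B 0 4 5 1 2 3 6 +
    tt B 0 4 6 1 2 3 5 +
    tt B 0 5 6 1 2 3 4 +
    tt B 2 3 4 1 0 5 6 +
    tt B 2 3 5 1 0 4 6 +
    tt B 2 3 6 1 0 4 5 +
    tt B 2 4 5 1 0 3 6 +
    tt B 2 4 6 1 0 3 5 +
    tt B 2 5 6 1 0 3 4 +
    tt B 3 4 5 1 0 2 6 +
    tt B 3 4 6 1 0 2 5 +
    tt B 3 5 6 1 0 2 4 +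
    tt B 4 5 6 1 0 2 3 = W B
  rw [tt_ab B hB 1 0 2 3 4 5 6,
    tt_ab B hB 1 0 3 2 4 5 6,
    tt_ab B hB 1 0 4 2 3 5 6,
    tt_ab B hB 1 0 5 2 3 4 6,
    tt_ab B hB 1 0 6 2 3 4 5,
    tt_de B hB 2 3 4 1 0 5 6,
    tt_de B hB 2 3 5 1 0 4 6,
    tt_de B hB 2 3 6 1 0 4 5,
    tt_de B hB 2 4 5 1 0 3 6,
    tt_de B hB 2 4 6 1 0 3 5,
    tt_de B hB 2 5 6 1 0 3 4,
    tt_de B hB 3 4 5 1 0 2 6,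
    tt_de B hB 3 4 6 1 0 2 5,
    tt_de B hB 3 5 6 1 0 2 4,
    tt_de B hB 4 5 6 1 0 2 3]
  unfold W
  ring

theorem W_sw1 (B : Gr) (hB : ∀ i j, B i j = B j i) :
    W (fun x y => B (![0, 2, 1, 3, 4, 5, 6] x) (![0, 2, 1, 3, 4, 5, 6] y)) = W B := by
  change tt B 0 2 1 3 4 5 6 +
    tt B 0 2 3 1 4 5 6 +
    tt B 0 2 4 1 3 5 6 +
    tt B 0 2 5 1 3 4 6 +
    tt B 0 2 6 1 3 4 5 +
    tt B 0 1 3 2 4 5 6 +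
    tt B 0 1 4 2 3 5 6 +
    tt B 0 1 5 2 3 4 6 +
    tt B 0 1 6 2 3 4 5 +
    tt B 0 3 4 2 1 5 6 +
    tt B 0 3 5 2 1 4 6 +
    tt B 0 3 6 2 1 4 5 +
    tt B 0 4 5 2 1 3 6 +
    tt B 0 4 6 2 1 3 5 +
    tt B 0 5 6 2 1 3 4 +
    tt B 2 1 3 0 4 5 6 +
    tt B 2 1 4 0 3 5 6 +
    tt B 2 1 5 0 3 4 6 +
    tt B 2 1 6 0 3 4 5 +
    tt B 2 3 4 0 1 5 6 +
    tt B 2 3 5 0 1 4 6 +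
    tt B 2 3 6 0 1 4 5 +
    tt B 2 4 5 0 1 3 6 +
    tt B 2 4 6 0 1 3 5 +
    tt B 2 5 6 0 1 3 4 +
    tt B 1 3 4 0 2 5 6 +
    tt B 1 3 5 0 2 4 6 +
    tt B 1 3 6 0 2 4 5 +
    tt B 1 4 5 0 2 3 6 +
    tt B 1 4 6 0 2 3 5 +
    tt B 1 5 6 0 2 3 4 +
    tt B 3 4 5 0 2 1 6 +
    tt B 3 4 6 0 2 1 5 +
    tt B 3 5 6 0 2 1 4 +
    tt B 4 5 6 0 2 1 3 = W B
  rw [tt_bc B hB 0 2 1 3 4 5 6,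
    tt_de B hB 0 3 4 2 1 5 6,
    tt_de B hB 0 3 5 2 1 4 6,
    tt_de B hB 0 3 6 2 1 4 5,
    tt_de B hB 0 4 5 2 1 3 6,
    tt_de B hB 0 4 6 2 1 3 5,
    tt_de B hB 0 5 6 2 1 3 4,
    tt_ab B hB 2 1 3 0 4 5 6,
    tt_ab B hB 2 1 4 0 3 5 6,
    tt_ab B hB 2 1 5 0 3 4 6,
    tt_ab B hB 2 1 6 0 3 4 5,
    tt_ef B hB 3 4 5 0 2 1 6,
    tt_ef B hB 3 4 6 0 2 1 5,
    tt_ef B hB 3 5 6 0 2 1 4,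
    tt_ef B hB 4 5 6 0 2 1 3]
  unfold W
  ring

theorem W_sw2 (B : Gr) (hB : ∀ i j, B i j = B j i) :
    W (fun x y => B (![0, 1, 3, 2, 4, 5, 6] x) (![0, 1, 3, 2, 4, 5, 6] y)) = W B := by
  change tt B 0 1 3 2 4 5 6 +
    tt B 0 1 2 3 4 5 6 +
    tt B 0 1 4 3 2 5 6 +
    tt B 0 1 5 3 2 4 6 +
    tt B 0 1 6 3 2 4 5 +
    tt B 0 3 2 1 4 5 6 +
    tt B 0 3 4 1 2 5 6 +
    tt B 0 3 5 1 2 4 6 +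
    tt B 0 3 6 1 2 4 5 +
    tt B 0 2 4 1 3 5 6 +
    tt B 0 2 5 1 3 4 6 +
    tt B 0 2 6 1 3 4 5 +
    tt B 0 4 5 1 3 2 6 +
    tt B 0 4 6 1 3 2 5 +
    tt B 0 5 6 1 3 2 4 +
    tt B 1 3 2 0 4 5 6 +
    tt B 1 3 4 0 2 5 6 +
    tt B 1 3 5 0 2 4 6 +
    tt B 1 3 6 0 2 4 5 +
    tt B 1 2 4 0 3 5 6 +
    tt B 1 2 5 0 3 4 6 +
    tt B 1 2 6 0 3 4 5 +
    tt B 1 4 5 0 3 2 6 +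
    tt B 1 4 6 0 3 2 5 +
    tt B 1 5 6 0 3 2 4 +
    tt B 3 2 4 0 1 5 6 +
    tt B 3 2 5 0 1 4 6 +
    tt B 3 2 6 0 1 4 5 +
    tt B 3 4 5 0 1 2 6 +
    tt B 3 4 6 0 1 2 5 +
    tt B 3 5 6 0 1 2 4 +
    tt B 2 4 5 0 1 3 6 +
    tt B 2 4 6 0 1 3 5 +
    tt B 2 5 6 0 1 3 4 +
    tt B 4 5 6 0 1 3 2 = W B
  rw [tt_de B hB 0 1 4 3 2 5 6,
    tt_de B hB 0 1 5 3 2 4 6,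
    tt_de B hB 0 1 6 3 2 4 5,
    tt_bc B hB 0 3 2 1 4 5 6,
    tt_ef B hB 0 4 5 1 3 2 6,
    tt_ef B hB 0 4 6 1 3 2 5,
    tt_ef B hB 0 5 6 1 3 2 4,
    tt_bc B hB 1 3 2 0 4 5 6,
    tt_ef B hB 1 4 5 0 3 2 6,
    tt_ef B hB 1 4 6 0 3 2 5,
    tt_ef B hB 1 5 6 0 3 2 4,
    tt_ab B hB 3 2 4 0 1 5 6,
    tt_ab B hB 3 2 5 0 1 4 6,
    tt_ab B hB 3 2 6 0 1 4 5,
    tt_fh B hB 4 5 6 0 1 3 2]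
  unfold W
  ring

theorem W_sw3 (B : Gr) (hB : ∀ i j, B i j = B j i) :
    W (fun x y => B (![0, 1, 2, 4, 3, 5, 6] x) (![0, 1, 2, 4, 3, 5, 6] y)) = W B := by
  change tt B 0 1 2 4 3 5 6 +
    tt B 0 1 4 2 3 5 6 +
    tt B 0 1 3 2 4 5 6 +
    tt B 0 1 5 2 4 3 6 +
    tt B 0 1 6 2 4 3 5 +
    tt B 0 2 4 1 3 5 6 +
    tt B 0 2 3 1 4 5 6 +
    tt B 0 2 5 1 4 3 6 +
    tt B 0 2 6 1 4 3 5 +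
    tt B 0 4 3 1 2 5 6 +
    tt B 0 4 5 1 2 3 6 +
    tt B 0 4 6 1 2 3 5 +
    tt B 0 3 5 1 2 4 6 +
    tt B 0 3 6 1 2 4 5 +
    tt B 0 5 6 1 2 4 3 +
    tt B 1 2 4 0 3 5 6 +
    tt B 1 2 3 0 4 5 6 +
    tt B 1 2 5 0 4 3 6 +
    tt B 1 2 6 0 4 3 5 +
    tt B 1 4 3 0 2 5 6 +
    tt B 1 4 5 0 2 3 6 +
    tt B 1 4 6 0 2 3 5 +
    tt B 1 3 5 0 2 4 6 +
    tt B 1 3 6 0 2 4 5 +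
    tt B 1 5 6 0 2 4 3 +
    tt B 2 4 3 0 1 5 6 +
    tt B 2 4 5 0 1 3 6 +
    tt B 2 4 6 0 1 3 5 +
    tt B 2 3 5 0 1 4 6 +
    tt B 2 3 6 0 1 4 5 +
    tt B 2 5 6 0 1 4 3 +
    tt B 4 3 5 0 1 2 6 +
    tt B 4 3 6 0 1 2 5 +
    tt B 4 5 6 0 1 2 3 +
    tt B 3 5 6 0 1 2 4 = W B
  rw [tt_de B hB 0 1 2 4 3 5 6,
    tt_ef B hB 0 1 5 2 4 3 6,
    tt_ef B hB 0 1 6 2 4 3 5,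
    tt_ef B hB 0 2 5 1 4 3 6,
    tt_ef B hB 0 2 6 1 4 3 5,
    tt_bc B hB 0 4 3 1 2 5 6,
    tt_fh B hB 0 5 6 1 2 4 3,
    tt_ef B hB 1 2 5 0 4 3 6,
    tt_ef B hB 1 2 6 0 4 3 5,
    tt_bc B hB 1 4 3 0 2 5 6,
    tt_fh B hB 1 5 6 0 2 4 3,
    tt_bc B hB 2 4 3 0 1 5 6,
    tt_fh B hB 2 5 6 0 1 4 3,
    tt_ab B hB 4 3 5 0 1 2 6,
    tt_ab B hB 4 3 6 0 1 2 5]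
  unfold W
  ring

theorem W_sw4 (B : Gr) (hB : ∀ i j, B i j = B j i) :
    W (fun x y => B (![0, 1, 2, 3, 5, 4, 6] x) (![0, 1, 2, 3, 5, 4, 6] y)) = W B := by
  change tt B 0 1 2 3 5 4 6 +
    tt B 0 1 3 2 5 4 6 +
    tt B 0 1 5 2 3 4 6 +
    tt B 0 1 4 2 3 5 6 +
    tt B 0 1 6 2 3 5 4 +
    tt B 0 2 3 1 5 4 6 +
    tt B 0 2 5 1 3 4 6 +
    tt B 0 2 4 1 3 5 6 +
    tt B 0 2 6 1 3 5 4 +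
    tt B 0 3 5 1 2 4 6 +
    tt B 0 3 4 1 2 5 6 +
    tt B 0 3 6 1 2 5 4 +
    tt B 0 5 4 1 2 3 6 +
    tt B 0 5 6 1 2 3 4 +
    tt B 0 4 6 1 2 3 5 +
    tt B 1 2 3 0 5 4 6 +
    tt B 1 2 5 0 3 4 6 +
    tt B 1 2 4 0 3 5 6 +
    tt B 1 2 6 0 3 5 4 +
    tt B 1 3 5 0 2 4 6 +
    tt B 1 3 4 0 2 5 6 +
    tt B 1 3 6 0 2 5 4 +
    tt B 1 5 4 0 2 3 6 +
    tt B 1 5 6 0 2 3 4 +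
    tt B 1 4 6 0 2 3 5 +
    tt B 2 3 5 0 1 4 6 +
    tt B 2 3 4 0 1 5 6 +
    tt B 2 3 6 0 1 5 4 +
    tt B 2 5 4 0 1 3 6 +
    tt B 2 5 6 0 1 3 4 +
    tt B 2 4 6 0 1 3 5 +
    tt B 3 5 4 0 1 2 6 +
    tt B 3 5 6 0 1 2 4 +
    tt B 3 4 6 0 1 2 5 +
    tt B 5 4 6 0 1 2 3 = W B
  rw [tt_ef B hB 0 1 2 3 5 4 6,
    tt_ef B hB 0 1 3 2 5 4 6,
    tt_fh B hB 0 1 6 2 3 5 4,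
    tt_ef B hB 0 2 3 1 5 4 6,
    tt_fh B hB 0 2 6 1 3 5 4,
    tt_fh B hB 0 3 6 1 2 5 4,
    tt_bc B hB 0 5 4 1 2 3 6,
    tt_ef B hB 1 2 3 0 5 4 6,
    tt_fh B hB 1 2 6 0 3 5 4,
    tt_fh B hB 1 3 6 0 2 5 4,
    tt_bc B hB 1 5 4 0 2 3 6,
    tt_fh B hB 2 3 6 0 1 5 4,
    tt_bc B hB 2 5 4 0 1 3 6,
    tt_bc B hB 3 5 4 0 1 2 6,
    tt_ab B hB 5 4 6 0 1 2 3]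
  unfold W
  ring

theorem W_sw5 (B : Gr) (hB : ∀ i j, B i j = B j i) :
    W (fun x y => B (![0, 1, 2, 3, 4, 6, 5] x) (![0, 1, 2, 3, 4, 6, 5] y)) = W B := by
  change tt B 0 1 2 3 4 6 5 +
    tt B 0 1 3 2 4 6 5 +
    tt B 0 1 4 2 3 6 5 +
    tt B 0 1 6 2 3 4 5 +
    tt B 0 1 5 2 3 4 6 +
    tt B 0 2 3 1 4 6 5 +
    tt B 0 2 4 1 3 6 5 +
    tt B 0 2 6 1 3 4 5 +
    tt B 0 2 5 1 3 4 6 +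
    tt B 0 3 4 1 2 6 5 +
    tt B 0 3 6 1 2 4 5 +
    tt B 0 3 5 1 2 4 6 +
    tt B 0 4 6 1 2 3 5 +
    tt B 0 4 5 1 2 3 6 +
    tt B 0 6 5 1 2 3 4 +
    tt B 1 2 3 0 4 6 5 +
    tt B 1 2 4 0 3 6 5 +
    tt B 1 2 6 0 3 4 5 +
    tt B 1 2 5 0 3 4 6 +
    tt B 1 3 4 0 2 6 5 +
    tt B 1 3 6 0 2 4 5 +
    tt B 1 3 5 0 2 4 6 +
    tt B 1 4 6 0 2 3 5 +
    tt B 1 4 5 0 2 3 6 +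
    tt B 1 6 5 0 2 3 4 +
    tt B 2 3 4 0 1 6 5 +
    tt B 2 3 6 0 1 4 5 +
    tt B 2 3 5 0 1 4 6 +
    tt B 2 4 6 0 1 3 5 +
    tt B 2 4 5 0 1 3 6 +
    tt B 2 6 5 0 1 3 4 +
    tt B 3 4 6 0 1 2 5 +
    tt B 3 4 5 0 1 2 6 +
    tt B 3 6 5 0 1 2 4 +
    tt B 4 6 5 0 1 2 3 = W B
  rw [tt_fh B hB 0 1 2 3 4 6 5,
    tt_fh B hB 0 1 3 2 4 6 5,
    tt_fh B hB 0 1 4 2 3 6 5,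
    tt_fh B hB 0 2 3 1 4 6 5,
    tt_fh B hB 0 2 4 1 3 6 5,
    tt_fh B hB 0 3 4 1 2 6 5,
    tt_bc B hB 0 6 5 1 2 3 4,
    tt_fh B hB 1 2 3 0 4 6 5,
    tt_fh B hB 1 2 4 0 3 6 5,
    tt_fh B hB 1 3 4 0 2 6 5,
    tt_bc B hB 1 6 5 0 2 3 4,
    tt_fh B hB 2 3 4 0 1 6 5,
    tt_bc B hB 2 6 5 0 1 3 4,
    tt_bc B hB 3 6 5 0 1 2 4,
    tt_bc B hB 4 6 5 0 1 2 3]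
  unfold W
  ring


theorem W_swap (B : Gr) (hB : ∀ i j, B i j = B j i) (i : Fin 6) :
    W (fun x y => B (Equiv.swap i.castSucc i.succ x) (Equiv.swap i.castSucc i.succ y)) = W B := by
  fin_cases i
  · rw [← W_sw0 B hB]
    have e : ∀ x : Fin 7, Equiv.swap (Fin.castSucc (0 : Fin 6)) (Fin.succ (0 : Fin 6)) x
      = ![1, 0, 2, 3, 4, 5, 6] x := by decide
    congr 1; funext x y; exact congrArg₂ B (e x) (e y)
  · rw [← W_sw1 B hB]
    have e : ∀ x : Fin 7, Equiv.swap (Fin.castSucc (1 : Fin 6)) (Fin.succ (1 : Fin 6)) x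
      = ![0, 2, 1, 3, 4, 5, 6] x := by decide
    congr 1; funext x y; exact congrArg₂ B (e x) (e y)
  · rw [← W_sw2 B hB]
    have e : ∀ x : Fin 7, Equiv.swap (Fin.castSucc (2 : Fin 6)) (Fin.succ (2 : Fin 6)) x
      = ![0, 1, 3, 2, 4, 5, 6] x := by decide
    congr 1; funext x y; exact congrArg₂ B (e x) (e y)
  · rw [← W_sw3 B hB]
    have e : ∀ x : Fin 7, Equiv.swap (Fin.castSucc (3 : Fin 6)) (Fin.succ (3 : Fin 6)) x
      = ![0, 1, 2, 4, 3, 5, 6] x := by decide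
    congr 1; funext x y; exact congrArg₂ B (e x) (e y)
  · rw [← W_sw4 B hB]
    have e : ∀ x : Fin 7, Equiv.swap (Fin.castSucc (4 : Fin 6)) (Fin.succ (4 : Fin 6)) x
      = ![0, 1, 2, 3, 5, 4, 6] x := by decide
    congr 1; funext x y; exact congrArg₂ B (e x) (e y)
  · rw [← W_sw5 B hB]
    have e : ∀ x : Fin 7, Equiv.swap (Fin.castSucc (5 : Fin 6)) (Fin.succ (5 : Fin 6)) x
      = ![0, 1, 2, 3, 4, 6, 5] x := by decide
    congr 1; funext x y; exact congrArg₂ B (e x) (e y)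

theorem W_perm (σ : Equiv.Perm (Fin 7)) : ∀ (B : Gr), (∀ i j, B i j = B j i) →
    W (fun x y => B (σ x) (σ y)) = W B := by
  have hσ : σ ∈ Submonoid.closure
      (Set.range fun i : Fin 6 => Equiv.swap i.castSucc i.succ) := by
    rw [Equiv.Perm.mclosure_swap_castSucc_succ]; trivial
  induction hσ using Submonoid.closure_induction with
  | mem x hx =>
    obtain ⟨i, rfl⟩ := hx
    exact fun B hB => W_swap B hB i
  | one => intro B _; rfl
  | mul x y _ _ hx hy =>
    intro B hB
    have h1 := hy (fun i j => B (x i) (x j)) (fun i j => hB _ _)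
    rw [hx B hB] at h1
    exact h1

theorem W21_eq (B : Gr) (hB : ∀ i j, B i j = B j i) :
    W21 (B 0 1) (B 0 2) (B 1 2) (B 0 3) (B 1 3) (B 2 3) (B 0 4) (B 1 4) (B 2 4) (B 3 4) (B 0 5) (B 1 5) (B 2 5) (B 3 5) (B 4 5) (B 0 6) (B 1 6) (B 2 6) (B 3 6) (B 4 6) (B 5 6) = W B := by
  unfold W tt W21
  rw [hB 1 0, hB 2 0, hB 2 1, hB 3 0, hB 3 1, hB 3 2, hB 4 0, hB 4 1, hB 4 2, hB 4 3, hB 5 0, hB 5 1, hB 5 2, hB 5 3, hB 5 4, hB 6 0, hB 6 1, hB 6 2, hB 6 3, hB 6 4, hB 6 5]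
  simp only [Nat.add_eq]
  ring

def dat1 : List (Nat × List Nat) := [
  (0, [1754760, 3851912])]

def dat2 : List (Nat × List Nat) := [
  (0, [1754760, 5949064, 5949057, 14337672]),
  (1, [5949008, 14337553, 14337616, 16434824])]

def dat3 : List (Nat × List Nat) := [
  (0, [1754760, 18531976, 18531969, 52086408, 18531906, 52086352, 52086289, 119195272]),
  (2, [18531528, 52084826, 39503496, 56280712, 52085848, 89835144, 56280131, 123389576]),
  (6, [52085960, 56280264, 56280257, 64669320, 119194824, 123389128, 123389121, 131778184]),
  (7, [89834584, 123388057, 123388568, 131777050, 123389016, 131777561, 131777624, 133875336])]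

def dat4 : List (Nat × List Nat) := [
  (0, [1754760, 135972488, 135972481, 404407944, 135972418, 404407888, 404407825, 941278856, 135971907, 404407384, 404407321, 941278408, 404406810, 941277904, 941277393, 2015020680]),
  (8, [135968904, 404391011, 286967432, 421185160, 286967376, 421185104, 823838344, 958056072, 404403296, 1226491528, 421180036, 1494926984, 421180484, 1494926928, 958054539, 2031797896]),
  (24, [404404360, 421181576, 421181569, 454739592, 823834690, 723175048, 723175041, 991610504, 941274376, 1494923400, 1494923393, 1528481416, 958051396, 1796916872, 1796916865, 2065352328]),
  (56, [941275272, 958052488, 958052481, 991606920, 958052418, 991606864, 991606801, 1058719368, 2015017096, 2031794312, 2031794305, 2065348744, 2031794242, 2065348688, 2065348625, 2132461192]),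
  (18, [286962952, 823822097, 823825688, 723161300, 823830273, 710592136, 723162308, 979027592, 823833864, 723169364, 710591681, 979027137, 723170372, 979026584, 979026129, 2052769416]),
  (26, [421180680, 958038803, 723161363, 991593123, 723166984, 979010330, 861587080, 995804808, 958051592, 1796911188, 979023105, 1532675720, 991605856, 1532674131, 995800132, 2069546632]),
  (42, [1226487048, 1494910562, 710588552, 979010274, 1494918752, 1528471651, 979018464, 1532665948, 1494922336, 1528475746, 979022496, 1532670036, 1528476768, 1834665608, 1532671044, 2103101064]),
  (58, [1494922504, 1796911202, 979024008, 995801224, 1796908808, 1532665955, 995801098, 1062913672, 2031793416, 2065346658, 2052765832, 2069543048, 2065347680, 2103097480, 2069541956, 2136655496]),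
  (30, [454735112, 991593242, 991596826, 1058705690, 991602440, 995796744, 995796737, 1062899994, 991606024, 995800328, 995800321, 1062899987, 1058714888, 1062909192, 1062909185, 2077935240]),
  (62, [1528476936, 1532671240, 1532671233, 1062899938, 2065344264, 2069538568, 2069538561, 2077927624, 2065347848, 2069542152, 2069542145, 2077931656, 2132456712, 2136651016, 2136651009, 2145044104]),
  (63, [1834660960, 2103084705, 2103088800, 2136641762, 2103092832, 2136645857, 2136646368, 2145034787, 2103096416, 2136649889, 2136650400, 2145038882, 2136650848, 2145039393, 2145039456, 2147141256])]

def dat5 : List (Nat × List Nat) := [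
  (0, [1754760, 2149238408, 2149238401, 6444205704, 2149238338, 6444205648, 6444205585, 15034140296, 2149237827, 6444205144, 6444205081, 15034139848, 6444204570, 15034139344, 15034138833, 32214009480, 2149233732, 6444201056, 6444200993, 15034135816, 6444200482, 15034135312, 15034134801, 32214005896, 6444196387, 15034131224, 15034130713, 32214001864, 15034126618, 32213997776, 32213993681, 66573747848]),
  (64, [2149209736, 6444037228, 4430939784, 6578423432, 4430939728, 6578423376, 13020874376, 15168358024, 4430939224, 6578422872, 13020873928, 15168357576, 13020873424, 15168357072, 30200743560, 32348227208, 6444168296, 36643194504, 6578378373, 40938161800, 6578382405, 40938161744, 15168341644, 49528096392, 6578385989, 40938161240, 15168341196, 49528095944, 15168340692, 49528095440, 32348210828, 66707965576]),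
  (192, [6444177032, 6578394760, 6578394753, 6846858888, 13020845634, 11141826184, 11141826177, 15436793480, 13020845123, 11141825736, 11141825729, 15436793032, 26174211720, 28321695368, 28321695361, 32616662664, 15034103112, 40938133128, 40938133121, 41206597256, 15168316997, 45501564552, 45501564545, 49796531848, 15168320581, 45501564104, 45501564097, 49796531400, 60533950088, 62681433736, 62681433729, 66976401032]),
  (448, [15034111624, 15168329352, 15168329345, 15436764808, 15168329282, 15436764752, 15436764689, 15973664392, 30200714307, 28321666136, 28321666073, 24563598984, 28321665562, 24563598928, 24563598865, 33153533576, 32213973640, 49528067720, 49528067713, 49796503176, 49528067650, 49796503120, 49796503057, 50333402760, 32348189765, 62681404504, 62681404441, 58923337352, 62681403930, 58923337296, 58923337233, 67513271944]),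
  (960, [32213980808, 32348198536, 32348198529, 32616633992, 32348198466, 32616633936, 32616633873, 33153504904, 32348197955, 32616633432, 32616633369, 33153504456, 32616632858, 33153503952, 33153503441, 34227275400, 66573719176, 66707936904, 66707936897, 66976372360, 66707936834, 66976372304, 66976372241, 67513243272, 66707936323, 66976371800, 66976371737, 67513242824, 66976371226, 67513242320, 67513241809, 68587013768]),
  (136, [4430903944, 13020710233, 13020738912, 11141678365, 8876902024, 11024385672, 11024382081, 15319352968, 13020808513, 19614320264, 11141690629, 23909287560, 11024319501, 28204254856, 15319351435, 32499222152, 13020837192, 11141776477, 19614316673, 23909283969, 11024348229, 15319340704, 28204251265, 32499218561, 11141788741, 23909275296, 23909271705, 58269025928, 15319339171, 32499209888, 32499206297, 66858960520]),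
  (200, [6578387592, 15168181596, 11141678428, 15436616940, 11024356944, 15319180012, 13306087048, 15453570696, 11141760328, 23909112483, 21896021640, 24043505288, 13306049605, 28338472584, 30485956232, 32633439880, 15168320840, 45501514845, 23909251713, 41223374472, 15319311976, 45518341768, 28338455196, 49813309064, 15436756072, 41223357084, 24043467397, 58403243656, 15453533253, 49813291676, 32633422492, 66993178248]),
  (392, [13020838536, 26174162027, 11024349825, 13306058376, 11024349762, 13306058320, 13708740232, 15856223880, 26174174312, 20151191176, 13306008620, 24446158472, 13306012204, 24446158416, 15856222347, 33036093064, 30200707720, 28321645661, 28204219009, 28338422429, 28204218946, 28338422877, 48068478600, 50215962248, 28321657925, 54510929544, 28338434693, 58805896840, 28338435141, 58805896784, 50215960715, 67395831432]),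
  (456, [15168322184, 60533900395, 15319324296, 15453542024, 15319324240, 15453541968, 15856195208, 15990441608, 28321657960, 54510766731, 30485918341, 24580376200, 30485918789, 24580376144, 31022827144, 33170310792, 32348191368, 62681384029, 32499186305, 49813280392, 32499186242, 49813280336, 50215933576, 50350179976, 32616625256, 54645147272, 32633401989, 58940114568, 32633402437, 58940114512, 65382565512, 67530049160]),
  (584, [36643158664, 40937997419, 19614291592, 23909111979, 19614291536, 23909116011, 20151162504, 54510770315, 40938095720, 41206514796, 23909210280, 41223291557, 23909214312, 41223292005, 54510868616, 54645086344, 40938124392, 41206547563, 23909242536, 41223324317, 23909246568, 41223324765, 54510900872, 54645118600, 41206559848, 54913582728, 41223336581, 59208550024, 41223337029, 59208549968, 54645117067, 67798484616]),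
  (712, [40938125960, 45501514859, 23909258888, 24043476616, 28204226128, 28338443856, 24446129800, 24580347528, 45501498696, 41223291564, 24043475083, 25117247112, 28338442323, 29412214408, 24580345995, 33707181704, 49528059208, 49796482155, 58268997256, 58403214984, 32499181160, 49813259357, 58805868168, 58940085896, 49796494440, 59208521352, 58403205765, 59476985480, 49813271621, 63771952776, 58940084363, 68066920072]),
  (968, [49528060552, 62681384043, 32499193480, 32633411208, 32499193424, 32633411152, 33036064392, 33170282120, 62681396328, 54645082760, 32633409675, 33707153032, 32633409619, 33707152976, 33170280587, 34244052616, 66707929736, 66976351339, 66858931848, 66993149576, 66858931792, 66993149520, 67395802760, 67530020488, 66976363624, 67798455944, 66993140357, 68066891400, 66993140805, 68066891344, 67530018955, 68603790984]),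
  (216, [6846823048, 15436617059, 15436645731, 15973516643, 13708704322, 15856047389, 15856076061, 15990293789, 15436727624, 24043440776, 24043440769, 25117100707, 15856157765, 28372027016, 28372027009, 32666994312, 15436756296, 24043469448, 24043469441, 25117100700, 15856186437, 28372023432, 28372023425, 32666990728, 15973627208, 25117211272, 25117211265, 58436798088, 15990404165, 32666980515, 32666976931, 67026732680]),
  (344, [11141790344, 15319180131, 13306051201, 15856047452, 13306022466, 15856051043, 13608076936, 15755560584, 28321630800, 28338408016, 24446093953, 24345495176, 30485891650, 28371962448, 30787946120, 32935429768, 28321659528, 28338436744, 30485920385, 28371991176, 24446122562, 24345491536, 30787942480, 32935426128, 24563561576, 29412178568, 24580309637, 58705233544, 24580338757, 58705229904, 65147684488, 67295168136]),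
  (472, [15436757640, 15453534856, 15453534849, 15990293852, 15856187970, 15755531912, 15755531905, 16023996040, 24563534472, 24580311688, 24580311681, 24613930632, 31022762562, 28908897928, 28908897921, 33203865224, 32616626824, 32633404040, 32633404033, 32666958472, 33036057154, 32935393872, 32935393809, 50383734408, 33153496392, 33707145864, 33707145857, 58973669000, 33170273349, 63268636296, 63268636289, 67563603592]),
  (728, [41206561416, 41223338632, 41223338625, 25117100203, 48068442690, 24345466504, 24345466497, 24613901960, 49796465992, 58403179144, 58403179137, 58436737160, 50215896133, 58705172616, 58705172609, 58973608072, 49796494664, 58403207816, 58403207809, 58436769416, 50215924805, 58705204872, 58705204865, 58973640328, 50333365576, 59476949640, 59476949633, 59510539912, 50350142533, 63805507208, 63805507201, 68100474504]),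
  (856, [45501528712, 45518305928, 28338426027, 28371998344, 28338397292, 28371966032, 30787917441, 28908869256, 62681369168, 49813226604, 58805832321, 58705169032, 32633364588, 32666919020, 65147623490, 63268575312, 62681397896, 49813258923, 32633393323, 32666947755, 58805860930, 58705197648, 65147655809, 63268607624, 58923299944, 63771916936, 58940048005, 63805478536, 58940077125, 63805446224, 66221426312, 68368909960]),
  (984, [49796496008, 49813273224, 49813273217, 32666965640, 50215926338, 32935401096, 32935401089, 33203836552, 58923272840, 58940050056, 58940050049, 58973604488, 65382500930, 63268571728, 63268571665, 34277607048, 66976365192, 66993142408, 66993142401, 67026704008, 67395795522, 67295139464, 67295139457, 67563574920, 67513234760, 68066884232, 68066884225, 68100445832, 67530011717, 68368881288, 68368881281, 68637345416]),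
  (504, [15973628552, 15990405768, 15990405761, 16023960200, 15990405698, 16023960144, 16023960081, 16091104904, 33153469064, 33170246280, 33170246273, 33203800712, 33170246210, 33203800656, 33203800593, 33270974088, 33153497736, 33170274952, 33170274945, 33203829384, 33170274882, 33203829328, 33203829265, 33270970504, 34227239560, 34244016776, 34244016769, 34277571208, 34244016706, 34277571152, 34277571089, 67630712456]),
  (1016, [50333366920, 50350144136, 50350144129, 50383698568, 50350144066, 50383698512, 50383698449, 33270945416, 67513207432, 67529984648, 67529984641, 67563539080, 67529984578, 67563539024, 67563538961, 67630651528, 67513236104, 67530013320, 67530013313, 67563567752, 67530013250, 67563567696, 67563567633, 67630683784, 68586977928, 68603755144, 68603755137, 68637309576, 68603755074, 68637309520, 68637309457, 68704454280]),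
  (338, [19614283080, 28204087626, 20151145816, 24445982954, 28204153160, 48068364129, 24446048488, 24345383141, 20151153992, 24445991018, 22185428616, 24332912264, 24446056552, 24345391205, 24332810309, 32922846856, 28204217672, 48068429649, 24446113000, 24345448661, 48068437825, 45807748744, 24345449669, 50102716040, 24446121064, 24345456725, 24332874821, 32922838792, 24345457733, 50102715032, 32922830602, 67282585224]),
  (466, [23909250376, 28338296156, 54510884184, 24580199660, 28338360668, 24345383148, 24580264172, 24613818604, 24446121288, 30787907669, 24332883137, 24601347720, 30787844417, 28896315016, 24601347594, 33191282312, 32499184968, 50215913297, 58805851368, 58705187029, 50215921473, 50102687368, 58705188037, 50371151496, 33036055880, 32935391317, 32922809665, 58961086088, 32935392325, 63256053384, 58961085962, 67551020680]),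
  (978, [58268988744, 58805847889, 58805851480, 65147637973, 58805856065, 32922818184, 65147638981, 33191253640, 58805859656, 65147646037, 32922817729, 33191253185, 65147647045, 33191252632, 33191252177, 34265024136, 66858923336, 67395782481, 67395786072, 67295121621, 67395790657, 67282556552, 67295122629, 67550992008, 67395794248, 67295129685, 67282556097, 67550991553, 67295130693, 67550991000, 67550990545, 68624762504]),
  (410, [21895984456, 30485792593, 30485817184, 31022680410, 30485854529, 30787834155, 31022688096, 28908785949, 30485881668, 30787879018, 30787807016, 28896168275, 31022725441, 28896213320, 28908758789, 33073841800, 30485919048, 31022777171, 30787895979, 28908847773, 30787908712, 28896265050, 28896175940, 33073837124, 31022789960, 28908830805, 28896277825, 33073833729, 28908860485, 33073829088, 33073826001, 67433580168]),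
  (474, [24043468104, 32633263452, 24580199772, 33170134364, 28371925320, 32935253228, 28908786012, 33203688684, 24580339016, 65147517265, 24601283208, 33191105891, 28908796232, 33073666842, 31060575880, 33208059528, 32633402696, 65382515539, 65147638099, 63268586141, 32935392360, 63256003418, 33073804357, 50387928712, 33170273608, 63268472461, 33191245121, 58977863304, 33203827816, 50387911324, 33208022085, 67567797896]),
  (730, [41223337288, 54645097299, 29412067667, 33707006123, 24345454408, 32922671891, 28896168723, 33191105835, 49813243208, 58940031660, 58705150636, 58973586092, 32935356744, 58961003173, 33073768769, 58977802376, 49813271880, 58940064427, 58705183403, 58973618859, 32935389000, 58961035933, 33073801025, 58977834632, 50350142792, 63805343373, 50371114305, 59514734216, 50383697000, 63809701512, 50387891269, 68104668808]),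
  (986, [58403206472, 58940064595, 58705187155, 63268586155, 58705192776, 58961036122, 33073813128, 33208030856, 58940077384, 66221359210, 58961021576, 58977798792, 63268598888, 58977700435, 33207984684, 34281801352, 66993141064, 67529999187, 67295121747, 67563553451, 67295127368, 67550970714, 67433551496, 67567769224, 67530011976, 68368871509, 67550983489, 68104640136, 67563566184, 68104638547, 67567760453, 68641539720]),
  (874, [54913545544, 59208386154, 45807712904, 50102551274, 59208451688, 59476871275, 50102616808, 50371035947, 59208483944, 59476904042, 50102649512, 50371068714, 59476912232, 59510464620, 50371076904, 59514658917, 59208512616, 59476936298, 50102678184, 50371101418, 59476944488, 59510497387, 50371109608, 59514691677, 59476948072, 59510501482, 50371113640, 59514695765, 59510502504, 64111691400, 59514696773, 68406658696]),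
  (1002, [59208512840, 63771903594, 50102680200, 63256003306, 63771854664, 63805464683, 63255956168, 50387813100, 63771886920, 63805468778, 63255988872, 50387845804, 63805469800, 59514658924, 50387853868, 34315355784, 67798447432, 68066870890, 67282549384, 67550970602, 68066879080, 68100431979, 67550978792, 68104626269, 68066882664, 68100436074, 67550982824, 68104630357, 68100437096, 68406630024, 68104631365, 68675094152]),
  (506, [25117209928, 32666817891, 24613818723, 33203688803, 32666882403, 50383618915, 33203753315, 33270862179, 33707115848, 63268469066, 33191217800, 33207995016, 63268534600, 50387813219, 33207994890, 33275168392, 33707144520, 63268472650, 33191246472, 33208023688, 63268538184, 50387813212, 33208023562, 33275164808, 34244015432, 34277568618, 34264988296, 34281765512, 34277569640, 34315319944, 34281763909, 67634906760]),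
  (1018, [59476948296, 63805343562, 50371115656, 50387892872, 63805409096, 63809603400, 50387892746, 33275139720, 68066854216, 68368842858, 67550956168, 67567733384, 68368836936, 68104593516, 67567733258, 67634845832, 68066882888, 68368871530, 67550984840, 67567762056, 68368869192, 68104626283, 67567761930, 67634878088, 68603753800, 68637306986, 68624726664, 68641503880, 68637308008, 68675058312, 68641502277, 68708648584]),
  (990, [58436760904, 58973619034, 58973622618, 34277460314, 58973628232, 58977822536, 58977822529, 34281654618, 58973631816, 58977826120, 58977826113, 34281654611, 34277534024, 34281728328, 34281728321, 34290189960, 67026695496, 67563553626, 67563557210, 67630666074, 67563562824, 67567757128, 67567757121, 67634860378, 67563566408, 67567760712, 67567760705, 67634860371, 67630675272, 67634869576, 67634869569, 68649928328]),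
  (1022, [59510502728, 59514697032, 59514697025, 34315208938, 68100376392, 68104570696, 68104570689, 67634794795, 68100408648, 68104602952, 68104602945, 67634827562, 68637272392, 68641466696, 68641466689, 68649855752, 68100437320, 68104631624, 68104631617, 67634860266, 68637304648, 68641498952, 68641498945, 68649888456, 68637308232, 68641502536, 68641502529, 68649892488, 68704417096, 68708611400, 68708611393, 68717037192]),
  (1023, [64111653992, 68406494889, 68406527656, 68674947306, 68406560360, 68674980073, 68674984168, 68708536619, 68406592616, 68675012777, 68675016872, 68708569386, 68675020904, 68708573481, 68708573992, 68716962348, 68406621288, 68675045033, 68675049128, 68708602090, 68675053160, 68708606185, 68708606696, 68716995115, 68675056744, 68708610217, 68708610728, 68716999210, 68708611176, 68716999721, 68716999784, 68719134344])]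


def eN (i j : Nat) : Nat := cond (Nat.blt i j) (j * (j - 1) / 2 + i) (i * (i - 1) / 2 + j)

def pr7 : List (Nat × Nat) := [(0, 1), (0, 2), (1, 2), (0, 3), (1, 3), (2, 3), (0, 4), (1, 4), (2, 4), (3, 4), (0, 5), (1, 5), (2, 5), (3, 5), (4, 5), (0, 6), (1, 6), (2, 6), (3, 6), (4, 6), (5, 6)]

def sN (c i : Nat) : Nat := (c >>> (3 * i)) % 8

/-- check of a relabelling certificate -/
def certOK (k : Nat) (l : List Nat) (g c : Nat) : Bool :=
  l.elem (c >>> 21) && (List.range 7).all (fun i => Nat.blt (sN c i) 7) && Nat.beq (sN c 6) 6 &&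
  pr7.all fun p => (!(Nat.beq (sN c p.1) (sN c p.2))) &&
    cond (Nat.blt p.2 k) (Nat.blt (sN c p.1) k && Nat.blt (sN c p.2) k &&
      (Nat.testBit (c >>> 21) (eN p.1 p.2) == Nat.testBit g (eN (sN c p.1) (sN c p.2)))) true

def stepOK (k : Nat) (d : List (Nat × List Nat)) (l : List Nat) : Bool :=
  d.all fun p => Nat.blt p.1 (2 ^ (k * (k - 1) / 2)) &&
    (List.range (2 ^ k)).all fun m =>
      certOK (k + 1) l (2 ^ (k * (k - 1) / 2) * m + p.1) (p.2.getD m 0)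

theorem step1 : stepOK 1 dat1 (dat2.map Prod.fst) = true := by decide +kernel
theorem step2 : stepOK 2 dat2 (dat3.map Prod.fst) = true := by decide +kernel
theorem step3 : stepOK 3 dat3 (dat4.map Prod.fst) = true := by decide +kernel
theorem step4 : stepOK 4 dat4 (dat5.map Prod.fst) = true := by decide +kernel
theorem step5 : stepOK 5 dat5 lv6 = true := by decide +kernel


theorem main6a : (lv6.take 52).all chk6 = true := by decide +kernel
theorem main6b : ((lv6.drop 52).take 52).all chk6 = true := by decide +kernel
theorem main6c : ((lv6.drop 52).drop 52).all chk6 = true := by decide +kernel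

theorem main6 : lv6.all chk6 = true := by
  rw [← List.take_append_drop 52 lv6, List.all_append, main6a,
    ← List.take_append_drop 52 (lv6.drop 52), List.all_append, main6b, main6c]
  rfl


def deg (B : Gr) (i : Fin 7) : Nat := ∑ j, bn (B i j)

def Agree (B : Gr) (k r : Nat) : Prop :=
  ∀ i j : Fin 7, i < j → j.val < k → B i j = r.testBit (eN i j)

def Nice (k r : Nat) : Prop := ∀ B : Gr, (∀ i j, B i j = B j i) → (∀ i, B i i = false) →
  (∀ i, deg B i ≤ deg B 6) → Agree B k r → W B ≤ KK


theorem nice6 (r : Nat) (h : chk6 r = true) : Nice 6 r := by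
  intro B hB hI hM hA
  simp only [chk6, bf_eq, allB_iff] at h
  have h := h (B 0 6) (B 1 6) (B 2 6) (B 3 6) (B 4 6) (B 5 6)
  have a01 : Nat.testBit r 0 = B 0 1 := (hA 0 1 (by decide) (by decide)).symm
  have a02 : Nat.testBit r 1 = B 0 2 := (hA 0 2 (by decide) (by decide)).symm
  have a12 : Nat.testBit r 2 = B 1 2 := (hA 1 2 (by decide) (by decide)).symm
  have a03 : Nat.testBit r 3 = B 0 3 := (hA 0 3 (by decide) (by decide)).symm
  have a13 : Nat.testBit r 4 = B 1 3 := (hA 1 3 (by decide) (by decide)).symm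
  have a23 : Nat.testBit r 5 = B 2 3 := (hA 2 3 (by decide) (by decide)).symm
  have a04 : Nat.testBit r 6 = B 0 4 := (hA 0 4 (by decide) (by decide)).symm
  have a14 : Nat.testBit r 7 = B 1 4 := (hA 1 4 (by decide) (by decide)).symm
  have a24 : Nat.testBit r 8 = B 2 4 := (hA 2 4 (by decide) (by decide)).symm
  have a34 : Nat.testBit r 9 = B 3 4 := (hA 3 4 (by decide) (by decide)).symm
  have a05 : Nat.testBit r 10 = B 0 5 := (hA 0 5 (by decide) (by decide)).symm
  have a15 : Nat.testBit r 11 = B 1 5 := (hA 1 5 (by decide) (by decide)).symm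
  have a25 : Nat.testBit r 12 = B 2 5 := (hA 2 5 (by decide) (by decide)).symm
  have a35 : Nat.testBit r 13 = B 3 5 := (hA 3 5 (by decide) (by decide)).symm
  have a45 : Nat.testBit r 14 = B 4 5 := (hA 4 5 (by decide) (by decide)).symm
  rw [a01, a02, a12, a03, a13, a23, a04, a14, a24, a34, a05, a15, a25, a35, a45] at h
  unfold G21 at h
  have hm : mx21 (B 0 1) (B 0 2) (B 1 2) (B 0 3) (B 1 3) (B 2 3) (B 0 4) (B 1 4) (B 2 4) (B 3 4) (B 0 5) (B 1 5) (B 2 5) (B 3 5) (B 4 5) (B 0 6) (B 1 6) (B 2 6) (B 3 6) (B 4 6) (B 5 6) = true := by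
    unfold mx21
    simp only [Bool.and_eq_true, Nat.ble_eq, Nat.add_eq]
    have b0 : bn false = 0 := rfl
    have d0 := hM 0
    have d1 := hM 1
    have d2 := hM 2
    have d3 := hM 3
    have d4 := hM 4
    have d5 := hM 5
    simp only [deg, Fin.sum_univ_seven, hI, b0, hB 1 0, hB 2 0, hB 2 1, hB 3 0, hB 3 1, hB 3 2, hB 4 0, hB 4 1, hB 4 2, hB 4 3, hB 5 0, hB 5 1, hB 5 2, hB 5 3, hB 5 4, hB 6 0, hB 6 1, hB 6 2, hB 6 3, hB 6 4, hB 6 5] at d0 d1 d2 d3 d4 d5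
    refine ⟨⟨⟨⟨⟨?_, ?_⟩, ?_⟩, ?_⟩, ?_⟩, ?_⟩ <;> omega
  rw [hm, cond_true, Nat.ble_eq, W21_eq B hB] at h
  exact h


theorem pr7_mem (i j : Fin 7) (h : i < j) : ((i : Nat), (j : Nat)) ∈ pr7 := by
  revert i j; decide

theorem eN_comm (i j : Nat) (h : i ≠ j) : eN i j = eN j i := by
  unfold eN
  rcases Nat.lt_or_gt_of_ne h with h' | h'
  · have h2 : Nat.blt i j = true := by simpa [Nat.blt_eq] using h'
    have h3 : Nat.blt j i = false := by
      rw [Bool.eq_false_iff]; simp [Nat.blt_eq]; omega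
    rw [h2, h3]; rfl
  · have h2 : Nat.blt j i = true := by simpa [Nat.blt_eq] using h'
    have h3 : Nat.blt i j = false := by
      rw [Bool.eq_false_iff]; simp [Nat.blt_eq]; omega
    rw [h2, h3]; rfl

theorem Agree.all {B : Gr} {k r : Nat} (h : Agree B k r) (hB : ∀ i j, B i j = B j i)
    (i j : Fin 7) (hij : i ≠ j) (hi : i.val < k) (hj : j.val < k) :
    B i j = r.testBit (eN i j) := by
  rcases lt_or_gt_of_ne hij with h' | h'
  · exact h i j h' hj
  · rw [hB, eN_comm _ _ (fun e => hij (Fin.ext e))]; exact h j i h' hi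

theorem nice_cert (k : Nat) (l : List Nat) (g c : Nat) (h : certOK k l g c = true)
    (hl : ∀ r ∈ l, Nice k r) : Nice k g := by
  unfold certOK at h
  simp only [Bool.and_eq_true, List.all_eq_true, List.elem_iff, Nat.blt_eq,
    List.mem_range, Bool.not_eq_true'] at h
  obtain ⟨⟨⟨h1, h2⟩, h3⟩, h4⟩ := h
  have h3 := Nat.eq_of_beq_eq_true h3
  let s : Fin 7 → Fin 7 := fun i => ⟨sN c i, h2 i i.2⟩
  have hlt : ∀ i j : Fin 7, i < j → s i ≠ s j := by
    intro i j hij he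
    have := (h4 _ (pr7_mem i j hij)).1
    rw [Fin.ext_iff] at he
    simp only [s] at he
    simp [he] at this
  have hinj : Function.Injective s := by
    intro i j he
    by_contra hne
    rcases lt_or_gt_of_ne hne with h' | h'
    · exact hlt i j h' he
    · exact hlt j i h' he.symm
  let σ : Equiv.Perm (Fin 7) := Equiv.ofBijective s (Finite.injective_iff_bijective.1 hinj)
  have hσ : ∀ i, σ i = s i := fun i => rfl
  have h6 : σ 6 = 6 := by
    rw [hσ]; apply Fin.ext; exact h3
  intro B hB hI hM hA
  rw [← W_perm σ B hB]
  have hdeg : ∀ i, deg (fun x y => B (σ x) (σ y)) i = deg B (σ i) := by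
    intro i
    unfold deg
    exact Equiv.sum_comp σ (fun j => bn (B (σ i) j))
  refine hl _ h1 _ (fun i j => hB _ _) (fun i => hI _) ?_ ?_
  · intro i
    rw [hdeg, hdeg, h6]; exact hM _
  · intro i j hij hj
    have h5 := (h4 _ (pr7_mem i j hij)).2
    have hjb : Nat.blt (j : Nat) k = true := by simpa [Nat.blt_eq] using hj
    simp only [hjb, cond_true, Bool.and_eq_true, Nat.blt_eq, beq_iff_eq] at h5
    obtain ⟨⟨h5, h7⟩, h8⟩ := h5
    rw [h8]
    exact hA.all hB (s i) (s j) (hlt i j hij) h5 h7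

theorem tri_lt (I J k : Nat) (h1 : I < J) (h2 : J < k) (h3 : k < 6) :
    J * (J - 1) / 2 + I < k * (k - 1) / 2 := by
  interval_cases k <;> interval_cases J <;> omega

theorem nice_step (k : Nat) (hk : k < 6) (d : List (Nat × List Nat)) (l : List Nat)
    (h : stepOK k d l = true) (hl : ∀ r ∈ l, Nice (k + 1) r) :
    ∀ r ∈ d.map Prod.fst, Nice k r := by
  intro r hr
  obtain ⟨⟨r', cs⟩, hp, rfl⟩ := List.mem_map.1 hr
  unfold stepOK at h
  simp only [Bool.and_eq_true, List.all_eq_true, Nat.blt_eq, List.mem_range] at h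
  obtain ⟨hlt, h⟩ := h _ hp
  simp only at hlt h
  intro B hB hI hM hA
  let m : Nat := Nat.ofBits (fun i : Fin k => B ⟨i.val, by omega⟩ ⟨k, by omega⟩)
  have hm : m < 2 ^ k := Nat.ofBits_lt_two_pow _
  refine nice_cert _ _ _ _ (h m hm) hl B hB hI hM ?_
  intro i j hij hj
  rw [Nat.testBit_two_pow_mul_add _ hlt]
  have hij' : i.val < j.val := hij
  have e1 : eN i j = j.val * (j.val - 1) / 2 + i.val := by
    unfold eN
    have h2 : Nat.blt (i : Nat) j = true := by simpa [Nat.blt_eq] using hij'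
    rw [h2]; rfl
  rcases Nat.lt_or_ge j.val k with hjk | hjk
  · have e2 : eN i j < k * (k - 1) / 2 := by
      rw [e1]
      exact tri_lt _ _ _ hij' hjk hk
    rw [if_pos e2]
    exact hA i j hij hjk
  · have e3 : j.val = k := by omega
    have e2 : ¬ (eN i j < k * (k - 1) / 2) := by rw [e1, e3]; omega
    rw [if_neg e2, e1, e3, Nat.add_sub_cancel_left]
    have hik : i.val < k := by omega
    rw [Nat.testBit_ofBits_lt _ _ hik]
    congr 1
    exact Fin.ext e3

theorem W_le (B : Gr) (hB : ∀ i j, B i j = B j i) (hI : ∀ i, B i i = false) : W B ≤ KK := by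
  have n6 : ∀ r ∈ lv6, Nice 6 r := by
    intro r hr
    have := main6
    rw [List.all_eq_true] at this
    exact nice6 r (this r hr)
  have n5 := nice_step 5 (by norm_num) dat5 _ step5 n6
  have n4 := nice_step 4 (by norm_num) dat4 _ step4 n5
  have n3 := nice_step 3 (by norm_num) dat3 _ step3 n4
  have n2 := nice_step 2 (by norm_num) dat2 _ step2 n3
  have n1 := nice_step 1 (by norm_num) dat1 _ step1 n2
  have n0 : Nice 1 0 := n1 0 (by simp [dat1])
  obtain ⟨i, -, hi⟩ := Finset.exists_max_image Finset.univ (deg B) ⟨0, Finset.mem_univ _⟩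
  let σ : Equiv.Perm (Fin 7) := Equiv.swap 6 i
  have hdeg : ∀ i, deg (fun x y => B (σ x) (σ y)) i = deg B (σ i) := by
    intro i
    unfold deg
    exact Equiv.sum_comp σ (fun j => bn (B (σ i) j))
  rw [← W_perm σ B hB]
  refine n0 _ (fun i j => hB _ _) (fun i => hI _) ?_ ?_
  · intro j
    rw [hdeg, hdeg]
    have : σ 6 = i := Equiv.swap_apply_left _ _
    rw [this]
    exact hi _ (Finset.mem_univ _)
  · intro i j hij hj
    have : i.val < j.val := hij
    omega



theorem dotL_cons (x y : Nat) (X Y : List Nat) :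
    dotL (x :: X) (y :: Y) = x * y + dotL X Y := rfl
theorem sumL_cons (x : Nat) (X : List Nat) : sumL (x :: X) = x + sumL X := rfl
theorem dotL_nil (Y : List Nat) : dotL [] Y = 0 := rfl
theorem sumL_nil : sumL [] = 0 := rfl

theorem dotL_shift (c : ℤ) (N : Nat) : ∀ X Y : List Nat, X.length = N → Y.length = N →
    (dotL X Y : ℤ) + N * (c * c) - c * ((sumL X : ℤ) + sumL Y) =
      ∑ k ∈ Finset.range N, ((X.getD k 0 : ℤ) - c) * ((Y.getD k 0 : ℤ) - c) := by
  induction N with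
  | zero =>
    intro X Y hX hY
    rw [List.length_eq_zero_iff] at hX hY
    subst hX hY
    simp [dotL_nil, sumL_nil]
  | succ N ih =>
    intro X Y hX hY
    cases X with
    | nil => simp at hX
    | cons x X =>
      cases Y with
      | nil => simp at hY
      | cons y Y =>
        rw [Finset.sum_range_succ']
        simp only [List.getD_cons_succ, List.getD_cons_zero]
        rw [← ih X Y (by simpa using hX) (by simpa using hY), dotL_cons, sumL_cons, sumL_cons]
        push_cast
        ring

theorem psd_sum {t : Tr} {ls : List Lf} {N : Nat} (h : TabOK t ls N) {P : Type} [Fintype P]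
    (F : P → Lf) (hF : ∀ p, F p ∈ ls) :
    268435456 * (Fintype.card P * Fintype.card P) ≤ ∑ p, ∑ q, entry (F p) (F q) := by
  have key : ∀ p q, (67108864 : ℤ) * 268435456 + ∑ k ∈ Finset.range N,
      (((F p).vec.getD k 0 : ℤ) - 134217728) * (((F q).vec.getD k 0 : ℤ) - 134217728) ≤
      67108864 * (entry (F p) (F q) : ℤ) := by
    intro p q
    rw [← dotL_shift 134217728 N _ _ (h.len _ (hF p)) (h.len _ (hF q))]
    have := h.psd _ (hF p) _ (hF q)
    zify at this
    linarith
  have s1 := Finset.sum_le_sum fun p (_ : p ∈ Finset.univ) =>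
    Finset.sum_le_sum fun q (_ : q ∈ Finset.univ) => key p q
  have s2 : ∑ p, ∑ q, ∑ k ∈ Finset.range N,
      (((F p).vec.getD k 0 : ℤ) - 134217728) * (((F q).vec.getD k 0 : ℤ) - 134217728) =
      ∑ k ∈ Finset.range N, (∑ p, (((F p).vec.getD k 0 : ℤ) - 134217728)) ^ 2 := by
    simp only [sq, Finset.sum_mul_sum]
    refine Eq.symm (Finset.sum_comm.trans (Finset.sum_congr rfl fun p _ => ?_))
    exact Finset.sum_comm
  have s3 : 0 ≤ ∑ k ∈ Finset.range N, (∑ p, (((F p).vec.getD k 0 : ℤ) - 134217728)) ^ 2 :=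
    Finset.sum_nonneg fun _ _ => sq_nonneg _
  simp only [Finset.sum_add_distrib, s2, Finset.sum_const, Finset.card_univ, nsmul_eq_mul,
    ← Finset.mul_sum] at s1
  zify
  nlinarith

theorem U_sum {t : Tr} {ls : List Lf} {N : Nat} (h : TabOK t ls N) {V : Type} [Fintype V]
    (x y w : V → Bool) (z : V → V → Bool) :
    3 * 268435456 * Fintype.card V ^ 4 ≤ ∑ d, ∑ e, ∑ f, ∑ k,
      U t (x d) (y d) (w d) (x e) (y e) (w e) (x f) (y f) (w f) (x k) (y k) (w k)
        (z d e) (z d f) (z d k) (z e f) (z e k) (z f k) := by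
  have key := psd_sum h
    (fun p : V × V => t.path (x p.1) (y p.1) (w p.1) (x p.2) (y p.2) (w p.2) (z p.1 p.2))
    (fun p => h.mem ..)
  simp only [Fintype.sum_prod_type, Fintype.card_prod] at key
  set E : V → V → V → V → Nat := fun d e f k =>
    entry (t.path (x d) (y d) (w d) (x e) (y e) (w e) (z d e))
      (t.path (x f) (y f) (w f) (x k) (y k) (w k) (z f k)) with hE
  have e1 : ∀ d e f k, U t (x d) (y d) (w d) (x e) (y e) (w e) (x f) (y f) (w f) (x k) (y k) (w k)
        (z d e) (z d f) (z d k) (z e f) (z e k) (z f k) = E d e f k + (E d f e k + E d k e f) :=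
    fun _ _ _ _ => rfl
  simp only [e1, Finset.sum_add_distrib]
  have k1 : 268435456 * (Fintype.card V * Fintype.card V * (Fintype.card V * Fintype.card V)) ≤
    ∑ d, ∑ e, ∑ f, ∑ k, E d e f k := key
  have k2 : ∑ d, ∑ e, ∑ f, ∑ k, E d f e k = ∑ d, ∑ e, ∑ f, ∑ k, E d e f k :=
    Finset.sum_congr rfl fun d _ => Finset.sum_comm
  have k3 : ∑ d, ∑ e, ∑ f, ∑ k, E d k e f = ∑ d, ∑ e, ∑ f, ∑ k, E d e f k := by
    refine Finset.sum_congr rfl fun d _ => ?_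
    exact (Finset.sum_congr rfl fun e _ => Finset.sum_comm).trans Finset.sum_comm
  rw [k2, k3]
  have : Fintype.card V ^ 4 =
    Fintype.card V * Fintype.card V * (Fintype.card V * Fintype.card V) := by ring
  rw [this]
  omega

theorem TU_sum {V : Type} [Fintype V] (ab ac bc : Bool)
    (x y w : V → Bool) (z : V → V → Bool) :
    3 * 268435456 * Fintype.card V ^ 4 ≤ ∑ d, ∑ e, ∑ f, ∑ k,
      TU ab ac bc (x d) (y d) (w d) (x e) (y e) (w e) (x f) (y f) (w f) (x k) (y k) (w k)
        (z d e) (z d f) (z d k) (z e f) (z e k) (z f k) := by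
  unfold TU
  cases ab <;> cases ac <;> cases bc <;> simp only [cond_true, cond_false]
  · exact U_sum okA x y w z
  · exact U_sum okB y w x z
  · exact U_sum okB x w y z
  · exact U_sum okB (fun d => !x d) (fun d => !y d) (fun d => !w d) (fun d e => !z d e)
  · exact U_sum okB x y w z
  · exact U_sum okB (fun d => !x d) (fun d => !w d) (fun d => !y d) (fun d e => !z d e)
  · exact U_sum okB (fun d => !y d) (fun d => !w d) (fun d => !x d) (fun d e => !z d e)
  · exact U_sum okA (fun d => !x d) (fun d => !y d) (fun d => !w d) (fun d e => !z d e)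

/-- number of non-monochromatic quadruples -/
def NM {V : Type} [Fintype V] (A : V → V → Bool) : Nat :=
  ∑ d, ∑ e, ∑ f, ∑ k, nm (A d e) (A d f) (A d k) (A e f) (A e k) (A f k)

theorem TT_sum {V : Type} [Fintype V] (A : V → V → Bool) :
    Fintype.card V ^ 3 * (3 * 268435456 * Fintype.card V ^ 4 + 67108864 * NM A) ≤
      ∑ a, ∑ b, ∑ c, ∑ d, ∑ e, ∑ f, ∑ k,
      TT (A a b) (A a c) (A b c) (A d a) (A d b) (A d c) (A e a) (A e b) (A e c)
        (A f a) (A f b) (A f c) (A k a) (A k b) (A k c)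
        (A d e) (A d f) (A d k) (A e f) (A e k) (A f k) := by
  have key : ∀ a b c, 3 * 268435456 * Fintype.card V ^ 4 + 67108864 * NM A ≤
      ∑ d, ∑ e, ∑ f, ∑ k,
      TT (A a b) (A a c) (A b c) (A d a) (A d b) (A d c) (A e a) (A e b) (A e c)
        (A f a) (A f b) (A f c) (A k a) (A k b) (A k c)
        (A d e) (A d f) (A d k) (A e f) (A e k) (A f k) := by
    intro a b c
    have := TU_sum (A a b) (A a c) (A b c) (fun d => A d a) (fun d => A d b) (fun d => A d c) A
    simp only [TT, Nat.add_eq, Nat.mul_eq, Finset.sum_add_distrib, ← Finset.mul_sum]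
    unfold NM
    omega
  have s := Finset.sum_le_sum fun a (_ : a ∈ Finset.univ) =>
    Finset.sum_le_sum fun b (_ : b ∈ Finset.univ) =>
    Finset.sum_le_sum fun c (_ : c ∈ Finset.univ) => key a b c
  refine le_trans (le_of_eq ?_) s
  simp only [Finset.sum_const, Finset.card_univ, smul_eq_mul]
  ring

theorem sum_cons {V : Type} [Fintype V] {n : Nat} (f : (Fin (n + 1) → V) → Nat) :
    ∑ x, f x = ∑ a, ∑ x : Fin n → V, f (Fin.cons a x) := by
  rw [← (Fin.consEquiv (fun _ => V)).sum_comp, Fintype.sum_prod_type]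
  rfl

theorem sum_7 {V : Type} [Fintype V] (A : V → V → Bool) :
    ∑ x : Fin 7 → V, tt (fun i j => A (x i) (x j)) 0 1 2 3 4 5 6 =
      ∑ a, ∑ b, ∑ c, ∑ d, ∑ e, ∑ f, ∑ k,
      TT (A a b) (A a c) (A b c) (A d a) (A d b) (A d c) (A e a) (A e b) (A e c)
        (A f a) (A f b) (A f c) (A k a) (A k b) (A k c)
        (A d e) (A d f) (A d k) (A e f) (A e k) (A f k) := by
  simp only [sum_cons, Fintype.sum_unique]
  rfl

theorem sum_perm {V : Type} [Fintype V] (A : V → V → Bool) (p : Fin 7 → Fin 7)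
    (hp : Function.Injective p) :
    ∑ x : Fin 7 → V, tt (fun i j => A (x i) (x j)) (p 0) (p 1) (p 2) (p 3) (p 4) (p 5) (p 6) =
    ∑ x : Fin 7 → V, tt (fun i j => A (x i) (x j)) 0 1 2 3 4 5 6 := by
  let σ : Equiv.Perm (Fin 7) := Equiv.ofBijective p (Finite.injective_iff_bijective.1 hp)
  exact Fintype.sum_equiv (Equiv.arrowCongr σ.symm (Equiv.refl V)) _ _ (fun x => rfl)


theorem W_sum {V : Type} [Fintype V] (A : V → V → Bool) :
    ∑ x : Fin 7 → V, W (fun i j => A (x i) (x j)) =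
    35 * ∑ x : Fin 7 → V, tt (fun i j => A (x i) (x j)) 0 1 2 3 4 5 6 := by
  have sp := sum_perm A
  have h0 : ∑ x : Fin 7 → V, tt (fun i j => A (x i) (x j)) 0 1 2 3 4 5 6 = _ :=
    sp ![0, 1, 2, 3, 4, 5, 6] (by decide)
  have h1 : ∑ x : Fin 7 → V, tt (fun i j => A (x i) (x j)) 0 1 3 2 4 5 6 = _ :=
    sp ![0, 1, 3, 2, 4, 5, 6] (by decide)
  have h2 : ∑ x : Fin 7 → V, tt (fun i j => A (x i) (x j)) 0 1 4 2 3 5 6 = _ :=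
    sp ![0, 1, 4, 2, 3, 5, 6] (by decide)
  have h3 : ∑ x : Fin 7 → V, tt (fun i j => A (x i) (x j)) 0 1 5 2 3 4 6 = _ :=
    sp ![0, 1, 5, 2, 3, 4, 6] (by decide)
  have h4 : ∑ x : Fin 7 → V, tt (fun i j => A (x i) (x j)) 0 1 6 2 3 4 5 = _ :=
    sp ![0, 1, 6, 2, 3, 4, 5] (by decide)
  have h5 : ∑ x : Fin 7 → V, tt (fun i j => A (x i) (x j)) 0 2 3 1 4 5 6 = _ :=
    sp ![0, 2, 3, 1, 4, 5, 6] (by decide)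
  have h6 : ∑ x : Fin 7 → V, tt (fun i j => A (x i) (x j)) 0 2 4 1 3 5 6 = _ :=
    sp ![0, 2, 4, 1, 3, 5, 6] (by decide)
  have h7 : ∑ x : Fin 7 → V, tt (fun i j => A (x i) (x j)) 0 2 5 1 3 4 6 = _ :=
    sp ![0, 2, 5, 1, 3, 4, 6] (by decide)
  have h8 : ∑ x : Fin 7 → V, tt (fun i j => A (x i) (x j)) 0 2 6 1 3 4 5 = _ :=
    sp ![0, 2, 6, 1, 3, 4, 5] (by decide)
  have h9 : ∑ x : Fin 7 → V, tt (fun i j => A (x i) (x j)) 0 3 4 1 2 5 6 = _ :=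
    sp ![0, 3, 4, 1, 2, 5, 6] (by decide)
  have h10 : ∑ x : Fin 7 → V, tt (fun i j => A (x i) (x j)) 0 3 5 1 2 4 6 = _ :=
    sp ![0, 3, 5, 1, 2, 4, 6] (by decide)
  have h11 : ∑ x : Fin 7 → V, tt (fun i j => A (x i) (x j)) 0 3 6 1 2 4 5 = _ :=
    sp ![0, 3, 6, 1, 2, 4, 5] (by decide)
  have h12 : ∑ x : Fin 7 → V, tt (fun i j => A (x i) (x j)) 0 4 5 1 2 3 6 = _ :=
    sp ![0, 4, 5, 1, 2, 3, 6] (by decide)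
  have h13 : ∑ x : Fin 7 → V, tt (fun i j => A (x i) (x j)) 0 4 6 1 2 3 5 = _ :=
    sp ![0, 4, 6, 1, 2, 3, 5] (by decide)
  have h14 : ∑ x : Fin 7 → V, tt (fun i j => A (x i) (x j)) 0 5 6 1 2 3 4 = _ :=
    sp ![0, 5, 6, 1, 2, 3, 4] (by decide)
  have h15 : ∑ x : Fin 7 → V, tt (fun i j => A (x i) (x j)) 1 2 3 0 4 5 6 = _ :=
    sp ![1, 2, 3, 0, 4, 5, 6] (by decide)
  have h16 : ∑ x : Fin 7 → V, tt (fun i j => A (x i) (x j)) 1 2 4 0 3 5 6 = _ :=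
    sp ![1, 2, 4, 0, 3, 5, 6] (by decide)
  have h17 : ∑ x : Fin 7 → V, tt (fun i j => A (x i) (x j)) 1 2 5 0 3 4 6 = _ :=
    sp ![1, 2, 5, 0, 3, 4, 6] (by decide)
  have h18 : ∑ x : Fin 7 → V, tt (fun i j => A (x i) (x j)) 1 2 6 0 3 4 5 = _ :=
    sp ![1, 2, 6, 0, 3, 4, 5] (by decide)
  have h19 : ∑ x : Fin 7 → V, tt (fun i j => A (x i) (x j)) 1 3 4 0 2 5 6 = _ :=
    sp ![1, 3, 4, 0, 2, 5, 6] (by decide)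
  have h20 : ∑ x : Fin 7 → V, tt (fun i j => A (x i) (x j)) 1 3 5 0 2 4 6 = _ :=
    sp ![1, 3, 5, 0, 2, 4, 6] (by decide)
  have h21 : ∑ x : Fin 7 → V, tt (fun i j => A (x i) (x j)) 1 3 6 0 2 4 5 = _ :=
    sp ![1, 3, 6, 0, 2, 4, 5] (by decide)
  have h22 : ∑ x : Fin 7 → V, tt (fun i j => A (x i) (x j)) 1 4 5 0 2 3 6 = _ :=
    sp ![1, 4, 5, 0, 2, 3, 6] (by decide)
  have h23 : ∑ x : Fin 7 → V, tt (fun i j => A (x i) (x j)) 1 4 6 0 2 3 5 = _ :=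
    sp ![1, 4, 6, 0, 2, 3, 5] (by decide)
  have h24 : ∑ x : Fin 7 → V, tt (fun i j => A (x i) (x j)) 1 5 6 0 2 3 4 = _ :=
    sp ![1, 5, 6, 0, 2, 3, 4] (by decide)
  have h25 : ∑ x : Fin 7 → V, tt (fun i j => A (x i) (x j)) 2 3 4 0 1 5 6 = _ :=
    sp ![2, 3, 4, 0, 1, 5, 6] (by decide)
  have h26 : ∑ x : Fin 7 → V, tt (fun i j => A (x i) (x j)) 2 3 5 0 1 4 6 = _ :=
    sp ![2, 3, 5, 0, 1, 4, 6] (by decide)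
  have h27 : ∑ x : Fin 7 → V, tt (fun i j => A (x i) (x j)) 2 3 6 0 1 4 5 = _ :=
    sp ![2, 3, 6, 0, 1, 4, 5] (by decide)
  have h28 : ∑ x : Fin 7 → V, tt (fun i j => A (x i) (x j)) 2 4 5 0 1 3 6 = _ :=
    sp ![2, 4, 5, 0, 1, 3, 6] (by decide)
  have h29 : ∑ x : Fin 7 → V, tt (fun i j => A (x i) (x j)) 2 4 6 0 1 3 5 = _ :=
    sp ![2, 4, 6, 0, 1, 3, 5] (by decide)
  have h30 : ∑ x : Fin 7 → V, tt (fun i j => A (x i) (x j)) 2 5 6 0 1 3 4 = _ :=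
    sp ![2, 5, 6, 0, 1, 3, 4] (by decide)
  have h31 : ∑ x : Fin 7 → V, tt (fun i j => A (x i) (x j)) 3 4 5 0 1 2 6 = _ :=
    sp ![3, 4, 5, 0, 1, 2, 6] (by decide)
  have h32 : ∑ x : Fin 7 → V, tt (fun i j => A (x i) (x j)) 3 4 6 0 1 2 5 = _ :=
    sp ![3, 4, 6, 0, 1, 2, 5] (by decide)
  have h33 : ∑ x : Fin 7 → V, tt (fun i j => A (x i) (x j)) 3 5 6 0 1 2 4 = _ :=
    sp ![3, 5, 6, 0, 1, 2, 4] (by decide)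
  have h34 : ∑ x : Fin 7 → V, tt (fun i j => A (x i) (x j)) 4 5 6 0 1 2 3 = _ :=
    sp ![4, 5, 6, 0, 1, 2, 3] (by decide)
  simp only [W, Finset.sum_add_distrib]
  rw [h1, h2, h3, h4, h5, h6, h7, h8, h9, h10, h11, h12, h13, h14, h15, h16, h17, h18, h19, h20, h21, h22, h23, h24, h25, h26, h27, h28, h29, h30, h31, h32, h33, h34]
  ring

theorem NM_le {V : Type} [Fintype V] [Nonempty V] (A : V → V → Bool) (hA : ∀ i j, A i j = A j i)
    (hI : ∀ i, A i i = false) :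
    35 * (3 * 268435456 * Fintype.card V ^ 4 + 67108864 * NM A) ≤ KK * Fintype.card V ^ 4 := by
  have h1 : ∑ x : Fin 7 → V, W (fun i j => A (x i) (x j)) ≤ ∑ x : Fin 7 → V, KK :=
    Finset.sum_le_sum fun x _ => W_le _ (fun i j => hA _ _) (fun i => hI _)
  rw [W_sum, sum_7, Finset.sum_const, Finset.card_univ, Fintype.card_fun, Fintype.card_fin,
    smul_eq_mul] at h1
  have h2 := TT_sum A
  have hpos : 0 < Fintype.card V ^ 3 := Nat.pow_pos Fintype.card_pos
  refine Nat.le_of_mul_le_mul_left ?_ hpos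
  calc Fintype.card V ^ 3 * (35 * (3 * 268435456 * Fintype.card V ^ 4 + 67108864 * NM A))
      = 35 * (Fintype.card V ^ 3 * (3 * 268435456 * Fintype.card V ^ 4 + 67108864 * NM A)) := by
        ring
    _ ≤ _ := Nat.mul_le_mul_left 35 h2
    _ ≤ _ := h1
    _ = _ := by ring


theorem nm_zero (de df dh ef eh fh : Bool) (h : nm de df dh ef eh fh = 0) :
    (de = true ∧ df = true ∧ dh = true ∧ ef = true ∧ eh = true ∧ fh = true) ∨
    (de = false ∧ df = false ∧ dh = false ∧ ef = false ∧ eh = false ∧ fh = false) := by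
  revert h
  cases de <;> cases df <;> cases dh <;> cases ef <;> cases eh <;> cases fh <;> decide

theorem clique_of {n : ℕ} (G : SimpleGraph (Fin n)) [DecidableRel G.Adj] (x : Fin 4 ↪ Fin n)
    (h01 : G.Adj (x 0) (x 1)) (h02 : G.Adj (x 0) (x 2)) (h03 : G.Adj (x 0) (x 3))
    (h12 : G.Adj (x 1) (x 2)) (h13 : G.Adj (x 1) (x 3)) (h23 : G.Adj (x 2) (x 3)) :
    Finset.univ.map x ∈ G.cliqueFinset 4 := by
  rw [SimpleGraph.mem_cliqueFinset_iff, SimpleGraph.isNClique_iff]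
  refine ⟨?_, by simp⟩
  intro a ha b hb hab
  simp only [Finset.coe_map, Set.mem_image, Finset.coe_univ, Set.mem_univ, true_and] at ha hb
  obtain ⟨i, rfl⟩ := ha
  obtain ⟨j, rfl⟩ := hb
  fin_cases i <;> fin_cases j <;>
    first
    | exact absurd rfl hab
    | assumption
    | (refine SimpleGraph.Adj.symm ?_; assumption)

theorem fiber_le {n : ℕ} (S : Finset (Fin 4 ↪ Fin n)) (b : Finset (Fin n)) (hb : b.card = 4) :
    (S.filter fun x => Finset.univ.map x = b).card ≤ 24 := by
  have : Fintype.card (Fin 4 ↪ b) = 24 := by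
    rw [Fintype.card_embedding_eq]; simp [hb]
  rw [← this, ← Finset.card_univ]
  have hm : ∀ x ∈ S.filter (fun x => Finset.univ.map x = b), ∀ i, x i ∈ b := by
    intro x hx i
    rw [← (Finset.mem_filter.1 hx).2]
    exact Finset.mem_map_of_mem x (Finset.mem_univ i)
  refine Finset.card_le_card_of_injOn
    (fun x => if hx : ∀ i, x i ∈ b then ⟨fun i => ⟨x i, hx i⟩, fun i j hij => by
      simpa using hij⟩ else (Fintype.card_pos_iff.1 (by omega)).some) (fun _ _ => by simp) ?_
  intro x hx y hy hxy
  simp only [dif_pos (hm x hx), dif_pos (hm y hy)] at hxy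
  ext i
  have := DFunLike.congr_fun hxy i
  exact congrArg (fun z : b => (z : Fin n).val) this

theorem clique_count {n : ℕ} (G : SimpleGraph (Fin n)) :
    n.descFactorial 4 ≤ NM (fun i j => decide (G.Adj i j)) +
      24 * ((G.cliqueFinset 4).card + (Gᶜ.cliqueFinset 4).card) := by
  set A : Fin n → Fin n → Bool := fun i j => decide (G.Adj i j) with hA
  let g : (Fin 4 → Fin n) → Nat := fun x =>
    nm (A (x 0) (x 1)) (A (x 0) (x 2)) (A (x 0) (x 3)) (A (x 1) (x 2)) (A (x 1) (x 3))
      (A (x 2) (x 3))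
  have h1 : NM A = ∑ x, g x := by
    simp only [sum_cons, Fintype.sum_unique]
    rfl
  have h2 : ∑ x : Fin 4 ↪ Fin n, g x ≤ ∑ x, g x := by
    have e : ∑ x : Fin 4 ↪ Fin n, g x = ∑ x ∈ Finset.univ.map
        (⟨fun x : Fin 4 ↪ Fin n => (x : Fin 4 → Fin n), DFunLike.coe_injective⟩ :
          (Fin 4 ↪ Fin n) ↪ (Fin 4 → Fin n)), g x := by
      rw [Finset.sum_map]; rfl
    rw [e]
    exact Finset.sum_le_sum_of_subset (Finset.subset_univ _)
  have h3 : n.descFactorial 4 = ∑ x : Fin 4 ↪ Fin n, 1 := by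
    simp [Fintype.card_embedding_eq]
  have h4 : ∑ x : Fin 4 ↪ Fin n, 1 ≤ ∑ x : Fin 4 ↪ Fin n, (g x + if g x = 0 then 1 else 0) := by
    refine Finset.sum_le_sum fun x _ => ?_
    split_ifs with h <;> omega
  rw [Finset.sum_add_distrib, ← Finset.card_filter] at h4
  have h5 : (Finset.univ.filter fun x : Fin 4 ↪ Fin n => g x = 0).card ≤
      24 * (G.cliqueFinset 4 ∪ Gᶜ.cliqueFinset 4).card := by
    refine Finset.card_le_mul_card_image_of_maps_to (f := fun x => Finset.univ.map x) ?_ 24 ?_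
    · intro x hx
      have h0 := (Finset.mem_filter.1 hx).2
      have ne : ∀ i j : Fin 4, i ≠ j → x i ≠ x j := fun i j hij h => hij (x.injective h)
      rw [Finset.mem_union]
      rcases nm_zero _ _ _ _ _ _ h0 with h | h
      · left
        simp only [hA, decide_eq_true_eq] at h
        obtain ⟨a, b, c, d, e, f⟩ := h
        exact clique_of G x a b c d e f
      · right
        simp only [hA, decide_eq_false_iff_not] at h
        obtain ⟨a, b, c, d, e, f⟩ := h
        refine clique_of Gᶜ x ?_ ?_ ?_ ?_ ?_ ?_ <;> rw [SimpleGraph.compl_adj]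
        · exact ⟨ne _ _ (by decide), a⟩
        · exact ⟨ne _ _ (by decide), b⟩
        · exact ⟨ne _ _ (by decide), c⟩
        · exact ⟨ne _ _ (by decide), d⟩
        · exact ⟨ne _ _ (by decide), e⟩
        · exact ⟨ne _ _ (by decide), f⟩
    · intro b hb
      have hb4 : b.card = 4 := by
        rw [Finset.mem_union, SimpleGraph.mem_cliqueFinset_iff,
          SimpleGraph.mem_cliqueFinset_iff] at hb
        rcases hb with hb | hb
        · exact hb.card_eq
        · exact hb.card_eq
      exact fiber_le _ b hb4
  have h6 := Finset.card_union_le (G.cliqueFinset 4) (Gᶜ.cliqueFinset 4)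
  omega

theorem k4_bound (n : ℕ) (hn : 0 < n) :
    35 * (67108864 * (24 * n.choose 4)) ≤
      35 * (67108864 * (24 * k4 n)) + (KK - 105 * 268435456) * n ^ 4 := by
  have hmem : k4 n ∈ { m | ∃ G : SimpleGraph (Fin n),
      m = (G.cliqueFinset 4).card + (Gᶜ.cliqueFinset 4).card } := Nat.sInf_mem ⟨_, ⊥, rfl⟩
  obtain ⟨G, hG⟩ := hmem
  have h1 := clique_count G
  rw [← hG, Nat.descFactorial_eq_factorial_mul_choose] at h1
  have : Nonempty (Fin n) := ⟨⟨0, hn⟩⟩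
  have h2 := NM_le (fun i j => decide (G.Adj i j))
    (fun i j => by simp only [G.adj_comm]) (fun i => by simp)
  rw [Fintype.card_fin] at h2
  have h3 : Nat.factorial 4 = 24 := rfl
  rw [h3] at h1
  generalize NM (fun i j => decide (G.Adj i j)) = M at *
  unfold KK at *
  generalize n ^ 4 = N at *
  omega

theorem k4_ratio (n : ℕ) (hn : 4 ≤ n) :
    (1 : ℝ) - (1 - 204603019 / 7112448000) * ((n : ℝ) ^ 4 / (24 * (n.choose 4 : ℝ))) ≤
      (k4 n : ℝ) / (n.choose 4 : ℝ) := by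
  have hC : (0 : ℝ) < n.choose 4 := by exact_mod_cast Nat.choose_pos hn
  have h := k4_bound n (by omega)
  unfold KK at h
  norm_num at h
  have h' : (35 * (67108864 * (24 * (n.choose 4 : ℝ)))) ≤
      35 * (67108864 * (24 * (k4 n : ℝ))) + ((30466965150 - 105 * 268435456 : ℕ) : ℝ) * (n : ℝ) ^ 4 := by
    exact_mod_cast h
  norm_num at h'
  have hn4 : (0 : ℝ) ≤ (n : ℝ) ^ 4 := by positivity
  rw [le_div_iff₀ hC]
  have e : (1 - (1 - 204603019 / 7112448000) * ((n : ℝ) ^ 4 / (24 * (n.choose 4 : ℝ)))) *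
      (n.choose 4 : ℝ) = n.choose 4 - (1 - 204603019 / 7112448000) * ((n : ℝ) ^ 4 / 24) := by
    field_simp
  rw [e]
  linarith

theorem k4_le (n : ℕ) (hn : 4 ≤ n) : (k4 n : ℝ) / (n.choose 4 : ℝ) ≤ 2 := by
  have hC : (0 : ℝ) < n.choose 4 := by exact_mod_cast Nat.choose_pos hn
  rw [div_le_iff₀ hC]
  have hmem : k4 n ∈ { m | ∃ G : SimpleGraph (Fin n),
      m = (G.cliqueFinset 4).card + (Gᶜ.cliqueFinset 4).card } := Nat.sInf_mem ⟨_, ⊥, rfl⟩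
  obtain ⟨G, h1⟩ := hmem
  have h2 : ∀ (G : SimpleGraph (Fin n)) [DecidableRel G.Adj], (G.cliqueFinset 4).card ≤ n.choose 4 := by
    intro G _
    have : G.cliqueFinset 4 ⊆ Finset.powersetCard 4 Finset.univ := by
      intro s hs
      rw [SimpleGraph.mem_cliqueFinset_iff] at hs
      rw [Finset.mem_powersetCard]
      exact ⟨Finset.subset_univ _, hs.card_eq⟩
    have := Finset.card_le_card this
    rwa [Finset.card_powersetCard, Finset.card_univ, Fintype.card_fin] at this
  have h3 := h2 G
  have h4 := h2 Gᶜ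
  have : k4 n ≤ 2 * n.choose 4 := by omega
  exact_mod_cast this

theorem lim_one : Filter.Tendsto (fun n : ℕ => (n : ℝ) ^ 4 / (24 * (n.choose 4 : ℝ)))
    Filter.atTop (nhds 1) := by
  have h := (isEquivalent_choose 4).symm
  rw [Asymptotics.isEquivalent_iff_tendsto_one] at h
  · refine h.congr' ?_
    filter_upwards [Filter.eventually_ge_atTop 4] with n hn
    have hC : (n.choose 4 : ℝ) ≠ 0 := by exact_mod_cast (Nat.choose_pos hn).ne'
    have : ((Nat.factorial 4 : ℕ) : ℝ) = 24 := by norm_num [Nat.factorial]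
    simp only [Pi.div_apply, this]
    field_simp
  · filter_upwards [Filter.eventually_ge_atTop 4] with n hn
    exact_mod_cast (Nat.choose_pos hn).ne'

theorem c4_lower_bound : c4 ≥ 204603019 / 7112448000 := by
  unfold c4
  have hl : Filter.Tendsto (fun n : ℕ => (1 : ℝ) - (1 - 204603019 / 7112448000) *
      ((n : ℝ) ^ 4 / (24 * (n.choose 4 : ℝ)))) Filter.atTop
      (nhds (1 - (1 - 204603019 / 7112448000) * 1)) :=
    tendsto_const_nhds.sub (lim_one.const_mul _)
  have e : (1 : ℝ) - (1 - 204603019 / 7112448000) * 1 = 204603019 / 7112448000 := by ring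
  rw [e] at hl
  rw [ge_iff_le, ← hl.liminf_eq]
  refine Filter.liminf_le_liminf ?_ ?_ ?_
  · filter_upwards [Filter.eventually_ge_atTop 4] with n hn
    exact k4_ratio n hn
  · exact hl.isBoundedUnder_ge
  · refine Filter.IsBoundedUnder.isCoboundedUnder_ge ?_
    refine ⟨2, ?_⟩
    rw [Filter.eventually_map]
    filter_upwards [Filter.eventually_ge_atTop 4] with n hn
    exact k4_le n hn
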